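/- arXiv:1002.1540 — 3 statements merged into one kernel-verified Lean document; each statement's English description precedes it below -/
import Mathlib

section
/- For every α ∈ (1,2), the function f_{U_α} is nonnegative on (0,∞) and ∫₀^∞ f_{U_α}(t) dt = 1; that is, f_{U_α} is a probability density on (0,∞). -/
open Real MeasureTheory Set

/-- Integrability of `t ^ (c - 1) * exp (-(r * t))` on the positive half-line. -/
lemma integrableOn_rpow_sub_one_mul_exp_neg_mul {c r : ℝ} (hc : 0 < c) (hr : 0 < r) :
    IntegrableOn (fun t : ℝ => t ^ (c - 1) * Real.exp (-(r * t))) (Ioi 0) := by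
  simpa using integrableOn_rpow_mul_exp_neg_mul_rpow (p := 1) (s := c - 1) (b := r)
    (by linarith) one_pos hr

lemma norm_cpow_sub_one_mul_exp_neg_mul (a r : ℂ) {t : ℝ} (ht : 0 < t) :
    ‖(t : ℂ) ^ (a - 1) * Complex.exp (-(r * t))‖ =
      t ^ (a.re - 1) * Real.exp (-(r.re * t)) := by
  rw [norm_mul, Complex.norm_cpow_eq_rpow_re_of_pos ht, Complex.norm_exp]
  simp

lemma integrableOn_cpow_sub_one_mul_exp_neg_mul {a r : ℂ} (ha : 0 < a.re) (hr : 0 < r.re) :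
    IntegrableOn (fun t : ℝ => (t : ℂ) ^ (a - 1) * Complex.exp (-(r * t))) (Ioi 0) := by
  refine (integrableOn_rpow_sub_one_mul_exp_neg_mul ha hr).mono' (by fun_prop) ?_
  filter_upwards [ae_restrict_mem measurableSet_Ioi] with t ht
  exact (norm_cpow_sub_one_mul_exp_neg_mul a r ht).le

/-- The Laplace transform of `t ^ (a - 1)` is holomorphic on the right half-plane. -/
lemma differentiableAt_integral_cpow_mul_exp_neg_mul {a r : ℂ} (ha : 0 < a.re) (hr : 0 < r.re) :
    DifferentiableAt ℂ
      (fun z : ℂ => ∫ t in Ioi (0 : ℝ), (t : ℂ) ^ (a - 1) * Complex.exp (-(z * t))) r := by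
  have hs : {z : ℂ | r.re / 2 < z.re} ∈ nhds r :=
    (isOpen_lt continuous_const Complex.continuous_re).mem_nhds (by simpa using hr)
  have hb := integrableOn_rpow_sub_one_mul_exp_neg_mul (c := a.re + 1) (by linarith) (half_pos hr)
  refine (hasDerivAt_integral_of_dominated_loc_of_deriv_le (μ := volume.restrict (Ioi 0))
    (F := fun (z : ℂ) (t : ℝ) => (t : ℂ) ^ (a - 1) * Complex.exp (-(z * t)))
    (F' := fun (z : ℂ) (t : ℝ) => (t : ℂ) ^ (a - 1) * (Complex.exp (-(z * t)) * (-t))) hs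
    (.of_forall fun z => by fun_prop) (integrableOn_cpow_sub_one_mul_exp_neg_mul ha hr)
    (by fun_prop) ?_ hb ?_).2.differentiableAt
  · filter_upwards [ae_restrict_mem measurableSet_Ioi] with t ht z hz
    have ht : 0 < t := ht
    rw [← mul_assoc, norm_mul, norm_cpow_sub_one_mul_exp_neg_mul a z ht, norm_neg,
      Complex.norm_of_nonneg ht.le, mul_right_comm, ← Real.rpow_add_one ht.ne',
      sub_add_cancel, add_sub_cancel_right]
    have hz : r.re / 2 < z.re := hz
    gcongr
  · filter_upwards with t z _
    refine HasDerivAt.const_mul _ (HasDerivAt.cexp ?_)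
    exact (hasDerivAt_mul_const (t : ℂ)).fun_neg

/-- The Gamma integral with a complex rate: extends
`Complex.integral_cpow_mul_exp_neg_mul_Ioi` from `r > 0` to `0 < re r`. -/
lemma integral_cpow_mul_exp_neg_mul_Ioi_of_re_pos {a r : ℂ} (ha : 0 < a.re) (hr : 0 < r.re) :
    ∫ t in Ioi (0 : ℝ), (t : ℂ) ^ (a - 1) * Complex.exp (-(r * t)) =
      (1 / r) ^ a * Complex.Gamma a := by
  have hopen : IsOpen {z : ℂ | 0 < z.re} := isOpen_lt continuous_const Complex.continuous_re
  have hF : AnalyticOnNhd ℂ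
      (fun z : ℂ => ∫ t in Ioi (0 : ℝ), (t : ℂ) ^ (a - 1) * Complex.exp (-(z * t)))
      {z : ℂ | 0 < z.re} :=
    DifferentiableOn.analyticOnNhd (fun z hz =>
      (differentiableAt_integral_cpow_mul_exp_neg_mul ha hz).differentiableWithinAt) hopen
  have hG : AnalyticOnNhd ℂ (fun z : ℂ => (1 / z) ^ a * Complex.Gamma a) {z : ℂ | 0 < z.re} := by
    refine DifferentiableOn.analyticOnNhd (fun z hz => ?_) hopen
    have hz : 0 < z.re := hz
    have hz0 : z ≠ 0 := fun h => by simp [h] at hz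
    have hmem : 1 / z ∈ Complex.slitPlane := by
      refine Or.inl ?_
      rw [one_div, Complex.inv_re]
      exact div_pos hz (Complex.normSq_pos.mpr hz0)
    refine DifferentiableAt.differentiableWithinAt (DifferentiableAt.mul_const ?_ _)
    exact ((differentiableAt_const 1).div differentiableAt_id hz0).cpow_const hmem
  refine hF.eqOn_of_preconnected_of_frequently_eq hG
    (convex_halfSpace_re_gt 0).isPreconnected (z₀ := 1) (by simp) ?_ hr
  have htend : Filter.Tendsto (fun x : ℝ => (x : ℂ)) (nhdsWithin 1 {1}ᶜ) (nhdsWithin 1 {1}ᶜ) := by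
    refine tendsto_nhdsWithin_iff.mpr ⟨?_, ?_⟩
    · exact (Complex.continuous_ofReal.tendsto' 1 1 (by simp)).mono_left nhdsWithin_le_nhds
    · filter_upwards [self_mem_nhdsWithin] with x hx
      simpa using hx
  refine htend.frequently (Filter.Eventually.frequently ?_)
  filter_upwards [nhdsWithin_le_nhds (Ioi_mem_nhds (zero_lt_one' ℝ))] with x hx
  exact Complex.integral_cpow_mul_exp_neg_mul_Ioi ha hx

lemma one_div_mul_ofReal_cpow {a : ℂ} (ha : a ≠ 0) {x : ℝ} (hx : 0 < x) (s : ℂ) :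
    (1 / (a * x)) ^ s = (1 / a) ^ s * (x : ℂ) ^ (-s) := by
  have hx' : (x : ℂ) ≠ 0 := by exact_mod_cast hx.ne'
  have h : 1 / (a * x) = ((x⁻¹ : ℝ) : ℂ) * (1 / a) := by push_cast; field_simp
  have hx0 : ((x⁻¹ : ℝ) : ℂ) ≠ 0 := by exact_mod_cast (inv_pos.mpr hx).ne'
  have ha' : 1 / a ≠ 0 := one_div_ne_zero ha
  rw [h, Complex.cpow_def_of_ne_zero (mul_ne_zero hx0 ha'), Complex.cpow_def_of_ne_zero ha',
    Complex.cpow_def_of_ne_zero hx', Complex.log_ofReal_mul (inv_pos.mpr hx) ha',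
    Real.log_inv, ← Complex.exp_add, Complex.ofReal_neg, Complex.ofReal_log hx.le]
  ring_nf

lemma cpow_mul_exp_neg_add_mul_eq (a b s : ℂ) (t x : ℝ) :
    (t : ℂ) ^ (s - 1) * Complex.exp (-((b + a * t) * x)) =
      Complex.exp (-(b * x)) * ((t : ℂ) ^ (s - 1) * Complex.exp (-(a * x * t))) := by
  rw [mul_left_comm, ← Complex.exp_add]
  ring_nf

/-- The double-integral kernel `t ^ (s - 1) * exp (-((b + a t) x))` is integrable on the positive
quadrant. -/
lemma integrable_cpow_mul_exp_neg_add_mul {a b s : ℂ} (ha : 0 < a.re) (hb : 0 < b.re)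
    (hs : 0 < s.re) (hs1 : s.re < 1) :
    Integrable (Function.uncurry fun t x : ℝ =>
        (t : ℂ) ^ (s - 1) * Complex.exp (-((b + a * t) * x)))
      ((volume.restrict (Ioi 0)).prod (volume.restrict (Ioi 0))) := by
  have hax : ∀ {x : ℝ}, 0 < x → 0 < (a * x).re := fun {x} hx => by
    simpa using mul_pos ha hx
  refine (integrable_prod_iff' ?_).mpr ⟨?_, ?_⟩
  · refine Measurable.aestronglyMeasurable ?_
    unfold Function.uncurry
    fun_prop
  · filter_upwards [ae_restrict_mem measurableSet_Ioi] with x hx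
    simp only [Function.uncurry, cpow_mul_exp_neg_add_mul_eq]
    exact (integrableOn_cpow_sub_one_mul_exp_neg_mul hs (hax hx)).const_mul _
  · have hint : IntegrableOn (fun x : ℝ => ((1 / a.re) ^ s.re * Real.Gamma s.re) *
        (x ^ ((1 - s.re) - 1) * Real.exp (-(b.re * x)))) (Ioi 0) :=
      (integrableOn_rpow_sub_one_mul_exp_neg_mul (sub_pos.mpr hs1) hb).const_mul _
    refine hint.congr_fun (fun x hx => ?_) measurableSet_Ioi
    have hx : 0 < x := hx
    have hnorm : ∀ t ∈ Ioi (0 : ℝ),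
        ‖(t : ℂ) ^ (s - 1) * Complex.exp (-((b + a * t) * x))‖ =
          Real.exp (-(b.re * x)) * (t ^ (s.re - 1) * Real.exp (-(a.re * x * t))) := by
      intro t ht
      rw [cpow_mul_exp_neg_add_mul_eq, norm_mul, norm_cpow_sub_one_mul_exp_neg_mul _ _ ht, Complex.norm_exp]
      simp
    simp only [Function.uncurry]
    rw [setIntegral_congr_fun measurableSet_Ioi hnorm, integral_const_mul,
      Real.integral_rpow_mul_exp_neg_mul_Ioi hs (mul_pos ha hx), ← one_div_mul_one_div,
      Real.mul_rpow (by positivity) (by positivity), one_div x, Real.inv_rpow hx.le,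
      ← Real.rpow_neg hx.le]
    ring_nf

lemma integral_exp_neg_mul_Ioi_zero {w : ℂ} (hw : 0 < w.re) :
    ∫ x in Ioi (0 : ℝ), Complex.exp (-(w * x)) = 1 / w := by
  have := integral_exp_mul_complex_Ioi (a := -w) (by simpa using hw) 0
  simpa [neg_div_neg_eq] using this

lemma re_add_mul_ofReal_pos {a b : ℂ} (ha : 0 < a.re) (hb : 0 < b.re) {t : ℝ} (ht : 0 < t) :
    0 < (b + a * t).re := by
  simpa using add_pos hb (mul_pos ha ht)

lemma integral_cpow_mul_exp_neg_add_mul {a b : ℂ} (ha : 0 < a.re) (hb : 0 < b.re) (s : ℂ)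
    {t : ℝ} (ht : 0 < t) :
    ∫ x in Ioi (0 : ℝ), (t : ℂ) ^ (s - 1) * Complex.exp (-((b + a * t) * x)) =
      (t : ℂ) ^ (s - 1) / (b + a * t) := by
  rw [integral_const_mul, integral_exp_neg_mul_Ioi_zero (re_add_mul_ofReal_pos ha hb ht),
    mul_one_div]

lemma integrableOn_cpow_div_add_mul {a b s : ℂ} (ha : 0 < a.re) (hb : 0 < b.re)
    (hs : 0 < s.re) (hs1 : s.re < 1) :
    IntegrableOn (fun t : ℝ => (t : ℂ) ^ (s - 1) / (b + a * t)) (Ioi 0) :=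
  IntegrableOn.congr_fun
    (integrable_cpow_mul_exp_neg_add_mul ha hb hs hs1).integral_prod_left
    (fun _ ht => integral_cpow_mul_exp_neg_add_mul ha hb s ht) measurableSet_Ioi

/-- The Mellin transform of `1 / (b + a t)` for `a`, `b` in the right half-plane. -/
lemma integral_cpow_div_add_mul {a b s : ℂ} (ha : 0 < a.re) (hb : 0 < b.re)
    (hs : 0 < s.re) (hs1 : s.re < 1) :
    ∫ t in Ioi (0 : ℝ), (t : ℂ) ^ (s - 1) / (b + a * t) =
      (1 / a) ^ s * (1 / b) ^ (1 - s) * (π / Complex.sin (π * s)) := by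
  have ha0 : a ≠ 0 := fun h => by simp [h] at ha
  rw [← setIntegral_congr_fun measurableSet_Ioi
      (fun t ht => integral_cpow_mul_exp_neg_add_mul ha hb s ht),
    integral_integral_swap (integrable_cpow_mul_exp_neg_add_mul ha hb hs hs1)]
  have hinner : ∀ x ∈ Ioi (0 : ℝ),
      ∫ t in Ioi (0 : ℝ), (t : ℂ) ^ (s - 1) * Complex.exp (-((b + a * t) * x)) =
        (1 / a) ^ s * Complex.Gamma s *
          ((x : ℂ) ^ ((1 - s) - 1) * Complex.exp (-(b * x))) := by
    intro x hx
    have hax : 0 < (a * x).re := by simpa using mul_pos ha hx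
    simp_rw [cpow_mul_exp_neg_add_mul_eq]
    rw [integral_const_mul, integral_cpow_mul_exp_neg_mul_Ioi_of_re_pos hs hax,
      one_div_mul_ofReal_cpow ha0 hx, sub_sub_cancel_left]
    ring
  rw [setIntegral_congr_fun measurableSet_Ioi hinner, integral_const_mul,
    integral_cpow_mul_exp_neg_mul_Ioi_of_re_pos (by simpa using hs1) hb,
    ← Complex.Gamma_mul_Gamma_one_sub]
  ring

lemma one_div_exp_mul_I_cpow {h : ℝ} (hl : -π < h) (hu : h < π) (s : ℂ) :
    (1 / Complex.exp (h * Complex.I)) ^ s = Complex.exp (-(h * Complex.I * s)) := by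
  rw [one_div, ← Complex.exp_neg, Complex.cpow_def_of_ne_zero (Complex.exp_ne_zero _),
    Complex.log_exp (by simpa using hu) (by simpa using by linarith)]
  ring_nf

/-- For `|h| < π / 2`, the Mellin transform of `1 / (1 + e ^ (2 i h) t)`, written so that the
denominator has positive real part. -/
lemma integral_cpow_mul_exp_div_add {h s : ℝ} (hl : -(π / 2) < h) (hu : h < π / 2)
    (hs : 0 < s) (hs1 : s < 1) :
    IntegrableOn (fun t : ℝ => (t : ℂ) ^ ((s : ℂ) - 1) /
      (Complex.exp ((-h : ℝ) * Complex.I) + Complex.exp (h * Complex.I) * t) *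
        Complex.exp ((-h : ℝ) * Complex.I)) (Ioi 0) ∧
    ∫ t in Ioi (0 : ℝ), (t : ℂ) ^ ((s : ℂ) - 1) /
      (Complex.exp ((-h : ℝ) * Complex.I) + Complex.exp (h * Complex.I) * t) *
        Complex.exp ((-h : ℝ) * Complex.I) =
      (π / Real.sin (π * s) : ℝ) * Complex.exp ((-(2 * h * s) : ℝ) * Complex.I) := by
  have hcos : 0 < Real.cos h := Real.cos_pos_of_mem_Ioo ⟨hl, hu⟩
  have ha : 0 < (Complex.exp (h * Complex.I)).re := by rwa [Complex.exp_ofReal_mul_I_re]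
  have hb : 0 < (Complex.exp ((-h : ℝ) * Complex.I)).re := by
    rwa [Complex.exp_ofReal_mul_I_re, Real.cos_neg]
  have hs' : 0 < (s : ℂ).re := hs
  have hs1' : (s : ℂ).re < 1 := hs1
  have hpi := Real.pi_pos
  refine ⟨(integrableOn_cpow_div_add_mul ha hb hs' hs1').mul_const _, ?_⟩
  rw [integral_mul_const, integral_cpow_div_add_mul ha hb hs' hs1',
    one_div_exp_mul_I_cpow (by linarith) (by linarith),
    one_div_exp_mul_I_cpow (by linarith) (by linarith), ← Complex.exp_add, mul_right_comm,
    ← Complex.exp_add, mul_comm]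
  push_cast
  ring_nf

lemma quadratic_pos_of_sin_ne_zero {θ : ℝ} (h : Real.sin θ ≠ 0) (t : ℝ) :
    0 < t ^ 2 - 2 * t * Real.cos θ + 1 := by
  have := Real.sin_sq_add_cos_sq θ
  have := sq_pos_of_ne_zero h
  nlinarith [sq_nonneg (t - Real.cos θ)]

lemma im_cpow_mul_exp_div_add {h s t : ℝ} (ht : 0 < t) :
    ((t : ℂ) ^ ((s : ℂ) - 1) /
      (Complex.exp ((-h : ℝ) * Complex.I) + Complex.exp (h * Complex.I) * t) *
        Complex.exp ((-h : ℝ) * Complex.I)).im =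
      -Real.sin (2 * h) * t ^ s / (t ^ 2 + 2 * t * Real.cos (2 * h) + 1) := by
  have hpow : (t : ℂ) ^ ((s : ℂ) - 1) = ((t ^ (s - 1) : ℝ) : ℂ) := by
    rw [Complex.ofReal_cpow ht.le]; push_cast; rfl
  have hts : t ^ s = t ^ (s - 1) * t := by rw [← Real.rpow_add_one ht.ne', sub_add_cancel]
  have hsq := Real.sin_sq_add_cos_sq h
  have hnormSq : Complex.normSq
      (Complex.exp ((-h : ℝ) * Complex.I) + Complex.exp (h * Complex.I) * t) =
      t ^ 2 + 2 * t * Real.cos (2 * h) + 1 := by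
    rw [Complex.normSq_apply]
    simp only [Complex.add_re, Complex.add_im, Complex.re_mul_ofReal, Complex.im_mul_ofReal,
      Complex.exp_ofReal_mul_I_re, Complex.exp_ofReal_mul_I_im, Real.cos_neg, Real.sin_neg]
    rw [Real.cos_two_mul]
    linear_combination (1 - t) ^ 2 * hsq
  rw [hpow, div_mul_eq_mul_div, mul_div_assoc, Complex.im_ofReal_mul, Complex.div_im, hnormSq, hts]
  simp only [Complex.add_re, Complex.add_im, Complex.re_mul_ofReal, Complex.im_mul_ofReal,
    Complex.exp_ofReal_mul_I_re, Complex.exp_ofReal_mul_I_im, Real.cos_neg, Real.sin_neg]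
  rw [Real.sin_two_mul]
  ring

/-- For every `α ∈ (1,2)`, the function
`f_{U_α}(t) = −sin(πα)·t^{1/α}/(π(t² − 2t cos(πα) + 1))`
is nonnegative on `(0,∞)` and integrates to `1` there; i.e. it is a probability
density on `(0,∞)`. -/
theorem stmt_2 (α : ℝ) (hα : α ∈ Set.Ioo (1 : ℝ) 2) :
    (∀ t : ℝ, 0 < t →
      0 ≤ -Real.sin (π * α) * t ^ (1 / α) /
            (π * (t ^ 2 - 2 * t * Real.cos (π * α) + 1))) ∧
    ∫ t in Set.Ioi (0 : ℝ),
        -Real.sin (π * α) * t ^ (1 / α) /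
          (π * (t ^ 2 - 2 * t * Real.cos (π * α) + 1)) = 1 := by
  obtain ⟨h1, h2⟩ := hα
  have hpi := Real.pi_pos
  have hα0 : 0 < α := by linarith
  have hsin : Real.sin (π * α) < 0 := by
    have := Real.sin_pos_of_pos_of_lt_pi (x := π * α - π) (by nlinarith) (by nlinarith)
    rw [Real.sin_sub_pi] at this
    linarith
  refine ⟨fun t ht => ?_, ?_⟩
  · exact div_nonneg (mul_nonneg (neg_nonneg.mpr hsin.le) (Real.rpow_nonneg ht.le _))
      (mul_pos hpi (quadratic_pos_of_sin_ne_zero hsin.ne t)).le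
  have hs0 : 0 < 1 / α := by positivity
  have hs1 : 1 / α < 1 := by rwa [div_lt_one hα0]
  obtain ⟨hint, heq⟩ := integral_cpow_mul_exp_div_add (h := (π - π * α) / 2) (s := 1 / α)
    (by nlinarith) (by nlinarith) hs0 hs1
  have him := (integral_im hint).trans (congrArg _ heq)
  have hsin' : Real.sin (π * (1 / α)) ≠ 0 :=
    (Real.sin_pos_of_pos_of_lt_pi (by positivity) (by nlinarith)).ne'
  have hexp : -(2 * ((π - π * α) / 2) * (1 / α)) = π - π * (1 / α) := by
    field_simp
    ring
  rw [hexp] at him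
  simp only [RCLike.im_eq_complex_im, Complex.im_ofReal_mul, Complex.exp_ofReal_mul_I_im,
    Real.sin_pi_sub] at him
  rw [div_mul_cancel₀ _ hsin', setIntegral_congr_fun measurableSet_Ioi
    (fun t ht => im_cpow_mul_exp_div_add ht), mul_div_cancel₀ _ two_ne_zero] at him
  simp only [Real.sin_pi_sub, Real.cos_pi_sub] at him
  have hpoint : ∀ t : ℝ, -Real.sin (π * α) * t ^ (1 / α) /
      (π * (t ^ 2 - 2 * t * Real.cos (π * α) + 1)) =
      π⁻¹ * (-Real.sin (π * α) * t ^ (1 / α) /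
        (t ^ 2 + 2 * t * -Real.cos (π * α) + 1)) := by
    intro t
    rw [inv_mul_eq_div, div_div]
    ring_nf
  simp_rw [hpoint]
  rw [integral_const_mul, him, inv_mul_cancel₀ hpi.ne']
end

section
/- For every α ∈ (1,2) and every real s with −1 − 1/α < s < 1 − 1/α and s ≠ −1/α, one has (−sin(πα)/π) · ∫₀^∞ x^{s+1/α}/(x² − 2x·cos(πα) + 1) dx = sin(π(α−1)(s+1/α))/sin(π(s+1/α)). -/
open Real MeasureTheory Set

/-- The reflection formula as a Beta integral over the unit interval. -/
lemma integral_Ioo_rpow_mul_one_sub_rpow {p : ℝ} (hp1 : -1 < p) (hp0 : p < 0) :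
    ∫ t in Ioo (0 : ℝ) 1, t ^ p * (1 - t) ^ (-p - 1) = -π / sin (π * p) := by
  have hbeta : Complex.betaIntegral ((p + 1 : ℝ) : ℂ) ((-p : ℝ) : ℂ)
      = ((∫ t in Ioo (0 : ℝ) 1, t ^ p * (1 - t) ^ (-p - 1) : ℝ) : ℂ) := by
    rw [Complex.betaIntegral, intervalIntegral.integral_of_le zero_le_one,
      integral_Ioc_eq_integral_Ioo, ← integral_complex_ofReal]
    refine setIntegral_congr_fun measurableSet_Ioo fun t ht ↦ ?_
    simp only [Complex.ofReal_mul]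
    rw [Complex.ofReal_cpow ht.1.le, Complex.ofReal_cpow (sub_nonneg.2 ht.2.le)]
    push_cast
    ring_nf
  have hGamma : Complex.betaIntegral ((p + 1 : ℝ) : ℂ) ((-p : ℝ) : ℂ)
      = ((Real.Gamma (p + 1) * Real.Gamma (1 - (p + 1)) : ℝ) : ℂ) := by
    rw [Complex.betaIntegral_eq_Gamma_mul_div _ _ (by simpa using by linarith)
      (by simpa using hp0), ← Complex.ofReal_add, Complex.Gamma_ofReal, Complex.Gamma_ofReal,
      Complex.Gamma_ofReal]
    simp
  rw [← Complex.ofReal_inj, ← hbeta, hGamma, Real.Gamma_mul_Gamma_one_sub, mul_add, mul_one,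
    Real.sin_add_pi, div_neg, neg_div]

lemma integral_Ioi_rpow_div_add_one {p : ℝ} (hp1 : -1 < p) (hp0 : p < 0) :
    ∫ x in Ioi (0 : ℝ), x ^ p / (x + 1) = -π / sin (π * p) := by
  have himage : (fun t : ℝ ↦ t / (1 - t)) '' Ioo 0 1 = Ioi 0 := by
    ext x
    constructor
    · rintro ⟨t, ht, rfl⟩
      exact div_pos ht.1 (sub_pos.2 ht.2)
    · intro (hx : 0 < x)
      refine ⟨x / (x + 1), ⟨by positivity, (div_lt_one (by positivity)).2 (by linarith)⟩, ?_⟩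
      field_simp
      simp
  have hderiv : ∀ t ∈ Ioo (0 : ℝ) 1,
      HasDerivWithinAt (fun t : ℝ ↦ t / (1 - t)) (1 / (1 - t) ^ 2) (Ioo 0 1) t := by
    intro t ht
    have h : 1 - t ≠ 0 := (sub_pos.2 ht.2).ne'
    convert! ((hasDerivAt_id t).div ((hasDerivAt_id t).const_sub 1) h).hasDerivWithinAt using 1
    simp
  have hinj : InjOn (fun t : ℝ ↦ t / (1 - t)) (Ioo 0 1) := by
    intro a ha b hb hab
    have h1 : 1 - a ≠ 0 := (sub_pos.2 ha.2).ne'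
    have h2 : 1 - b ≠ 0 := (sub_pos.2 hb.2).ne'
    simp only at hab
    rw [div_eq_div_iff h1 h2] at hab
    linarith
  rw [← integral_Ioo_rpow_mul_one_sub_rpow hp1 hp0, ← himage,
    integral_image_eq_integral_abs_deriv_smul measurableSet_Ioo hderiv hinj]
  refine setIntegral_congr_fun measurableSet_Ioo fun t ht ↦ ?_
  have h : 0 < 1 - t := sub_pos.2 ht.2
  simp only [smul_eq_mul]
  rw [abs_of_pos (by positivity), div_rpow ht.1.le h.le, sub_eq_add_neg (-p) 1,
    rpow_add h, rpow_neg h.le, rpow_neg_one]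
  have : t / (1 - t) + 1 = 1 / (1 - t) := by field_simp; ring
  rw [this]
  field_simp

lemma integral_Ioi_rpow_div_add {p c : ℝ} (hp1 : -1 < p) (hp0 : p < 0) (hc : 0 < c) :
    ∫ x in Ioi (0 : ℝ), x ^ p / (x + c) = -π / sin (π * p) * c ^ p := by
  have h := integral_comp_mul_left_Ioi (fun x ↦ x ^ p / (x + c)) 0 hc
  rw [mul_zero, smul_eq_mul, inv_mul_eq_div, eq_div_iff hc.ne'] at h
  rw [← h, ← integral_Ioi_rpow_div_add_one hp1 hp0, ← integral_mul_const, ← integral_mul_const]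
  refine setIntegral_congr_fun measurableSet_Ioi fun x (hx : 0 < x) ↦ ?_
  rw [mul_rpow hc.le hx.le]
  field_simp

lemma integrableOn_Ioi_rpow_div_add_one {p : ℝ} (hp1 : -1 < p) (hp0 : p < 0) :
    IntegrableOn (fun x : ℝ ↦ x ^ p / (x + 1)) (Ioi 0) := by
  refine not_imp_comm.1 integral_undef ?_
  rw [integral_Ioi_rpow_div_add_one hp1 hp0]
  have h : sin (π * p) < 0 := sin_neg_of_neg_of_neg_pi_lt (by nlinarith [pi_pos])
    (by nlinarith [pi_pos])
  exact div_ne_zero (neg_ne_zero.2 pi_ne_zero) h.ne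

/-- Near a point of the slit plane, `w ↦ x + w` is bounded below uniformly in `x > 0`. -/
lemma exists_add_one_le_mul_norm_add {w₀ : ℂ} (hw₀ : w₀ ∈ Complex.slitPlane) :
    ∃ r > 0, ∃ C > 0, ∀ w ∈ Metric.ball w₀ r, ∀ x : ℝ, 0 < x → x + 1 ≤ C * ‖(x : ℂ) + w‖ := by
  obtain ⟨d, hd, hball⟩ := Metric.isOpen_iff.1 Complex.isOpen_slitPlane w₀ hw₀
  have hdist : ∀ x : ℝ, 0 < x → d ≤ ‖(x : ℂ) + w₀‖ := by
    intro x hx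
    by_contra! h
    have hmem : -(x : ℂ) ∈ Metric.ball w₀ d := by
      rwa [Metric.mem_ball, dist_eq_norm, ← norm_neg,
        show -(-(x : ℂ) - w₀) = x + w₀ by ring]
    exact absurd (Complex.neg_ofReal_mem_slitPlane.1 (hball hmem)) hx.not_gt
  refine ⟨d / 2, by positivity, 1 + (1 + ‖w₀‖ + d) * (2 / d), by positivity, fun w hw x hx ↦ ?_⟩
  rw [Metric.mem_ball, dist_eq_norm] at hw
  have h1 : ‖(x : ℂ) + w₀‖ ≤ ‖(x : ℂ) + w‖ + ‖w - w₀‖ := by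
    calc ‖(x : ℂ) + w₀‖ = ‖(x + w) - (w - w₀)‖ := congrArg norm (by ring)
      _ ≤ ‖(x : ℂ) + w‖ + ‖w - w₀‖ := norm_sub_le _ _
  have h2 : x ≤ ‖(x : ℂ) + w‖ + ‖w₀‖ + ‖w - w₀‖ := by
    have h3 : ‖(x : ℂ)‖ ≤ ‖(x : ℂ) + w₀‖ + ‖w₀‖ := by
      simpa using norm_sub_le ((x : ℂ) + w₀) w₀
    rw [Complex.norm_real, Real.norm_of_nonneg hx.le] at h3
    linarith
  have h4 : 1 ≤ 2 / d * ‖(x : ℂ) + w‖ := by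
    rw [div_mul_eq_mul_div, le_div_iff₀ hd]
    linarith [hdist x hx]
  nlinarith [norm_nonneg w₀, mul_le_mul_of_nonneg_left h4 (by positivity : 0 ≤ 1 + ‖w₀‖ + d)]

lemma ofReal_add_ne_zero_of_mem_slitPlane {w : ℂ} (hw : w ∈ Complex.slitPlane) {x : ℝ}
    (hx : 0 < x) : (x : ℂ) + w ≠ 0 := by
  intro h
  rw [← neg_eq_of_add_eq_zero_right h, Complex.neg_ofReal_mem_slitPlane] at hw
  exact hw.not_gt hx

lemma integrableOn_Ioi_rpow_div_ofReal_add {p : ℝ} (hp1 : -1 < p) (hp0 : p < 0) {w : ℂ}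
    (hw : w ∈ Complex.slitPlane) :
    IntegrableOn (fun x : ℝ ↦ ((x ^ p : ℝ) : ℂ) / (x + w)) (Ioi 0) := by
  obtain ⟨r, hr, C, hC, hbound⟩ := exists_add_one_le_mul_norm_add hw
  refine ((integrableOn_Ioi_rpow_div_add_one hp1 hp0).const_mul C).mono'
    (Measurable.aestronglyMeasurable (by fun_prop)) ?_
  filter_upwards [ae_restrict_mem measurableSet_Ioi] with x (hx : 0 < x)
  have h := hbound w (Metric.mem_ball_self hr) x hx
  have hpos : 0 < ‖(x : ℂ) + w‖ :=
    norm_pos_iff.2 (ofReal_add_ne_zero_of_mem_slitPlane hw hx)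
  rw [norm_div, Complex.norm_real, Real.norm_of_nonneg (rpow_nonneg hx.le p), mul_div_assoc',
    div_le_div_iff₀ hpos (by positivity)]
  calc x ^ p * (x + 1) ≤ x ^ p * (C * ‖(x : ℂ) + w‖) := by gcongr
    _ = C * x ^ p * ‖(x : ℂ) + w‖ := by ring

lemma differentiableOn_integral_Ioi_rpow_div_ofReal_add {p : ℝ} (hp1 : -1 < p) (hp0 : p < 0) :
    DifferentiableOn ℂ (fun w : ℂ ↦ ∫ x in Ioi (0 : ℝ), ((x ^ p : ℝ) : ℂ) / (x + w))
      Complex.slitPlane := by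
  intro w₀ hw₀
  obtain ⟨r, hr, C, hC, hbound⟩ := exists_add_one_le_mul_norm_add hw₀
  have hpos : ∀ w ∈ Metric.ball w₀ r, ∀ x : ℝ, 0 < x → 0 < ‖(x : ℂ) + w‖ := fun w hw x hx ↦
    pos_of_mul_pos_right (lt_of_lt_of_le (by positivity) (hbound w hw x hx)) hC.le
  refine (hasDerivAt_integral_of_dominated_loc_of_deriv_le (𝕜 := ℂ) (μ := volume.restrict (Ioi 0))
    (F := fun w (x : ℝ) ↦ ((x ^ p : ℝ) : ℂ) / (x + w)) (Metric.ball_mem_nhds w₀ hr)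
    (F' := fun w (x : ℝ) ↦ -((x ^ p : ℝ) : ℂ) / (x + w) ^ 2)
    (bound := fun x ↦ C ^ 2 * (x ^ p / (x + 1)))
    (.of_forall fun w ↦ Measurable.aestronglyMeasurable (by fun_prop))
    (integrableOn_Ioi_rpow_div_ofReal_add hp1 hp0 hw₀)
    (Measurable.aestronglyMeasurable (by fun_prop)) ?_
    ((integrableOn_Ioi_rpow_div_add_one hp1 hp0).const_mul _)
    ?_).2.differentiableAt.differentiableWithinAt
  · filter_upwards [ae_restrict_mem measurableSet_Ioi] with x (hx : 0 < x) w hw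
    have h := hbound w hw x hx
    have hxw := hpos w hw x hx
    rw [norm_div, norm_neg, norm_pow, Complex.norm_real,
      Real.norm_of_nonneg (rpow_nonneg hx.le p), mul_div_assoc',
      div_le_div_iff₀ (by positivity) (by positivity)]
    have hsq : x + 1 ≤ (C * ‖(x : ℂ) + w‖) ^ 2 := by nlinarith
    calc x ^ p * (x + 1) ≤ x ^ p * (C * ‖(x : ℂ) + w‖) ^ 2 := by gcongr
      _ = C ^ 2 * x ^ p * ‖(x : ℂ) + w‖ ^ 2 := by ring
  · filter_upwards [ae_restrict_mem measurableSet_Ioi] with x (hx : 0 < x) w hw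
    have hne : (x : ℂ) + w ≠ 0 := norm_pos_iff.1 (hpos w hw x hx)
    convert! (hasDerivAt_const w ((x ^ p : ℝ) : ℂ)).div ((hasDerivAt_id w).const_add (x : ℂ)) hne
      using 1
    simp

/-- The Stieltjes transform of `x ^ p`. -/
lemma integral_Ioi_rpow_div_ofReal_add {p : ℝ} (hp1 : -1 < p) (hp0 : p < 0) {w : ℂ}
    (hw : w ∈ Complex.slitPlane) :
    ∫ x in Ioi (0 : ℝ), ((x ^ p : ℝ) : ℂ) / (x + w)
      = ((-π / sin (π * p) : ℝ) : ℂ) * w ^ (p : ℂ) := by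
  have hpow : DifferentiableOn ℂ (fun w : ℂ ↦ ((-π / sin (π * p) : ℝ) : ℂ) * w ^ (p : ℂ))
      Complex.slitPlane := fun z hz ↦
    (((hasDerivAt_id z).cpow_const hz).differentiableAt.const_mul _).differentiableWithinAt
  refine AnalyticOnNhd.eqOn_of_preconnected_of_frequently_eq
    ((differentiableOn_integral_Ioi_rpow_div_ofReal_add hp1 hp0).analyticOnNhd
      Complex.isOpen_slitPlane) (hpow.analyticOnNhd Complex.isOpen_slitPlane)
    (Complex.starConvex_one_slitPlane.isPathConnected Complex.one_mem_slitPlane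
      |>.isConnected.isPreconnected) Complex.one_mem_slitPlane ?_ hw
  have hreal : ∀ c : ℝ, 0 < c → ∫ x in Ioi (0 : ℝ), ((x ^ p : ℝ) : ℂ) / (x + (c : ℂ))
      = ((-π / sin (π * p) : ℝ) : ℂ) * (c : ℂ) ^ (p : ℂ) := by
    intro c hc
    rw [← Complex.ofReal_cpow hc.le, ← Complex.ofReal_mul, ← integral_Ioi_rpow_div_add hp1 hp0 hc,
      ← integral_complex_ofReal]
    push_cast
    rfl
  have htend : Filter.Tendsto (fun c : ℝ ↦ (c : ℂ)) (nhdsWithin 1 {1}ᶜ) (nhdsWithin 1 {1}ᶜ) := by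
    refine tendsto_nhdsWithin_of_tendsto_nhds_of_eventually_within _ ?_ ?_
    · exact (Complex.continuous_ofReal.tendsto' 1 1 Complex.ofReal_one).mono_left
        nhdsWithin_le_nhds
    · filter_upwards [self_mem_nhdsWithin] with c hc
      simpa using hc
  refine htend.frequently (Filter.Eventually.frequently ?_)
  filter_upwards [nhdsWithin_le_nhds (lt_mem_nhds one_pos)] with c hc using hreal c hc

/-- The Mellin transform of `1 / (x ^ 2 + 2 x cos θ + 1)`, for negative exponents. -/
lemma integral_Ioi_rpow_div_quadratic_of_neg {p θ : ℝ} (hp1 : -1 < p) (hp0 : p < 0)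
    (hθ0 : 0 < θ) (hθ : θ < π) :
    sin θ * ∫ x in Ioi (0 : ℝ), x ^ p / (x ^ 2 + 2 * x * cos θ + 1)
      = π * sin (p * θ) / sin (π * p) := by
  have hsin : 0 < sin θ := sin_pos_of_pos_of_lt_pi hθ0 hθ
  set w : ℂ := Complex.exp (-θ * Complex.I) with hwdef
  have hwre : w.re = cos θ := by simp [hwdef, Complex.exp_re]
  have hwim : w.im = -sin θ := by simp [hwdef, Complex.exp_im]
  have hw : w ∈ Complex.slitPlane := Or.inr (by rw [hwim]; simpa using hsin.ne')
  have hwpow : w ^ (p : ℂ) = Complex.exp (((-(p * θ) : ℝ) : ℂ) * Complex.I) := by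
    rw [Complex.cpow_def_of_ne_zero (Complex.slitPlane_ne_zero hw), hwdef, Complex.log_exp]
    · push_cast
      ring_nf
    · simpa using hθ
    · simpa using by linarith
  have him := congrArg Complex.im (integral_Ioi_rpow_div_ofReal_add hp1 hp0 hw)
  rw [Complex.im_ofReal_mul, hwpow, Complex.exp_ofReal_mul_I_im, sin_neg] at him
  have hswap := integral_im (𝕜 := ℂ) (integrableOn_Ioi_rpow_div_ofReal_add hp1 hp0 hw)
  simp only [RCLike.im_to_complex] at hswap
  rw [← hswap] at him
  rw [← integral_const_mul]
  convert him using 1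
  · refine setIntegral_congr_fun measurableSet_Ioi fun x hx ↦ ?_
    have hnorm : Complex.normSq ((x : ℂ) + w) = x ^ 2 + 2 * x * cos θ + 1 := by
      rw [Complex.normSq_apply]
      simp only [Complex.add_re, Complex.add_im, Complex.ofReal_re, Complex.ofReal_im, hwre, hwim]
      linear_combination sin_sq_add_cos_sq θ
    rw [div_eq_mul_inv ((x ^ p : ℝ) : ℂ), Complex.im_ofReal_mul, Complex.inv_im, hnorm,
      Complex.add_im, hwim, Complex.ofReal_im]
    ring
  · ring

/-- The substitution `x ↦ x⁻¹` in the Mellin transform of a palindromic quadratic. -/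
lemma integral_Ioi_rpow_neg_div_quadratic (p c : ℝ) :
    ∫ x in Ioi (0 : ℝ), x ^ (-p) / (x ^ 2 + 2 * x * c + 1)
      = ∫ x in Ioi (0 : ℝ), x ^ p / (x ^ 2 + 2 * x * c + 1) := by
  rw [← integral_comp_rpow_Ioi (fun x : ℝ ↦ x ^ (-p) / (x ^ 2 + 2 * x * c + 1))
    (neg_ne_zero.2 one_ne_zero)]
  refine setIntegral_congr_fun measurableSet_Ioi fun x (hx : 0 < x) ↦ ?_
  have hx2 : x ^ (-1 - 1 : ℝ) = (x ^ 2)⁻¹ := by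
    rw [show (-1 - 1 : ℝ) = -(2 : ℕ) by norm_num, rpow_neg hx.le, rpow_natCast]
  simp only [smul_eq_mul, abs_neg, abs_one, one_mul]
  rw [hx2, rpow_neg_one, inv_rpow hx.le, rpow_neg hx.le, inv_inv]
  have : x⁻¹ ^ 2 + 2 * x⁻¹ * c + 1 = (x ^ 2 + 2 * x * c + 1) / x ^ 2 := by
    field_simp
    ring
  rw [this, div_div_eq_mul_div]
  field_simp

lemma integral_Ioi_rpow_div_quadratic {p θ : ℝ} (hp1 : -1 < p) (hp : p < 1) (hp0 : p ≠ 0)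
    (hθ0 : 0 < θ) (hθ : θ < π) :
    sin θ * ∫ x in Ioi (0 : ℝ), x ^ p / (x ^ 2 + 2 * x * cos θ + 1)
      = π * sin (p * θ) / sin (π * p) := by
  rcases hp0.lt_or_gt with h | h
  · exact integral_Ioi_rpow_div_quadratic_of_neg hp1 h hθ0 hθ
  · rw [← integral_Ioi_rpow_neg_div_quadratic,
      integral_Ioi_rpow_div_quadratic_of_neg (by linarith) (by linarith) hθ0 hθ, neg_mul, mul_neg,
      sin_neg, sin_neg, mul_neg, neg_div_neg_eq]

theorem stmt_3 (α s : ℝ) (hα : α ∈ Set.Ioo (1 : ℝ) 2)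
    (hs1 : -1 - 1 / α < s) (hs2 : s < 1 - 1 / α) (hs3 : s ≠ -(1 / α)) :
    (-Real.sin (π * α) / π) *
        ∫ x in Set.Ioi (0 : ℝ),
          x ^ (s + 1 / α) / (x ^ 2 - 2 * x * Real.cos (π * α) + 1)
      = Real.sin (π * (α - 1) * (s + 1 / α)) / Real.sin (π * (s + 1 / α)) := by
  have key := integral_Ioi_rpow_div_quadratic (p := s + 1 / α) (θ := π * (α - 1))
    (by linarith) (by linarith) (fun h ↦ hs3 (by linarith))
    (mul_pos pi_pos (by linarith [hα.1])) (by nlinarith [pi_pos, hα.2])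
  rw [mul_sub, mul_one, sin_sub_pi, cos_sub_pi] at key
  simp only [mul_neg, ← sub_eq_add_neg] at key
  rw [div_mul_eq_mul_div, key, div_right_comm, mul_div_cancel_left₀ _ pi_ne_zero]
  ring_nf
end

section
/- For every α ∈ (1,2), the two series defining h_α(x) converge absolutely for every x > 0, the function h_α is nonnegative on (0,∞), and ∫₀^∞ h_α(x) dx = 1; that is, h_α is a probability density on (0,∞). -/
open Real MeasureTheory Set

/-- The density `h_α` of the first hitting time of level 1 by a normalized
spectrally positive `α`-stable Lévy process:
`h_α(x) = Σ_{n≥1} (−α) x^{1/α−n−1}/(Γ(αn)Γ(1/α−n)) + Σ_{n≥1} x^{−n/α−1}/(Γ(−n/α) n!)`. -/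
noncomputable def hittingDensity (α x : ℝ) : ℝ :=
  (∑' n : ℕ, (-α) * x ^ (1 / α - ((n : ℝ) + 1) - 1) /
      (Real.Gamma (α * ((n : ℝ) + 1)) * Real.Gamma (1 / α - ((n : ℝ) + 1))))
  + ∑' n : ℕ, x ^ (-((n : ℝ) + 1) / α - 1) /
      (Real.Gamma (-((n : ℝ) + 1) / α) * (Nat.factorial (n + 1) : ℝ))

lemma exists_bound_of_continuousOn_strip {f : ℂ → ℂ} {ψ C T : ℝ}
    (hc : ContinuousOn f {w | 0 ≤ w.im ∧ w.im ≤ ψ})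
    (hb : ∀ w : ℂ, 0 ≤ w.im → w.im ≤ ψ → T ≤ |w.re| → ‖f w‖ ≤ C / w.re ^ 2) :
    ∃ D : ℝ, 0 ≤ D ∧ ∀ w : ℂ, 0 ≤ w.im → w.im ≤ ψ → ‖f w‖ ≤ D * (1 + w.re ^ 2)⁻¹ := by
  set S := max T 1 with hS
  have hK : IsCompact (Icc (-S) S ×ℂ Icc 0 ψ) := isCompact_Icc.reProdIm isCompact_Icc
  obtain ⟨M, hM⟩ := hK.exists_bound_of_continuousOn (f := f) (hc.mono (by
    intro w hw
    rw [Complex.mem_reProdIm] at hw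
    exact hw.2))
  refine ⟨max M 0 * (1 + S ^ 2) + 2 * max C 0, by positivity, fun w h0 h1 => ?_⟩
  have hpos : 0 < 1 + w.re ^ 2 := by positivity
  rw [← div_eq_mul_inv, le_div_iff₀ hpos]
  have hM0 : 0 ≤ max M 0 := le_max_right _ _
  have hC0 : 0 ≤ max C 0 := le_max_right _ _
  rcases le_total |w.re| S with h | h
  · have h2 : ‖f w‖ ≤ max M 0 := by
      refine (hM w ?_).trans (le_max_left _ _)
      rw [Complex.mem_reProdIm]
      exact ⟨abs_le.mp h, h0, h1⟩
    have h3 : w.re ^ 2 ≤ S ^ 2 := sq_le_sq' (abs_le.mp h).1 (abs_le.mp h).2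
    calc ‖f w‖ * (1 + w.re ^ 2) ≤ max M 0 * (1 + S ^ 2) := by gcongr
      _ ≤ _ := by linarith
  · have h1' : 1 ≤ |w.re| := (le_max_right _ _).trans h
    have h2 : 1 ≤ w.re ^ 2 := by rw [← sq_abs]; nlinarith
    have h3 : ‖f w‖ ≤ max C 0 / w.re ^ 2 :=
      (hb w h0 h1 ((le_max_left _ _).trans h)).trans (by gcongr; exact le_max_left _ _)
    calc ‖f w‖ * (1 + w.re ^ 2) ≤ max C 0 / w.re ^ 2 * (w.re ^ 2 + w.re ^ 2) := by
          gcongr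
      _ = 2 * max C 0 := by
          have hne : w.re ^ 2 ≠ 0 := by positivity
          rw [← two_mul, mul_left_comm, div_mul_cancel₀ _ hne]
      _ ≤ _ := by
        have : 0 ≤ max M 0 * (1 + S ^ 2) := by positivity
        linarith

lemma integrable_line_of_strip_bound {f : ℂ → ℂ} {ψ D y : ℝ} (hy : 0 ≤ y) (hyψ : y ≤ ψ)
    (hc : ContinuousOn f {w | 0 ≤ w.im ∧ w.im ≤ ψ})
    (hb : ∀ w : ℂ, 0 ≤ w.im → w.im ≤ ψ → ‖f w‖ ≤ D * (1 + w.re ^ 2)⁻¹) :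
    Integrable (fun t : ℝ => f (t + y * Complex.I)) := by
  refine Integrable.mono' (integrable_inv_one_add_sq.const_mul D) ?_ ?_
  · refine Continuous.aestronglyMeasurable ?_
    exact hc.comp_continuous (by fun_prop) (fun t => by simp [hy, hyψ])
  · refine Filter.Eventually.of_forall fun t => ?_
    simpa using hb (t + y * Complex.I) (by simpa using hy) (by simpa using hyψ)

/-- Cauchy's theorem for a strip: the integral along horizontal lines does not depend on the
line. -/
lemma integral_line_shift {f : ℂ → ℂ} {ψ C T : ℝ} (hψ : 0 ≤ ψ) {s : Set ℂ} (hs : s.Countable)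
    (hc : ContinuousOn f {w | 0 ≤ w.im ∧ w.im ≤ ψ})
    (hd : ∀ w : ℂ, 0 ≤ w.im → w.im ≤ ψ → w ∉ s → DifferentiableAt ℂ f w)
    (hb : ∀ w : ℂ, 0 ≤ w.im → w.im ≤ ψ → T ≤ |w.re| → ‖f w‖ ≤ C / w.re ^ 2) :
    ∫ t : ℝ, f (t + ψ * Complex.I) = ∫ t : ℝ, f t := by
  obtain ⟨D, hD0, hD⟩ := exists_bound_of_continuousOn_strip hc hb
  have i0 : Integrable (fun t : ℝ => f t) := by
    simpa using integrable_line_of_strip_bound le_rfl hψ hc hD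
  have i1 := integrable_line_of_strip_bound hψ le_rfl hc hD
  have t0 := intervalIntegral_tendsto_integral i0 Filter.tendsto_neg_atTop_atBot Filter.tendsto_id
  have t1 := intervalIntegral_tendsto_integral i1 Filter.tendsto_neg_atTop_atBot Filter.tendsto_id
  have key : ∀ R : ℝ, (∫ x in (-R)..R, f x) - (∫ x in (-R)..R, f (x + ψ * Complex.I)) =
      Complex.I • (∫ y in (0:ℝ)..ψ, f ((-R : ℝ) + y * Complex.I)) -
      Complex.I • (∫ y in (0:ℝ)..ψ, f (R + y * Complex.I)) := by
    intro R
    have h := Complex.integral_boundary_rect_eq_zero_of_differentiable_on_off_countable f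
      (⟨-R, 0⟩ : ℂ) (⟨R, ψ⟩ : ℂ) s hs (hc.mono ?_) ?_
    · simp only [Complex.ofReal_zero, zero_mul, add_zero] at h
      linear_combination h
    · intro w hw
      rw [Complex.mem_reProdIm] at hw
      have := hw.2
      simp only [uIcc_of_le hψ] at this
      exact this
    · intro w hw
      rw [mem_sdiff, Complex.mem_reProdIm] at hw
      have := hw.1.2
      simp only [min_eq_left hψ, max_eq_right hψ] at this
      exact hd w this.1.le this.2.le hw.2
  have side : ∀ e : ℝ → ℝ, (∀ R, (e R) ^ 2 = R ^ 2) → Filter.Tendsto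
      (fun R : ℝ => ∫ y in (0:ℝ)..ψ, f (e R + y * Complex.I)) Filter.atTop (nhds 0) := by
    intro e he
    have hlim : Filter.Tendsto (fun R : ℝ => D * (1 + R ^ 2)⁻¹ * |ψ - 0|) Filter.atTop (nhds 0) := by
      have : Filter.Tendsto (fun R : ℝ => (1 + R ^ 2)⁻¹) Filter.atTop (nhds 0) :=
        tendsto_inv_atTop_zero.comp (Filter.tendsto_atTop_add_const_left _ _
          (Filter.tendsto_pow_atTop (by norm_num)))
      simpa using (this.const_mul D).mul_const |ψ - 0|
    refine squeeze_zero_norm (fun R => ?_) hlim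
    refine intervalIntegral.norm_integral_le_of_norm_le_const fun y hy => ?_
    rw [uIoc_of_le hψ] at hy
    have := hD (e R + y * Complex.I) (by simpa using hy.1.le) (by simpa using hy.2)
    simpa [he] using this
  have s1 := side (fun R => -R) (by intro R; ring)
  have s2 := side (fun R => R) (by intro R; ring)
  have lim1 := t0.sub t1
  have lim2 := (s1.const_smul Complex.I).sub (s2.const_smul Complex.I)
  have : (fun R : ℝ => (∫ x in (-R)..id R, f x) - (∫ x in (-R)..id R, f (x + ψ * Complex.I))) =
      fun R : ℝ => Complex.I • (∫ y in (0:ℝ)..ψ, f ((-R : ℝ) + y * Complex.I)) -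
      Complex.I • (∫ y in (0:ℝ)..ψ, f (R + y * Complex.I)) := funext key
  rw [this] at lim1
  have := tendsto_nhds_unique lim1 lim2
  simp only [smul_zero, sub_zero] at this
  exact (sub_eq_zero.mp this).symm

lemma integrable_im_inv_add_mul_I {c : ℝ} (hc : c ≠ 0) (a : ℝ) :
    Integrable (fun t : ℝ => ((t - a + c * Complex.I : ℂ)⁻¹).im) ∧
    ∫ t : ℝ, ((t - a + c * Complex.I : ℂ)⁻¹).im = -π * (c / |c|) := by
  have e : ∀ t : ℝ, ((t - a + c * Complex.I : ℂ)⁻¹).im = (-c⁻¹) * (1 + (c⁻¹ * (t - a)) ^ 2)⁻¹ := by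
    intro t
    have : ((t:ℂ) - a + c * Complex.I) = ⟨t - a, c⟩ := by
      apply Complex.ext <;> simp
    rw [this, Complex.inv_im, Complex.normSq_mk]
    have h1 : (t - a) * (t - a) + c * c ≠ 0 := by
      have : 0 < c * c := mul_self_pos.mpr hc
      nlinarith [mul_self_nonneg (t - a)]
    have h2 : (1 + (c⁻¹ * (t - a)) ^ 2) ≠ 0 := by positivity
    field_simp
    ring
  simp_rw [e]
  constructor
  · have := (integrable_inv_one_add_sq.comp_mul_left' (inv_ne_zero hc)).comp_sub_right a
    exact this.const_mul _
  · rw [integral_const_mul, integral_sub_right_eq_self (fun t : ℝ => (1 + (c⁻¹ * t) ^ 2)⁻¹) a,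
      Measure.integral_comp_mul_left (fun t : ℝ => (1 + t ^ 2)⁻¹) c⁻¹,
      integral_univ_inv_one_add_sq, inv_inv, smul_eq_mul]
    rcases lt_or_gt_of_ne hc with h | h
    · rw [abs_of_neg h]; field_simp; try ring
    · rw [abs_of_pos h]; field_simp; try ring

/-- Sokhotski–Plemelj type formula on a horizontal line: a function holomorphic on a closed strip,
real on the real axis and decaying at infinity. -/
lemma im_integral_div_sub {A : ℂ → ℂ} {ψ C T w₀ : ℝ} (hψ : 0 < ψ)
    (hd : ∀ w : ℂ, 0 ≤ w.im → w.im ≤ ψ → DifferentiableAt ℂ A w)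
    (hreal : ∀ t : ℝ, (A t).im = 0)
    (hb : ∀ w : ℂ, 0 ≤ w.im → w.im ≤ ψ → T ≤ |w.re| → ‖A w‖ ≤ C / |w.re|) :
    Integrable (fun t : ℝ => (A (t + ψ * Complex.I) / (t + ψ * Complex.I - w₀)).im) ∧
    ∫ t : ℝ, (A (t + ψ * Complex.I) / (t + ψ * Complex.I - w₀)).im = -π * (A w₀).re := by
  set b : ℝ := ψ + 1 with hbdef
  have hb0 : 0 < b := by linarith
  set χ : ℂ → ℂ := fun w => b ^ 2 / ((w - w₀) ^ 2 + b ^ 2) with hχ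
  have hden : ∀ w : ℂ, 0 ≤ w.im → w.im ≤ ψ → (w - w₀) ^ 2 + b ^ 2 ≠ 0 := by
    intro w h0 h1 h
    have : (w - w₀ + b * Complex.I) * (w - w₀ - b * Complex.I) = 0 := by
      linear_combination h - (b:ℂ) ^ 2 * Complex.I_sq
    rcases mul_eq_zero.mp this with h | h
    · have := congrArg Complex.im h
      simp at this; linarith
    · have := congrArg Complex.im h
      simp at this; linarith
  have hχd : ∀ w : ℂ, 0 ≤ w.im → w.im ≤ ψ → DifferentiableAt ℂ χ w := by
    intro w h0 h1
    exact (differentiableAt_const _).div (by fun_prop) (hden w h0 h1)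
  set B : ℂ → ℂ := fun w => A w - A w₀ * χ w with hB
  have hBd : ∀ w : ℂ, 0 ≤ w.im → w.im ≤ ψ → DifferentiableAt ℂ B w := fun w h0 h1 =>
    (hd w h0 h1).sub ((hχd w h0 h1).const_mul _)
  have hχ0 : χ w₀ = 1 := by
    have : (b : ℂ) ≠ 0 := by exact_mod_cast hb0.ne'
    simp [hχ, this]
  have hB0 : B w₀ = 0 := by simp [hB, hχ0]
  have hχreal : ∀ t : ℝ, (χ t).im = 0 := by
    intro t
    have : χ t = ((b ^ 2 / ((t - w₀) ^ 2 + b ^ 2) : ℝ) : ℂ) := by simp [hχ]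
    rw [this, Complex.ofReal_im]
  have hBreal : ∀ t : ℝ, (B t).im = 0 := by
    intro t
    simp [hB, hreal, hχreal]
  set g : ℂ → ℂ := dslope B w₀ with hg
  have hgne : ∀ w : ℂ, w ≠ w₀ → g w = B w / (w - w₀) := by
    intro w hw
    rw [hg, dslope_of_ne _ hw, slope_def_field, hB0, sub_zero]
  have hgc : ContinuousOn g {w | 0 ≤ w.im ∧ w.im ≤ ψ} := by
    intro w hw
    refine ContinuousAt.continuousWithinAt ?_
    by_cases h : w = w₀
    · rw [h, hg, continuousAt_dslope_same]
      exact hBd _ (by simp) (by simpa using hψ.le)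
    · exact ((differentiableAt_dslope_of_ne h).mpr (hBd w hw.1 hw.2)).continuousAt
  have hgd : ∀ w : ℂ, 0 ≤ w.im → w.im ≤ ψ → w ∉ ({(w₀ : ℂ)} : Set ℂ) →
      DifferentiableAt ℂ g w := fun w h0 h1 h2 =>
    (differentiableAt_dslope_of_ne (by simpa using h2)).mpr (hBd w h0 h1)
  have hgb : ∀ w : ℂ, 0 ≤ w.im → w.im ≤ ψ → max T (2 * |w₀| + 2 * b + 1) ≤ |w.re| →
      ‖g w‖ ≤ (2 * (C + ‖A w₀‖ * (b ^ 2 * 8))) / w.re ^ 2 := by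
    intro w h0 h1 h2
    have hT := (le_max_left _ _).trans h2
    have hW := (le_max_right _ _).trans h2
    have hx : 0 < |w.re| := by
      have := abs_nonneg w₀
      linarith
    have hx1 : 1 ≤ |w.re| := by
      have := abs_nonneg w₀
      linarith
    have hlow : |w.re| / 2 ≤ ‖w - w₀‖ := by
      have h3 : |(w - w₀).re| ≤ ‖w - w₀‖ := Complex.abs_re_le_norm _
      have h4 : |w.re| - |w₀| ≤ |(w - w₀).re| := by
        simpa using abs_sub_abs_le_abs_sub w.re w₀
      linarith
    have hne : w ≠ w₀ := by
      intro h
      rw [h] at hlow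
      rw [h] at hx
      simp only [sub_self, norm_zero] at hlow
      linarith
    have hχb : ‖χ w‖ ≤ b ^ 2 * 8 / |w.re| := by
      have h5 : |w.re| ^ 2 / 8 ≤ ‖(w - w₀) ^ 2 + (b:ℂ) ^ 2‖ := by
        have h6 : ‖(w - w₀) ^ 2‖ - ‖(b:ℂ) ^ 2‖ ≤ ‖(w - w₀) ^ 2 + (b:ℂ) ^ 2‖ := by
          have := norm_sub_norm_le ((w - w₀) ^ 2) (-(b:ℂ) ^ 2)
          rw [norm_neg] at this
          simpa using this
        have h7 : ‖(b:ℂ) ^ 2‖ = b ^ 2 := by simp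
        have h8 : (|w.re| / 2) ^ 2 ≤ ‖(w - w₀) ^ 2‖ := by
          rw [norm_pow]; gcongr
        have h9 : b ≤ |w.re| / 2 - 1/2 := by
          have := abs_nonneg w₀
          linarith
        have h10 : ‖(w-w₀)^2‖ - b ^ 2 ≤ ‖(w - w₀) ^ 2 + (b:ℂ) ^ 2‖ := by rw [← h7]; exact h6
        have h11 : |w.re| ≤ ‖w - w₀‖ + |w₀| := by
          have h4 : |w.re| - |w₀| ≤ |(w - w₀).re| := by
            simpa using abs_sub_abs_le_abs_sub w.re w₀
          linarith [Complex.abs_re_le_norm (w - w₀)]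
        have h12 : |w.re| / 2 + b ≤ ‖w - w₀‖ := by linarith
        have h13 : (|w.re| / 2 + b) ^ 2 ≤ ‖(w - w₀) ^ 2‖ := by
          rw [norm_pow]; gcongr
        nlinarith
      rw [hχ]
      simp only [norm_div]
      have h7 : ‖(b:ℂ) ^ 2‖ = b ^ 2 := by simp
      rw [h7, div_le_div_iff₀ (by refine lt_of_lt_of_le ?_ h5; positivity) hx]
      have : |w.re| ≤ |w.re| ^ 2 := by nlinarith
      nlinarith [sq_nonneg b]
    have hBb : ‖B w‖ ≤ (C + ‖A w₀‖ * (b ^ 2 * 8)) / |w.re| := by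
      calc ‖B w‖ ≤ ‖A w‖ + ‖A w₀ * χ w‖ := norm_sub_le _ _
        _ ≤ C / |w.re| + ‖A w₀‖ * (b ^ 2 * 8 / |w.re|) := by
          rw [norm_mul]
          gcongr
          exact hb w h0 h1 hT
        _ = _ := by ring
    rw [hgne w hne, norm_div]
    calc ‖B w‖ / ‖w - w₀‖ ≤ ((C + ‖A w₀‖ * (b ^ 2 * 8)) / |w.re|) / (|w.re| / 2) := by
          have := (norm_nonneg _).trans hBb
          gcongr
      _ = _ := by rw [← sq_abs w.re]; field_simp
  have shift := integral_line_shift hψ.le (Set.countable_singleton _) hgc hgd hgb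
  obtain ⟨D, hD0, hD⟩ := exists_bound_of_continuousOn_strip hgc hgb
  have iψ := integrable_line_of_strip_bound hψ.le le_rfl hgc hD
  have i0 : Integrable (fun t : ℝ => g t) := by
    simpa using integrable_line_of_strip_bound le_rfl hψ.le hgc hD
  have im0 : (∫ t : ℝ, g t).im = 0 := by
    have h1 : (∫ t : ℝ, g t).im = ∫ t : ℝ, (g t).im := (integral_im i0).symm
    rw [h1]
    rw [integral_eq_zero_of_ae]
    have : ∀ᵐ t : ℝ, t ≠ w₀ := by simp [ae_iff, measure_singleton]
    filter_upwards [this] with t ht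
    rw [hgne t (by exact_mod_cast ht)]
    have : (t : ℂ) - w₀ = ((t - w₀ : ℝ) : ℂ) := by push_cast; ring
    rw [this, Complex.div_ofReal_im, hBreal, zero_div]
    rfl
  have imψ : ∫ t : ℝ, (g (t + ψ * Complex.I)).im = 0 := by
    rw [← im0, ← shift]
    exact integral_im iψ
  have c1 := integrable_im_inv_add_mul_I hψ.ne' w₀
  have c2 := integrable_im_inv_add_mul_I (c := ψ + b) (by positivity) w₀
  have c3 := integrable_im_inv_add_mul_I (c := ψ - b) (by rw [hbdef]; norm_num) w₀
  have hA0 : (A w₀ : ℂ) = ((A w₀).re : ℂ) := by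
    apply Complex.ext <;> simp [hreal]
  have dec : (fun t : ℝ => (A (t + ψ * Complex.I) / (t + ψ * Complex.I - w₀)).im) = fun t : ℝ =>
      (g (t + ψ * Complex.I)).im + (A w₀).re * (((t - w₀ + ψ * Complex.I : ℂ)⁻¹).im -
        2⁻¹ * ((t - w₀ + (ψ + b : ℝ) * Complex.I : ℂ)⁻¹).im -
        2⁻¹ * ((t - w₀ + (ψ - b : ℝ) * Complex.I : ℂ)⁻¹).im) := by
    funext t
    set w : ℂ := t + ψ * Complex.I with hw
    have him : w.im = ψ := by simp [hw]
    have hne : w - w₀ ≠ 0 := by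
      intro h
      have := congrArg Complex.im h
      simp [him] at this
      linarith
    have hp : w - w₀ + b * Complex.I ≠ 0 := by
      intro h
      have := congrArg Complex.im h
      simp [him] at this
      linarith
    have hm : w - w₀ - b * Complex.I ≠ 0 := by
      intro h
      have := congrArg Complex.im h
      simp [him] at this
      linarith
    have hdn := hden w (by rw [him]; exact hψ.le) (by rw [him])
    have e1 : (t - w₀ + ψ * Complex.I : ℂ) = w - w₀ := by rw [hw]; ring
    have e2 : (t - w₀ + (ψ + b : ℝ) * Complex.I : ℂ) = w - w₀ + b * Complex.I := by
      rw [hw]; push_cast; ring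
    have e3 : (t - w₀ + (ψ - b : ℝ) * Complex.I : ℂ) = w - w₀ - b * Complex.I := by
      rw [hw]; push_cast; ring
    have hfac : (w - w₀) ^ 2 + (b:ℂ) ^ 2 = (w - w₀ + b * Complex.I) * (w - w₀ - b * Complex.I) := by
      linear_combination (b:ℂ) ^ 2 * Complex.I_sq
    have hχpf : χ w / (w - w₀) = (w - w₀)⁻¹ - 2⁻¹ * (w - w₀ + b * Complex.I)⁻¹ -
        2⁻¹ * (w - w₀ - b * Complex.I)⁻¹ := by
      have hsum : 2⁻¹ * (w - w₀ + b * Complex.I)⁻¹ + 2⁻¹ * (w - w₀ - b * Complex.I)⁻¹ =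
          (w - w₀) / ((w - w₀) ^ 2 + (b:ℂ) ^ 2) := by
        rw [hfac]
        field_simp
        ring
      rw [sub_sub, hsum]
      simp only [hχ]
      field_simp
      ring
    have hmain : A w / (w - w₀) = g w + ((A w₀).re : ℂ) * (χ w / (w - w₀)) := by
      rw [hgne w (sub_ne_zero.mp hne), ← hA0]
      simp only [hB]
      ring
    rw [hmain, e1, e2, e3, Complex.add_im, Complex.im_ofReal_mul, hχpf]
    have h2 : (2⁻¹ : ℂ) = ((2⁻¹ : ℝ) : ℂ) := by push_cast; rfl
    rw [h2, Complex.sub_im, Complex.sub_im, Complex.im_ofReal_mul, Complex.im_ofReal_mul]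
  have c12 : Integrable (fun t : ℝ => ((t - w₀ + ψ * Complex.I : ℂ)⁻¹).im -
      2⁻¹ * ((t - w₀ + (ψ + b : ℝ) * Complex.I : ℂ)⁻¹).im) := c1.1.sub (c2.1.const_mul _)
  have ic : Integrable (fun t : ℝ => (A w₀).re * (((t - w₀ + ψ * Complex.I : ℂ)⁻¹).im -
        2⁻¹ * ((t - w₀ + (ψ + b : ℝ) * Complex.I : ℂ)⁻¹).im -
        2⁻¹ * ((t - w₀ + (ψ - b : ℝ) * Complex.I : ℂ)⁻¹).im)) :=
    (c12.sub (c3.1.const_mul _)).const_mul _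
  rw [dec]
  have iψ' : Integrable (fun t : ℝ => (g (t + ψ * Complex.I)).im) := iψ.im
  refine ⟨iψ'.add ic, ?_⟩
  rw [integral_add iψ' ic, imψ, integral_const_mul,
    integral_sub c12 (c3.1.const_mul _), integral_sub c1.1 (c2.1.const_mul _), integral_const_mul, integral_const_mul, c1.2, c2.2, c3.2,
    abs_of_pos hψ, abs_of_pos (by positivity : 0 < ψ + b), div_self hψ.ne',
    div_self (by positivity : ψ + b ≠ 0)]
  have : ψ - b = -1 := by rw [hbdef]; ring
  rw [this]
  norm_num
  ring

/-- `CMUpTo N φ`: the alternating finite differences of `φ` up to order `N` are nonnegative. -/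
def CMUpTo : ℕ → (ℕ → ℝ) → Prop
  | 0, φ => ∀ k, 0 ≤ φ k
  | N + 1, φ => (∀ k, 0 ≤ φ k) ∧ CMUpTo N (fun k => φ k - φ (k + 1))

namespace CMUpTo

variable {N : ℕ} {φ χ : ℕ → ℝ}

lemma nonneg (h : CMUpTo N φ) (k : ℕ) : 0 ≤ φ k := by
  cases N with
  | zero => exact h k
  | succ N => exact h.1 k

lemma of_succ (h : CMUpTo (N + 1) φ) : CMUpTo N φ := by
  induction N generalizing φ with
  | zero => exact h.1
  | succ N ih => exact ⟨h.1, ih h.2⟩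

lemma shift (h : CMUpTo N φ) : CMUpTo N (fun k => φ (k + 1)) := by
  induction N generalizing φ with
  | zero => exact fun k => h (k + 1)
  | succ N ih => exact ⟨fun k => h.1 (k + 1), ih h.2⟩

lemma add (h : CMUpTo N φ) (h' : CMUpTo N χ) : CMUpTo N (fun k => φ k + χ k) := by
  induction N generalizing φ χ with
  | zero => exact fun k => add_nonneg (h k) (h' k)
  | succ N ih =>
    refine ⟨fun k => add_nonneg (h.1 k) (h'.1 k), ?_⟩
    convert ih h.2 h'.2 using 2
    ring

lemma mul (h : CMUpTo N φ) (h' : CMUpTo N χ) : CMUpTo N (fun k => φ k * χ k) := by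
  induction N generalizing φ χ with
  | zero => exact fun k => mul_nonneg (h k) (h' k)
  | succ N ih =>
    refine ⟨fun k => mul_nonneg (h.1 k) (h'.1 k), ?_⟩
    convert (ih h.2 h'.of_succ).add (ih h.of_succ.shift h'.2) using 2
    ring

lemma geom {c q : ℝ} (hc : 0 ≤ c) (h0 : 0 ≤ q) (h1 : q ≤ 1) : CMUpTo N (fun k => c * q ^ k) := by
  induction N generalizing c with
  | zero => exact fun k => by positivity
  | succ N ih =>
    refine ⟨fun k => by positivity, ?_⟩
    convert ih (c := c * (1 - q)) (mul_nonneg hc (by linarith)) using 2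
    ring

lemma const {c : ℝ} (hc : 0 ≤ c) : CMUpTo N (fun _ => c) := by
  simpa using geom (N := N) hc zero_le_one le_rfl

lemma of_tendsto {f : ℕ → ℕ → ℝ} (h : ∀ n, CMUpTo N (f n))
    (hl : ∀ k, Filter.Tendsto (fun n => f n k) Filter.atTop (nhds (φ k))) : CMUpTo N φ := by
  induction N generalizing φ f with
  | zero => exact fun k => ge_of_tendsto' (hl k) fun n => h n k
  | succ N ih =>
    exact ⟨fun k => ge_of_tendsto' (hl k) fun n => (h n).1 k,
      ih (fun n => (h n).2) fun k => (hl k).sub (hl (k + 1))⟩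

lemma integral {T : Type*} [MeasurableSpace T] {μ : Measure T} {F : T → ℕ → ℝ}
    (h : ∀ᵐ t ∂μ, CMUpTo N (F t)) (hi : ∀ k, Integrable (fun t => F t k) μ) :
    CMUpTo N (fun k => ∫ t, F t k ∂μ) := by
  induction N generalizing F with
  | zero => exact fun k => integral_nonneg_of_ae (h.mono fun t ht => ht k)
  | succ N ih =>
    refine ⟨fun k => integral_nonneg_of_ae (h.mono fun t ht => ht.1 k), ?_⟩
    convert ih (h.mono fun t ht => ht.2) (fun k => (hi k).sub (hi (k + 1))) using 2
    exact (integral_sub (hi _) (hi _)).symm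

lemma exp_sub_one (h : CMUpTo N φ) : CMUpTo N (fun k => Real.exp (φ k) - 1) := by
  refine of_tendsto (f := fun n k => (1 + φ k / n) ^ n - 1) (fun n => ?_)
    (fun k => (Real.tendsto_one_add_div_pow_exp (φ k)).sub_const 1)
  have hq : CMUpTo N (fun k => φ k / n) := by
    simpa [div_eq_mul_inv] using h.mul (const (c := ((n : ℝ))⁻¹) (by positivity))
  have hp : CMUpTo N (fun k => 1 + φ k / n) := (const zero_le_one).add hq
  have key : ∀ m : ℕ, CMUpTo N (fun k => (1 + φ k / n) ^ m - 1) := by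
    intro m
    induction m with
    | zero => simpa using const (N := N) le_rfl
    | succ m ih =>
      convert (ih.mul hp).add hq using 2
      ring
  exact key n

lemma exp_neg {b : ℕ → ℝ} (h : ∀ N, CMUpTo N (fun k => b (k + 1) - b k)) :
    CMUpTo N (fun k => Real.exp (-b k)) := by
  induction N with
  | zero => exact fun k => (Real.exp_pos _).le
  | succ N ih =>
    refine ⟨fun k => (Real.exp_pos _).le, ?_⟩
    convert ih.shift.mul (h N).exp_sub_one using 2 with k
    rw [mul_sub, ← Real.exp_add]
    ring_nf

lemma inv_add {t : ℝ} (ht : 0 < t) : CMUpTo N (fun k => (t + k)⁻¹) := by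
  have e : ∀ k : ℕ, ∀ x : ℝ, Real.exp (-t * x) * Real.exp (-x) ^ k = Real.exp (-(t + k) * x) := by
    intro k x
    rw [← Real.exp_nat_mul, ← Real.exp_add]
    ring_nf
  have := integral (N := N) (μ := volume.restrict (Ioi (0 : ℝ)))
    (F := fun x k => Real.exp (-t * x) * Real.exp (-x) ^ k) ?_ ?_
  · convert this using 2 with k
    simp_rw [e]
    have hk : 0 < t + k := by positivity
    rw [integral_exp_mul_Ioi (by linarith) 0, mul_zero, Real.exp_zero, neg_div_neg_eq, one_div]
  · filter_upwards [ae_restrict_mem measurableSet_Ioi] with x hx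
    exact geom (Real.exp_pos _).le (Real.exp_pos _).le (Real.exp_le_one_iff.mpr (by
      have : 0 < x := hx
      linarith))
  · intro k
    simp_rw [e]
    have hk : 0 < t + k := by positivity
    exact integrableOn_exp_mul_Ioi (by linarith) 0

lemma exp_neg_mul_rpow {r p : ℝ} (hr : 0 ≤ r) (hp : p ∈ Ioo (0 : ℝ) 1) :
    CMUpTo N (fun k => Real.exp (-(r * ((k + 1 : ℕ) : ℝ) ^ p))) := by
  refine exp_neg (b := fun k => r * ((k + 1 : ℕ) : ℝ) ^ p) fun N => ?_
  set c := (∫ t in Ioi 0, p.rpowIntegrand₀₁ t 1)⁻¹ with hc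
  have hc0 : 0 ≤ c := inv_nonneg.mpr (integral_rpowIntegrand₀₁_one_pos hp).le
  have hFint : ∀ k : ℕ, IntegrableOn (fun t => p.rpowIntegrand₀₁ t ((k + 1 : ℕ) : ℝ)) (Ioi 0) :=
    fun k => integrableOn_rpowIntegrand₀₁_Ioi hp (by positivity)
  have := integral (N := N) (μ := volume.restrict (Ioi (0 : ℝ)))
    (F := fun t k => p.rpowIntegrand₀₁ t ((k + 1 + 1 : ℕ) : ℝ) -
      p.rpowIntegrand₀₁ t ((k + 1 : ℕ) : ℝ)) ?_ (fun k => (hFint (k + 1)).sub (hFint k))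
  · convert (const hr).mul ((const hc0).mul this) using 2 with k
    rw [integral_sub (hFint (k + 1)) (hFint k), rpow_eq_const_mul_integral hp (Nat.cast_nonneg (k + 1)),
      rpow_eq_const_mul_integral hp (Nat.cast_nonneg (k + 1 + 1)), ← hc]
    ring
  · filter_upwards [ae_restrict_mem measurableSet_Ioi] with t ht
    have ht' : 0 < t := ht
    have h2 : CMUpTo (N + 1) (fun k => t ^ p * (t + (k + 1 : ℕ))⁻¹) :=
      (const (by positivity)).mul (inv_add ht').shift
    convert h2.2 using 2 with k
    simp only [rpowIntegrand₀₁]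
    ring

lemma integral_nonneg {g : ℝ → ℝ} (hg : IntegrableOn g (Ioi 0))
    (h : CMUpTo N (fun k => ∫ x in Ioi 0, Real.exp (-x) ^ k * g x)) (k : ℕ) :
    0 ≤ ∫ x in Ioi 0, Real.exp (-x) ^ k * (1 - Real.exp (-x)) ^ N * g x := by
  induction N generalizing g with
  | zero => simpa using h k
  | succ N ih =>
    have hb : ∀ {f : ℝ → ℝ}, IntegrableOn f (Ioi 0) → ∀ u : ℝ → ℝ, Continuous u →
        (∀ x ∈ Ioi (0:ℝ), |u x| ≤ 1) → IntegrableOn (fun x => u x * f x) (Ioi 0) := by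
      intro f hf u hu hu1
      refine Integrable.bdd_mul (c := 1) hf hu.aestronglyMeasurable ?_
      filter_upwards [ae_restrict_mem measurableSet_Ioi] with x hx using hu1 x hx
    have hE : ∀ x ∈ Ioi (0:ℝ), 0 ≤ Real.exp (-x) ∧ Real.exp (-x) ≤ 1 := fun x hx =>
      ⟨(Real.exp_pos _).le, Real.exp_le_one_iff.mpr (by
        have : 0 < x := hx
        linarith)⟩
    have hg' : IntegrableOn (fun x => (1 - Real.exp (-x)) * g x) (Ioi 0) :=
      hb hg _ (by fun_prop) fun x hx => by
        rw [abs_of_nonneg (by linarith [hE x hx])]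
        linarith [hE x hx]
    have hk : ∀ k : ℕ, IntegrableOn (fun x => Real.exp (-x) ^ k * g x) (Ioi 0) := fun k =>
      hb hg _ (by fun_prop) fun x hx => by
        rw [abs_of_nonneg (pow_nonneg (hE x hx).1 _)]
        exact pow_le_one₀ (hE x hx).1 (hE x hx).2
    have := ih hg' (by
      convert h.2 using 2 with k
      rw [← integral_sub (hk k) (hk (k + 1))]
      congr 1
      ext x
      ring)
    convert this using 3 with x
    ring

end CMUpTo

/-- A continuous integrable function on `(0, ∞)` whose Laplace transform is completely monotone
along the integers is nonnegative. -/
lemma nonneg_of_laplace_completelyMonotone {g : ℝ → ℝ} (hgc : ContinuousOn g (Ioi 0))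
    (hg : IntegrableOn g (Ioi 0))
    (h : ∀ N, CMUpTo N (fun k => ∫ x in Ioi 0, Real.exp (-x) ^ k * g x)) :
    ∀ x ∈ Ioi (0 : ℝ), 0 ≤ g x := by
  have hE : ∀ x ∈ Ioi (0:ℝ), Real.exp (-x) ∈ unitInterval := fun x hx =>
    ⟨(Real.exp_pos _).le, Real.exp_le_one_iff.mpr (by
      have : 0 < x := hx
      linarith)⟩
  have hcont : Continuous fun x : ℝ => projIcc 0 1 zero_le_one (Real.exp (-x)) :=
    continuous_projIcc.comp (by fun_prop)
  have hI : ∀ f : C(unitInterval, ℝ),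
      IntegrableOn (fun x => f (projIcc 0 1 zero_le_one (Real.exp (-x))) * g x) (Ioi 0) := by
    intro f
    refine Integrable.bdd_mul (c := ‖f‖) hg (f.continuous.comp hcont).aestronglyMeasurable ?_
    exact Filter.Eventually.of_forall fun x => f.norm_coe_le_norm _
  have pos : ∀ f : C(unitInterval, ℝ), (∀ y, 0 ≤ f y) →
      0 ≤ ∫ x in Ioi 0, f (projIcc 0 1 zero_le_one (Real.exp (-x))) * g x := by
    intro f hf
    have hlim : Filter.Tendsto (fun n => ∫ x in Ioi 0,
        bernsteinApproximation n f (projIcc 0 1 zero_le_one (Real.exp (-x))) * g x) Filter.atTop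
        (nhds (∫ x in Ioi 0, f (projIcc 0 1 zero_le_one (Real.exp (-x))) * g x)) := by
      rw [tendsto_iff_norm_sub_tendsto_zero]
      have h0 : Filter.Tendsto (fun n => ‖bernsteinApproximation n f - f‖ * ∫ x in Ioi 0, ‖g x‖)
          Filter.atTop (nhds 0) := by
        have := tendsto_iff_norm_sub_tendsto_zero.mp (bernsteinApproximation_uniform f)
        simpa using this.mul_const (∫ x in Ioi 0, ‖g x‖)
      refine squeeze_zero (fun _ => norm_nonneg _) (fun n => ?_) h0
      rw [← integral_sub (hI _) (hI _), ← integral_const_mul]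
      refine norm_integral_le_of_norm_le (hg.norm.const_mul _) ?_
      refine Filter.Eventually.of_forall fun x => ?_
      rw [← sub_mul, norm_mul]
      gcongr
      exact (bernsteinApproximation n f - f).norm_coe_le_norm _
    refine ge_of_tendsto' hlim fun n => ?_
    have e : ∀ x ∈ Ioi (0:ℝ),
        bernsteinApproximation n f (projIcc 0 1 zero_le_one (Real.exp (-x))) * g x =
        ∑ k : Fin (n + 1), (n.choose k * f (bernstein.z k)) *
          (Real.exp (-x) ^ (k : ℕ) * (1 - Real.exp (-x)) ^ (n - k) * g x) := by
      intro x hx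
      rw [bernsteinApproximation.apply, Finset.sum_mul]
      refine Finset.sum_congr rfl fun k _ => ?_
      rw [bernstein_apply, projIcc_of_mem _ (hE x hx), smul_eq_mul]
      ring
    rw [setIntegral_congr_fun measurableSet_Ioi e, integral_finsetSum]
    · refine Finset.sum_nonneg fun k _ => ?_
      rw [integral_const_mul]
      exact mul_nonneg (mul_nonneg (by positivity) (hf _)) (CMUpTo.integral_nonneg hg (h _) _)
    · intro k _
      refine Integrable.const_mul (Integrable.bdd_mul (c := 1) hg
        (by fun_prop) ?_) _
      filter_upwards [ae_restrict_mem measurableSet_Ioi] with x hx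
      have := hE x hx
      rw [norm_of_nonneg (mul_nonneg (pow_nonneg this.1 _) (pow_nonneg (by linarith [this.2]) _))]
      exact mul_le_one₀ (pow_le_one₀ this.1 this.2) (pow_nonneg (by linarith [this.2]) _)
        (pow_le_one₀ (by linarith [this.2]) (by linarith [this.1]))
  intro x₀ hx₀
  by_contra! hneg
  obtain ⟨δ, hδ, hball⟩ := Metric.isOpen_iff.mp
    (hgc.isOpen_inter_preimage isOpen_Ioi isOpen_Iio) x₀ ⟨hx₀, hneg⟩
  have hx₀' : (0 : ℝ) < x₀ := hx₀
  set y₀ := Real.exp (-x₀)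
  have hlog : ContinuousAt Real.log y₀ := Real.continuousAt_log (Real.exp_pos _).ne'
  obtain ⟨ε, hε, hεb⟩ := Metric.continuousAt_iff.mp hlog δ hδ
  let f : C(unitInterval, ℝ) := ⟨fun y => max 0 (ε - |(y : ℝ) - y₀|), by fun_prop⟩
  have hle : ∀ x ∈ Ioi (0 : ℝ), f (projIcc 0 1 zero_le_one (Real.exp (-x))) * g x ≤ 0 := by
    intro x hx
    rw [projIcc_of_mem _ (hE x hx)]
    change max 0 (ε - |Real.exp (-x) - y₀|) * g x ≤ 0
    rcases le_or_gt (ε - |Real.exp (-x) - y₀|) 0 with h1 | h1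
    · rw [max_eq_left h1, zero_mul]
    · have h2 : dist (Real.log (Real.exp (-x))) (Real.log y₀) < δ := by
        apply hεb
        rw [Real.dist_eq]
        linarith
      rw [Real.log_exp, Real.log_exp, Real.dist_eq] at h2
      have h3 : x ∈ Metric.ball x₀ δ := by
        rw [Metric.mem_ball, Real.dist_eq, abs_sub_comm]
        convert h2 using 2
        ring
      have h4 : g x < 0 := (hball h3).2
      exact mul_nonpos_of_nonneg_of_nonpos (le_max_left _ _) h4.le
  have hIn : IntegrableOn (fun x => -(f (projIcc 0 1 zero_le_one (Real.exp (-x))) * g x)) (Ioi 0) :=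
    (hI f).neg
  have hlt : 0 < ∫ x in Ioi 0, -(f (projIcc 0 1 zero_le_one (Real.exp (-x))) * g x) := by
    rw [setIntegral_pos_iff_support_of_nonneg_ae _ hIn]
    · have hcon : ContinuousOn (fun x => -(f (projIcc 0 1 zero_le_one (Real.exp (-x))) * g x))
          (Ioi 0) := ((f.continuous.comp hcont).continuousOn.mul hgc).neg
      have hopen := hcon.isOpen_inter_preimage isOpen_Ioi (isOpen_compl_singleton (x := (0:ℝ)))
      refine (hopen.measure_pos volume ⟨x₀, hx₀, ?_⟩).trans_le (measure_mono ?_)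
      · change -(f (projIcc 0 1 zero_le_one (Real.exp (-x₀))) * g x₀) ≠ 0
        rw [projIcc_of_mem _ (hE x₀ hx₀)]
        have : f ⟨Real.exp (-x₀), hE x₀ hx₀⟩ = ε := by
          change max 0 (ε - |y₀ - y₀|) = ε
          simp [hε.le]
        rw [this]
        exact neg_ne_zero.mpr (mul_ne_zero hε.ne' hneg.ne)
      · rintro x ⟨h1, h2⟩
        exact ⟨h2, h1⟩
    · filter_upwards [ae_restrict_mem measurableSet_Ioi] with x hx
      have := hle x hx
      simp only [Pi.zero_apply]
      linarith
  rw [integral_neg] at hlt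
  linarith [pos f fun y => le_max_left _ _]

/-- Uniqueness for the Laplace transform along the integers. -/
lemma eq_zero_of_laplace_eq_zero {g : ℝ → ℝ} (hgc : ContinuousOn g (Ioi 0))
    (hg : IntegrableOn g (Ioi 0)) (h : ∀ k : ℕ, ∫ x in Ioi 0, Real.exp (-x) ^ k * g x = 0) :
    ∀ x ∈ Ioi (0 : ℝ), g x = 0 := by
  intro x hx
  have h1 := nonneg_of_laplace_completelyMonotone hgc hg
    (fun N => by simp_rw [h]; exact CMUpTo.const le_rfl) x hx
  have h2 := nonneg_of_laplace_completelyMonotone hgc.neg hg.neg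
    (fun N => by
      simp only [Pi.neg_apply, mul_neg, integral_neg, h, neg_zero]
      exact CMUpTo.const le_rfl) x hx
  simp only [Pi.neg_apply] at h2
  linarith

lemma Gamma_add_le_rpow_mul {x p : ℝ} (hx : 0 < x) (hp : p ∈ Ioo (0 : ℝ) 1) :
    Real.Gamma (x + p) ≤ x ^ p * Real.Gamma x := by
  have h := Real.Gamma_mul_add_mul_le_rpow_Gamma_mul_rpow_Gamma hx (by linarith : 0 < x + 1)
    (sub_pos.mpr hp.2) hp.1 (by ring)
  have hG := Real.Gamma_pos_of_pos hx
  rw [Real.Gamma_add_one hx.ne', Real.mul_rpow hx.le hG.le, mul_left_comm,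
    ← Real.rpow_add hG, sub_add_cancel, Real.rpow_one] at h
  convert h using 2
  ring

lemma rpow_mul_Gamma_le {x α : ℝ} (hx : 0 < x) (hα : 1 < α) :
    x ^ α * Real.Gamma x ≤ Real.Gamma (x + α) := by
  have h0 : 0 < α := by linarith
  have h := Real.Gamma_mul_add_mul_le_rpow_Gamma_mul_rpow_Gamma hx (by linarith : 0 < x + α)
    (sub_pos.mpr (inv_lt_one_of_one_lt₀ hα)) (inv_pos.mpr h0) (by ring)
  have hG := Real.Gamma_pos_of_pos hx
  have hG' := Real.Gamma_pos_of_pos (by linarith : 0 < x + α)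
  have e : (1 - α⁻¹) * x + α⁻¹ * (x + α) = x + 1 := by field_simp; ring
  have h1 : x * Real.Gamma x ^ α⁻¹ ≤ Real.Gamma (x + α) ^ α⁻¹ := by
    rw [e, Real.Gamma_add_one hx.ne'] at h
    have h2 : x * Real.Gamma x
        = Real.Gamma x ^ (1 - α⁻¹) * (x * Real.Gamma x ^ α⁻¹) := by
      rw [mul_left_comm, ← Real.rpow_add hG, sub_add_cancel, Real.rpow_one]
    rw [h2] at h
    exact le_of_mul_le_mul_left h (Real.rpow_pos_of_pos hG _)
  have h3 := Real.rpow_le_rpow (by positivity) h1 h0.le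
  rwa [Real.mul_rpow hx.le (by positivity), ← Real.rpow_mul hG.le, ← Real.rpow_mul hG'.le,
    inv_mul_cancel₀ h0.ne', Real.rpow_one, Real.rpow_one] at h3

lemma summable_mul_pow_of_le_mul {a r : ℕ → ℝ} (ha : ∀ n, 0 ≤ a n)
    (h : ∀ n, a (n + 1) ≤ r n * a n) (hr : Filter.Tendsto r Filter.atTop (nhds 0)) {X : ℝ}
    (hX : 0 ≤ X) : Summable (fun n => a n * X ^ n) := by
  have h1 : Filter.Tendsto (fun n => r n * X) Filter.atTop (nhds 0) := by
    simpa using hr.mul_const X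
  refine summable_of_ratio_norm_eventually_le (r := 1 / 2) (by norm_num) ?_
  filter_upwards [h1.eventually (gt_mem_nhds (by norm_num : (0 : ℝ) < 1 / 2))] with n hn
  rw [Real.norm_of_nonneg (mul_nonneg (ha _) (pow_nonneg hX _)),
    Real.norm_of_nonneg (mul_nonneg (ha _) (pow_nonneg hX _)), pow_succ]
  calc a (n + 1) * (X ^ n * X) ≤ r n * a n * (X ^ n * X) := by gcongr; exact h n
    _ = (r n * X) * (a n * X ^ n) := by ring
    _ ≤ 1 / 2 * (a n * X ^ n) := by
      gcongr
      exact mul_nonneg (ha _) (pow_nonneg hX _)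

lemma tendsto_natCast_add_one_rpow_neg {p : ℝ} (hp : p < 0) (c : ℝ) :
    Filter.Tendsto (fun n : ℕ => c * ((n : ℝ) + 1) ^ p) Filter.atTop (nhds 0) := by
  have h := (tendsto_rpow_neg_atTop (neg_pos.mpr hp)).comp
    (Filter.tendsto_atTop_add_const_right _ 1 tendsto_natCast_atTop_atTop)
  simpa [Function.comp_def] using h.const_mul c

lemma inv_Gamma_succ_le {α : ℝ} (hα : 1 < α) (n : ℕ) :
    (Real.Gamma (α * ((n + 1 : ℕ) + 1)))⁻¹
      ≤ ((n : ℝ) + 1) ^ (-α) * (Real.Gamma (α * ((n : ℝ) + 1)))⁻¹ := by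
  have hn : (0 : ℝ) < n + 1 := by positivity
  have hx : 0 < α * ((n : ℝ) + 1) := by positivity
  have h := rpow_mul_Gamma_le hx hα
  have hG := Real.Gamma_pos_of_pos hx
  have h1 : ((n : ℝ) + 1) ^ α ≤ (α * ((n : ℝ) + 1)) ^ α := by
    apply Real.rpow_le_rpow hn.le _ (by linarith)
    nlinarith
  rw [Real.rpow_neg hn.le, ← mul_inv]
  apply inv_anti₀ (by positivity)
  calc _ ≤ (α * ((n : ℝ) + 1)) ^ α * Real.Gamma (α * ((n : ℝ) + 1)) := by gcongr
    _ ≤ _ := h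
    _ = _ := by push_cast; ring_nf

lemma summable_inv_Gamma_mul_pow {α X : ℝ} (hα : 1 < α) (hX : 0 ≤ X) :
    Summable (fun n : ℕ => (Real.Gamma (α * ((n : ℝ) + 1)))⁻¹ * X ^ n) := by
  refine summable_mul_pow_of_le_mul (r := fun n => 1 * ((n : ℝ) + 1) ^ (-α)) (fun n => ?_)
    (fun n => ?_) (tendsto_natCast_add_one_rpow_neg (by linarith) 1) hX
  · have : 0 < α * ((n : ℝ) + 1) := by positivity
    exact (inv_pos.mpr (Real.Gamma_pos_of_pos this)).le
  · rw [one_mul]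
    exact inv_Gamma_succ_le hα n

lemma summable_Gamma_div_Gamma_mul_pow {α X : ℝ} (hα : 1 < α) (hX : 0 ≤ X) :
    Summable (fun n : ℕ => Real.Gamma ((n : ℝ) + 1 - 1 / α + 1) *
      (Real.Gamma (α * ((n : ℝ) + 1)))⁻¹ * X ^ n) := by
  have hρ : 1 / α < 1 := by rw [div_lt_one (by linarith)]; exact hα
  have hρ0 : 0 < 1 / α := by positivity
  refine summable_mul_pow_of_le_mul (r := fun n => 2 * ((n : ℝ) + 1) ^ (1 - α)) (fun n => ?_)
    (fun n => ?_) (tendsto_natCast_add_one_rpow_neg (by linarith) 2) hX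
  · have : 0 < α * ((n : ℝ) + 1) := by positivity
    have h2 : 0 < (n : ℝ) + 1 - 1 / α + 1 := by
      have hn : (0 : ℝ) ≤ n := by positivity
      linarith
    have := Real.Gamma_pos_of_pos this
    have := Real.Gamma_pos_of_pos h2
    positivity
  · have hn : (0 : ℝ) ≤ n := by positivity
    have h2 : 0 < (n : ℝ) + 1 - 1 / α + 1 := by linarith
    have hG2 := Real.Gamma_pos_of_pos h2
    have hG := Real.Gamma_pos_of_pos (by positivity : 0 < α * ((n : ℝ) + 1))
    have hG' := Real.Gamma_pos_of_pos (by positivity : 0 < α * (((n + 1 : ℕ) : ℝ) + 1))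
    have e : Real.Gamma (((n + 1 : ℕ) : ℝ) + 1 - 1 / α + 1)
        = ((n : ℝ) + 1 - 1 / α + 1) * Real.Gamma ((n : ℝ) + 1 - 1 / α + 1) := by
      rw [← Real.Gamma_add_one h2.ne']
      push_cast
      ring_nf
    rw [e]
    have e2 : ((n : ℝ) + 1) ^ (1 - α) = ((n : ℝ) + 1) * ((n : ℝ) + 1) ^ (-α) := by
      rw [sub_eq_add_neg, Real.rpow_add (by linarith), Real.rpow_one]
    calc _ ≤ (2 * ((n : ℝ) + 1)) * Real.Gamma ((n : ℝ) + 1 - 1 / α + 1) *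
          (((n : ℝ) + 1) ^ (-α) * (Real.Gamma (α * ((n : ℝ) + 1)))⁻¹) := by
          gcongr
          · linarith
          · exact inv_Gamma_succ_le hα n
      _ = _ := by rw [e2]; ring

lemma summable_Gamma_div_factorial_mul_pow {p X : ℝ} (hp : p ∈ Ioo (0 : ℝ) 1) (hX : 0 ≤ X) :
    Summable (fun n : ℕ => Real.Gamma (p * n + 1) * ((n.factorial : ℝ))⁻¹ * X ^ n) := by
  have hp0 := hp.1
  refine summable_mul_pow_of_le_mul (r := fun n => 1 * ((n : ℝ) + 1) ^ (p - 1)) (fun n => ?_)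
    (fun n => ?_) (tendsto_natCast_add_one_rpow_neg (by linarith [hp.2]) 1) hX
  · have := Real.Gamma_pos_of_pos (by positivity : 0 < p * n + 1)
    positivity
  · have h := Gamma_add_le_rpow_mul (by positivity : 0 < p * n + 1) hp
    have hG := Real.Gamma_pos_of_pos (by positivity : 0 < p * n + 1)
    have hn : (0 : ℝ) < n + 1 := by positivity
    have e2 : ((n : ℝ) + 1) ^ (p - 1) = ((n : ℝ) + 1) ^ p * ((n : ℝ) + 1)⁻¹ := by
      rw [sub_eq_add_neg, Real.rpow_add hn, Real.rpow_neg_one]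
    have e3 : (((n + 1).factorial : ℕ) : ℝ)⁻¹ = ((n : ℝ) + 1)⁻¹ * ((n.factorial : ℝ))⁻¹ := by
      rw [Nat.factorial_succ]
      push_cast
      rw [mul_inv]
    have h1 : (p * n + 1) ^ p ≤ ((n : ℝ) + 1) ^ p := by
      apply Real.rpow_le_rpow (by positivity) _ hp0.le
      have : (0 : ℝ) ≤ n := by positivity
      nlinarith [hp.2]
    have e4 : Real.Gamma (p * ((n + 1 : ℕ) : ℝ) + 1) ≤ ((n : ℝ) + 1) ^ p * Real.Gamma (p * n + 1) := by
      calc _ = Real.Gamma (p * n + 1 + p) := by push_cast; ring_nf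
        _ ≤ _ := h
        _ ≤ _ := by gcongr
    rw [e3]
    calc _ ≤ ((n : ℝ) + 1) ^ p * Real.Gamma (p * n + 1)
          * (((n : ℝ) + 1)⁻¹ * ((n.factorial : ℝ))⁻¹) := by gcongr
      _ = _ := by rw [e2]; ring

/-- The reflection formula for `1 / Γ(-a)`; both sides vanish at the poles of `Γ`. -/
lemma inv_Gamma_neg {a : ℝ} (ha : -1 < a) :
    (Real.Gamma (-a))⁻¹ = -(Real.Gamma (a + 1) * Real.sin (π * a) / π) := by
  have h := Real.Gamma_mul_Gamma_one_sub (-a)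
  have hG := Real.Gamma_pos_of_pos (by linarith : 0 < a + 1)
  rw [show (1 : ℝ) - -a = a + 1 by ring, mul_neg, Real.sin_neg] at h
  have hπ := Real.pi_pos
  by_cases hs : Real.sin (π * a) = 0
  · rw [hs, neg_zero, div_zero, mul_eq_zero] at h
    rw [h.resolve_right hG.ne', hs]
    simp
  · have : Real.Gamma (-a) ≠ 0 := by
      intro h0
      rw [h0, zero_mul] at h
      exact div_ne_zero hπ.ne' (neg_ne_zero.mpr hs) h.symm
    rw [eq_div_iff (neg_ne_zero.mpr hs)] at h
    rw [inv_eq_iff_eq_inv, eq_comm, inv_eq_iff_eq_inv]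
    apply eq_inv_of_mul_eq_one_left
    rw [neg_mul, div_mul_eq_mul_div, neg_eq_iff_eq_neg, div_eq_iff hπ.ne']
    linarith

lemma abs_inv_Gamma_neg_le {a : ℝ} (ha : -1 < a) :
    |(Real.Gamma (-a))⁻¹| ≤ Real.Gamma (a + 1) := by
  have hG := Real.Gamma_pos_of_pos (by linarith : 0 < a + 1)
  rw [inv_Gamma_neg ha, abs_neg, abs_div, abs_mul, abs_of_pos hG, abs_of_pos Real.pi_pos,
    div_le_iff₀ Real.pi_pos]
  have := Real.abs_sin_le_one (π * a)
  have := Real.pi_gt_three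
  exact mul_le_mul_of_nonneg_left (by linarith) hG.le

lemma im_integral_div {G D : ℂ → ℂ} {ψ C T w₀ d : ℝ} (hψ : 0 < ψ)
    (hG : ∀ w : ℂ, 0 ≤ w.im → w.im ≤ ψ → DifferentiableAt ℂ G w) (hD : Differentiable ℂ D)
    (hD0 : D w₀ = 0) (hd : HasDerivAt D d w₀) (hd0 : d ≠ 0)
    (hDne : ∀ w : ℂ, 0 ≤ w.im → w.im ≤ ψ → w ≠ w₀ → D w ≠ 0)
    (hGr : ∀ t : ℝ, (G t).im = 0) (hDr : ∀ t : ℝ, (D t).im = 0)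
    (hb : ∀ w : ℂ, 0 ≤ w.im → w.im ≤ ψ → T ≤ |w.re| → ‖G w / D w‖ ≤ C / w.re ^ 2) :
    Integrable (fun t : ℝ => (G (t + ψ * Complex.I) / D (t + ψ * Complex.I)).im) ∧
      ∫ t : ℝ, (G (t + ψ * Complex.I) / D (t + ψ * Complex.I)).im = -π * ((G w₀).re / d) := by
  have hq : ∀ w : ℂ, w ≠ w₀ → dslope D w₀ w = D w / (w - w₀) := by
    intro w hw
    rw [dslope_of_ne _ hw, slope_def_field, hD0, sub_zero]
  have hq0 : dslope D w₀ (w₀ : ℂ) = d := by rw [dslope_same, hd.deriv]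
  have hqd : Differentiable ℂ (dslope D (w₀ : ℂ)) := by
    have := (Complex.differentiableOn_dslope (f := D) (c := (w₀ : ℂ)) Filter.univ_mem).mpr
      hD.differentiableOn
    exact differentiableOn_univ.mp this
  have hqne : ∀ w : ℂ, 0 ≤ w.im → w.im ≤ ψ → dslope D w₀ w ≠ 0 := by
    intro w h1 h2
    by_cases hw : w = w₀
    · rw [hw, hq0]
      exact_mod_cast hd0
    · rw [hq w hw]
      exact div_ne_zero (hDne w h1 h2 hw) (sub_ne_zero.mpr hw)
  have hreal : ∀ t : ℝ, (dslope D w₀ (t : ℂ)).im = 0 := by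
    intro t
    by_cases ht : (t : ℂ) = w₀
    · rw [ht, hq0, Complex.ofReal_im]
    · rw [hq _ ht, ← Complex.ofReal_sub, Complex.div_ofReal_im, hDr, zero_div]
  have hA : ∀ w : ℂ, w ≠ w₀ → G w / dslope D w₀ w = (w - w₀) * (G w / D w) := by
    intro w hw
    rw [hq w hw, div_div_eq_mul_div]
    ring
  have key := im_integral_div_sub (A := fun w => G w / dslope D w₀ w) (ψ := ψ)
    (C := C * (1 + ψ + |w₀|)) (T := max T (1 + |w₀|)) (w₀ := w₀) hψ
    (fun w h1 h2 => (hG w h1 h2).div (hqd w) (hqne w h1 h2))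
    (fun t => by
      simp only [Complex.div_im, hGr, hreal, zero_mul, mul_zero, zero_div, sub_zero])
    (fun w h1 h2 h3 => by
      have hT := (le_max_left _ _).trans h3
      have h4 := (le_max_right _ _).trans h3
      have h5 : 0 < |w.re| := by linarith [abs_nonneg w₀]
      have hw : w ≠ w₀ := by
        rintro rfl
        simp at h4
        linarith
      have hC := hb w h1 h2 hT
      have hC0 : 0 ≤ C := by
        have := (norm_nonneg _).trans hC
        have h6 : 0 < w.re ^ 2 := by rw [← sq_abs]; positivity
        exact (div_nonneg_iff.mp this).elim (fun h => h.1) fun h => by linarith [h.2]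
      have hn : ‖w - w₀‖ ≤ (1 + ψ + |w₀|) * |w.re| := by
        calc ‖w - w₀‖ ≤ ‖w‖ + ‖(w₀ : ℂ)‖ := norm_sub_le _ _
          _ ≤ (|w.re| + |w.im|) + |w₀| := by
            rw [Complex.norm_real, Real.norm_eq_abs]
            gcongr
            exact Complex.norm_le_abs_re_add_abs_im w
          _ ≤ _ := by
            rw [abs_of_nonneg h1]
            have h7 : 1 ≤ |w.re| := by linarith [abs_nonneg w₀]
            nlinarith [abs_nonneg w₀]
      rw [hA w hw, norm_mul]
      calc _ ≤ ((1 + ψ + |w₀|) * |w.re|) * (C / w.re ^ 2) := by gcongr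
        _ = _ := by
          rw [← sq_abs]
          field_simp)
  have e : ∀ t : ℝ, G (t + ψ * Complex.I) / dslope D w₀ (t + ψ * Complex.I) /
      (t + ψ * Complex.I - w₀) = G (t + ψ * Complex.I) / D (t + ψ * Complex.I) := by
    intro t
    have hw : (t + ψ * Complex.I : ℂ) ≠ w₀ := by
      intro h
      have := congrArg Complex.im h
      simp at this
      exact hψ.ne' this
    rw [hA _ hw, mul_div_assoc, mul_div_cancel₀]
    exact sub_ne_zero.mpr hw
  simp only [e, hq0] at key
  rwa [Complex.div_ofReal_re] at key

section ExpSubst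
variable {F : Type*} [NormedAddCommGroup F] [NormedSpace ℝ F]

lemma integral_Ioi_zero_eq_integral_exp (g : ℝ → F) :
    ∫ x in Ioi 0, g x = ∫ t, Real.exp t • g (Real.exp t) := by
  have h := integral_image_eq_integral_abs_deriv_smul (f := Real.exp) (f' := Real.exp)
    (s := univ) MeasurableSet.univ (fun x _ => (Real.hasDerivAt_exp x).hasDerivWithinAt)
    Real.exp_injective.injOn g
  rw [image_univ, Real.range_exp, setIntegral_univ] at h
  simpa only [Real.abs_exp] using h

lemma integrableOn_Ioi_zero_iff_integrable_exp (g : ℝ → F) :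
    IntegrableOn g (Ioi 0) ↔ Integrable (fun t => Real.exp t • g (Real.exp t)) := by
  have h := integrableOn_image_iff_integrableOn_abs_deriv_smul (f := Real.exp) (f' := Real.exp)
    (s := univ) MeasurableSet.univ (fun x _ => (Real.hasDerivAt_exp x).hasDerivWithinAt)
    Real.exp_injective.injOn g
  rw [image_univ, Real.range_exp, integrableOn_univ] at h
  simpa only [Real.abs_exp] using h
end ExpSubst

lemma exp_neg_mul_abs_le {c : ℝ} (hc : 0 < c) {u : ℝ} (hu : u ≠ 0) :
    Real.exp (-(c * |u|)) ≤ 2 / c ^ 2 / u ^ 2 := by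
  have h0 : 0 < |u| := abs_pos.mpr hu
  have h := Real.quadratic_le_exp_of_nonneg (by positivity : 0 ≤ c * |u|)
  have h1 : 0 < c * |u| := by positivity
  rw [Real.exp_neg, div_div, ← sq_abs u, inv_le_comm₀ (Real.exp_pos _) (by positivity), inv_div]
  nlinarith

/-- The spectral density in the representation of `exp z - α z ^ (α - 1) E_{α,α}(z ^ α)` as a
Laplace transform. -/
noncomputable def spectralKernel (α r : ℝ) : ℝ :=
  -(α / π) * (Real.sin (π * α) * r ^ α / ((r ^ α) ^ 2 - 2 * r ^ α * Real.cos (π * α) + 1))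

section Kernel
variable {α : ℝ} (hα : α ∈ Ioo (1 : ℝ) 2)
include hα

lemma sin_pi_mul_neg : Real.sin (π * α) < 0 := by
  have h1 := Real.pi_pos
  have : 0 < Real.sin (π * α - π) :=
    Real.sin_pos_of_pos_of_lt_pi (by nlinarith [hα.1]) (by nlinarith [hα.2])
  rw [Real.sin_sub_pi] at this
  linarith

omit hα in
lemma sin_sq_le_kernel_denom (R : ℝ) :
    Real.sin (π * α) ^ 2 ≤ R ^ 2 - 2 * R * Real.cos (π * α) + 1 := by
  have := Real.sin_sq_add_cos_sq (π * α)
  nlinarith [sq_nonneg (R - Real.cos (π * α))]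

omit hα in
lemma sq_mul_sin_sq_le_kernel_denom (R : ℝ) :
    R ^ 2 * Real.sin (π * α) ^ 2 ≤ R ^ 2 - 2 * R * Real.cos (π * α) + 1 := by
  have := Real.sin_sq_add_cos_sq (π * α)
  nlinarith [sq_nonneg (R * Real.cos (π * α) - 1)]

lemma kernel_denom_pos (R : ℝ) : 0 < R ^ 2 - 2 * R * Real.cos (π * α) + 1 := by
  have := sin_sq_le_kernel_denom (α := α) R
  have := pow_pos (neg_pos.mpr (sin_pi_mul_neg hα)) 2
  nlinarith

lemma spectralKernel_nonneg {r : ℝ} (hr : 0 ≤ r) : 0 ≤ spectralKernel α r := by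
  have h1 := kernel_denom_pos hα (r ^ α)
  have h2 := sin_pi_mul_neg hα
  have h3 := Real.rpow_nonneg hr α
  have h4 : 0 < α := by linarith [hα.1]
  have h5 := Real.pi_pos
  rw [spectralKernel, neg_mul, ← mul_neg, ← neg_div, ← neg_mul]
  have : 0 ≤ -Real.sin (π * α) := by linarith
  positivity

lemma exists_spectralKernel_le : ∃ C : ℝ, 0 < C ∧
    (∀ r, 0 ≤ r → spectralKernel α r ≤ C * r ^ α) ∧
    ∀ r, 0 < r → spectralKernel α r ≤ C * r ^ (-α) := by
  have h2 := sin_pi_mul_neg hα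
  have h4 : 0 < α := by linarith [hα.1]
  have h5 := Real.pi_pos
  set S := -Real.sin (π * α) with hS
  have hS0 : 0 < S := by linarith
  have e : ∀ r, spectralKernel α r = α / π *
      (S * r ^ α / ((r ^ α) ^ 2 - 2 * r ^ α * Real.cos (π * α) + 1)) := by
    intro r
    rw [spectralKernel, hS]
    ring
  refine ⟨α / π / S, by positivity, fun r hr => ?_, fun r hr => ?_⟩
  · have h1 := sin_sq_le_kernel_denom (α := α) (r ^ α)
    have h3 := Real.rpow_nonneg hr α
    have h6 : S ^ 2 ≤ (r ^ α) ^ 2 - 2 * r ^ α * Real.cos (π * α) + 1 := by rwa [hS, neg_sq]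
    rw [e]
    calc _ ≤ α / π * (S * r ^ α / S ^ 2) := by gcongr
      _ = _ := by field_simp
  · have h1 := sq_mul_sin_sq_le_kernel_denom (α := α) (r ^ α)
    have h3 := Real.rpow_pos_of_pos hr α
    have h6 : (r ^ α) ^ 2 * S ^ 2 ≤ (r ^ α) ^ 2 - 2 * r ^ α * Real.cos (π * α) + 1 := by
      rwa [hS, neg_sq]
    rw [e, Real.rpow_neg hr.le]
    calc _ ≤ α / π * (S * r ^ α / ((r ^ α) ^ 2 * S ^ 2)) := by gcongr
      _ = _ := by field_simp

omit hα in
lemma measurable_spectralKernel : Measurable (spectralKernel α) := by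
  unfold spectralKernel
  fun_prop

lemma integrableOn_spectralKernel : IntegrableOn (spectralKernel α) (Ioi 0) := by
  obtain ⟨C, hC, h1, h2⟩ := exists_spectralKernel_le hα
  rw [← Ioc_union_Ioi_eq_Ioi zero_le_one, integrableOn_union]
  constructor
  · refine Integrable.mono' (g := fun _ => C) (integrable_const C)
      measurable_spectralKernel.aestronglyMeasurable ?_
    filter_upwards [ae_restrict_mem measurableSet_Ioc] with r hr
    rw [Real.norm_of_nonneg (spectralKernel_nonneg hα hr.1.le)]
    refine (h1 r hr.1.le).trans ?_
    have := Real.rpow_le_one hr.1.le hr.2 (by linarith [hα.1] : 0 ≤ α)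
    nlinarith
  · refine Integrable.mono' (g := fun r => C * r ^ (-α))
      ((integrableOn_Ioi_rpow_of_lt (by linarith [hα.1]) one_pos).const_mul C)
      measurable_spectralKernel.aestronglyMeasurable ?_
    filter_upwards [ae_restrict_mem measurableSet_Ioi] with r hr
    have : (0 : ℝ) < r := one_pos.trans hr
    rw [Real.norm_of_nonneg (spectralKernel_nonneg hα this.le)]
    exact h2 r this

end Kernel

lemma eq_of_exp_mul_eq {c ψ w₀ : ℝ} (hc : 0 < c) (hψ : c * ψ < 2 * π) {w : ℂ} (h0 : 0 ≤ w.im)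
    (h1 : w.im ≤ ψ) (h : Complex.exp (c * w) = Complex.exp (c * w₀)) : w = w₀ := by
  obtain ⟨n, hn⟩ := Complex.exp_eq_exp_iff_exists_int.mp h
  have him := congrArg Complex.im hn
  simp at him
  have hπ := Real.pi_pos
  have h2 : (0 : ℝ) ≤ n * (2 * π) := by rw [← him]; positivity
  have h3 : n * (2 * π) < 1 * (2 * π) := by
    rw [← him, one_mul]
    exact (mul_le_mul_of_nonneg_left h1 hc.le).trans_lt hψ
  have h4 : (0 : ℝ) ≤ n := nonneg_of_mul_nonneg_left h2 (by positivity)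
  have h5 : (n : ℝ) < 1 := lt_of_mul_lt_mul_right h3 (by positivity)
  have h6 : n = 0 := by
    have h7 : (0 : ℤ) ≤ n := by exact_mod_cast h4
    have h8 : n < (1 : ℤ) := by exact_mod_cast h5
    omega
  rw [h6, Int.cast_zero, zero_mul, add_zero] at hn
  exact mul_left_cancel₀ (Complex.ofReal_ne_zero.mpr hc.ne') hn

lemma norm_exp_div_exp_mul_sub_one_le {α : ℝ} (hα : α ∈ Ioo (1 : ℝ) 2) {w : ℂ} (hw : 1 ≤ |w.re|) :
    ‖Complex.exp w / (Complex.exp (α * w) - 1)‖ ≤ 2 * Real.exp (-((α - 1) * |w.re|)) := by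
  obtain ⟨ha, hb⟩ := hα
  have he : (2 : ℝ) ≤ Real.exp 1 := by linarith [Real.add_one_le_exp (1 : ℝ)]
  have hn : ‖Complex.exp (α * w)‖ = Real.exp (α * w.re) := by
    rw [Complex.norm_exp, Complex.re_ofReal_mul]
  rw [norm_div, Complex.norm_exp]
  rcases le_total 0 w.re with h | h
  · rw [abs_of_nonneg h] at hw ⊢
    have h1 : 2 ≤ Real.exp (α * w.re) := he.trans (Real.exp_le_exp.mpr (by nlinarith))
    have h2 : Real.exp (α * w.re) / 2 ≤ ‖Complex.exp (α * w) - 1‖ := by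
      have := norm_sub_norm_le (Complex.exp (α * w)) 1
      rw [hn, norm_one] at this
      linarith
    have h3 : Real.exp (-((α - 1) * w.re)) * Real.exp (α * w.re) = Real.exp w.re := by
      rw [← Real.exp_add]; ring_nf
    rw [div_le_iff₀ (by linarith)]
    have := Real.exp_pos (-((α - 1) * w.re))
    nlinarith
  · rw [abs_of_nonpos h] at hw ⊢
    have h1 : Real.exp (α * w.re) ≤ 1 / 2 := by
      have : Real.exp (α * w.re) ≤ Real.exp (-1) := Real.exp_le_exp.mpr (by nlinarith)
      rw [Real.exp_neg] at this
      exact this.trans ((inv_anti₀ two_pos he).trans (by norm_num))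
    have h2 : 1 / 2 ≤ ‖Complex.exp (α * w) - 1‖ := by
      have := norm_sub_norm_le 1 (Complex.exp (α * w))
      rw [hn, norm_one, norm_sub_rev] at this
      linarith
    have h3 : Real.exp w.re ≤ Real.exp (-((α - 1) * -w.re)) := Real.exp_le_exp.mpr (by nlinarith)
    rw [div_le_iff₀ (by linarith)]
    have := Real.exp_pos (-((α - 1) * -w.re))
    nlinarith

lemma norm_exp_sub_one_div_le {s : ℝ} (hs : 1 < s) {w : ℂ} (hw : 1 + Real.log s ≤ |w.re|) :
    ‖(Complex.exp w - 1) / (s - Complex.exp w)‖ ≤ 4 := by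
  have he : (2 : ℝ) ≤ Real.exp 1 := by linarith [Real.add_one_le_exp (1 : ℝ)]
  have hσ : 0 < Real.log s := Real.log_pos hs
  have hE := Complex.norm_exp w
  have hs' : ‖(s : ℂ)‖ = s := by rw [Complex.norm_real, Real.norm_of_nonneg (by linarith)]
  have h1 : ‖Complex.exp w - 1‖ ≤ Real.exp w.re + 1 := by
    have := norm_sub_le (Complex.exp w) 1
    rwa [hE, norm_one] at this
  rw [norm_div]
  rcases le_total 0 w.re with h | h
  · rw [abs_of_nonneg h] at hw
    have h2 : 2 * s ≤ Real.exp w.re := by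
      have : Real.exp (1 + Real.log s) ≤ Real.exp w.re := Real.exp_le_exp.mpr hw
      rw [Real.exp_add, Real.exp_log (by linarith)] at this
      nlinarith
    have h3 : Real.exp w.re / 2 ≤ ‖(s : ℂ) - Complex.exp w‖ := by
      have := norm_sub_norm_le (Complex.exp w) s
      rw [hE, hs', norm_sub_rev] at this
      linarith
    rw [div_le_iff₀ (by linarith)]
    linarith
  · rw [abs_of_nonpos h] at hw
    have h2 : Real.exp w.re ≤ 1 / 2 := by
      have : Real.exp w.re ≤ Real.exp (-1) := Real.exp_le_exp.mpr (by linarith)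
      rw [Real.exp_neg] at this
      exact this.trans ((inv_anti₀ two_pos he).trans (by norm_num))
    have h3 : 1 / 2 ≤ ‖(s : ℂ) - Complex.exp w‖ := by
      have := norm_sub_norm_le (s : ℂ) (Complex.exp w)
      rw [hE, hs'] at this
      linarith
    rw [div_le_iff₀ (by linarith)]
    linarith

/-- The Stieltjes transform of the spectral kernel. -/
lemma integral_spectralKernel_div {α s : ℝ} (hα : α ∈ Ioo (1 : ℝ) 2) (hs : 1 < s) :
    ∫ r in Ioi 0, spectralKernel α r / (s + r) = 1 / (s - 1) - α / (s ^ α - 1) := by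
  have hπ := Real.pi_pos
  have hα0 : 0 < α := by linarith [hα.1]
  have hα1 : 0 < α - 1 := by linarith [hα.1]
  have hαπ : α * π < 2 * π := by nlinarith [hα.2]
  have hs0 : 0 < s := by linarith
  have hσ : 0 < Real.log s := Real.log_pos hs
  have hsα : 1 < s ^ α := Real.one_lt_rpow hs hα0
  set B : ℂ → ℂ := fun w => Complex.exp (α * w) - 1 with hB
  have hBd : Differentiable ℂ B := by fun_prop
  have hB0 : B (0 : ℝ) = 0 := by simp [hB]
  have hB' : HasDerivAt B α ((0 : ℝ) : ℂ) := by
    have := (((hasDerivAt_id ((0 : ℝ) : ℂ)).const_mul (α : ℂ)).cexp).sub_const 1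
    simpa [hB] using this
  have hBne : ∀ w : ℂ, 0 ≤ w.im → w.im ≤ π → w ≠ (0 : ℝ) → B w ≠ 0 := by
    intro w h0 h1 hw h
    refine hw (eq_of_exp_mul_eq hα0 hαπ h0 h1 ?_)
    simpa [hB, sub_eq_zero] using h
  have hexpr : ∀ t : ℝ, (Complex.exp (t : ℂ)).im = 0 := fun t => by
    rw [← Complex.ofReal_exp, Complex.ofReal_im]
  have hBr : ∀ t : ℝ, (B t).im = 0 := fun t => by
    simp only [hB]
    rw [← Complex.ofReal_mul, Complex.sub_im, hexpr, Complex.one_im, sub_zero]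
  have hpow : ∀ t : ℝ, 1 ≤ |t| →
      2 * Real.exp (-((α - 1) * |t|)) ≤ 2 * (2 / (α - 1) ^ 2) / t ^ 2 := fun t ht => by
    have : t ≠ 0 := by
      rintro rfl
      norm_num at ht
    rw [mul_div_assoc]
    exact mul_le_mul_of_nonneg_left (exp_neg_mul_abs_le hα1 this) two_pos.le
  obtain ⟨i1, e1⟩ := im_integral_div (G := Complex.exp) (D := B) (ψ := π) (T := 1)
    (C := 2 * (2 / (α - 1) ^ 2)) hπ (fun w _ _ => Complex.differentiable_exp w) hBd hB0 hB' hα0.ne'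
    hBne hexpr hBr
    (fun w h0 h1 hT => (norm_exp_div_exp_mul_sub_one_le hα hT).trans (hpow _ hT))
  set P : ℂ → ℂ := dslope (fun w => Complex.exp w - 1) 0 with hP
  set Q : ℂ → ℂ := dslope B 0 with hQ
  have hPd : Differentiable ℂ P := differentiableOn_univ.mp
    ((Complex.differentiableOn_dslope Filter.univ_mem).mpr (by fun_prop))
  have hQd : Differentiable ℂ Q := differentiableOn_univ.mp
    ((Complex.differentiableOn_dslope Filter.univ_mem).mpr hBd.differentiableOn)
  have hPne : ∀ w : ℂ, w ≠ 0 → P w = (Complex.exp w - 1) / w := by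
    intro w hw
    rw [hP, dslope_of_ne _ hw, slope_def_field, Complex.exp_zero]
    simp
  have hQne : ∀ w : ℂ, w ≠ 0 → Q w = B w / w := by
    intro w hw
    rw [hQ, dslope_of_ne _ hw, slope_def_field, ← Complex.ofReal_zero, hB0]
    simp
  have hQ0 : Q 0 = α := by
    rw [hQ, dslope_same]
    simpa using hB'.deriv
  have hP0 : P 0 = 1 := by
    rw [hP, dslope_same]
    simp
  have hQne0 : ∀ w : ℂ, 0 ≤ w.im → w.im ≤ π → Q w ≠ 0 := by
    intro w h0 h1
    by_cases hw : w = 0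
    · rw [hw, hQ0]
      exact_mod_cast hα0.ne'
    · rw [hQne w hw]
      exact div_ne_zero (hBne w h0 h1 (by simpa using hw)) hw
  have hPQ : ∀ w : ℂ, w ≠ 0 → P w / Q w = (Complex.exp w - 1) / B w := by
    intro w hw
    rw [hPne w hw, hQne w hw, div_div_div_cancel_right₀ hw]
  have hPQr : ∀ t : ℝ, (P t / Q t).im = 0 := by
    intro t
    by_cases ht : (t : ℂ) = 0
    · rw [ht, hP0, hQ0, ← Complex.ofReal_one, ← Complex.ofReal_div, Complex.ofReal_im]
    · rw [hPQ _ ht, Complex.div_im, Complex.sub_im, hexpr, hBr]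
      simp
  have hσs : Complex.exp (Real.log s : ℝ) = s := by
    rw [← Complex.ofReal_exp, Real.exp_log hs0]
  obtain ⟨i2, e2⟩ := im_integral_div (G := fun w => Complex.exp w * (P w / Q w))
    (D := fun w => s - Complex.exp w) (ψ := π) (T := 1 + Real.log s) (w₀ := Real.log s) (d := -s)
    (C := 4 * (2 * (2 / (α - 1) ^ 2))) hπ
    (fun w h0 h1 => (Complex.differentiable_exp w).mul ((hPd w).div (hQd w) (hQne0 w h0 h1)))
    (by fun_prop) (by rw [hσs, sub_self])
    (by
      have := (Complex.hasDerivAt_exp (Real.log s : ℝ)).const_sub (s : ℂ)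
      rw [hσs] at this
      simpa using this)
    (neg_ne_zero.mpr hs0.ne')
    (fun w h0 h1 hw h => by
      refine hw (eq_of_exp_mul_eq one_pos (by linarith : 1 * π < 2 * π) h0 h1 ?_)
      rw [Complex.ofReal_one, one_mul, one_mul, hσs]
      exact (sub_eq_zero.mp h).symm)
    (fun t => by
      have := hexpr t
      rw [Complex.mul_im, hexpr, hPQr]
      simp)
    (fun t => by rw [Complex.sub_im, hexpr, Complex.ofReal_im, sub_zero])
    (fun w h0 h1 hT => by
      have hT1 : 1 ≤ |w.re| := by linarith
      have hw : w ≠ 0 := by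
        rintro rfl
        norm_num at hT1
      have e : Complex.exp w * (P w / Q w) / (s - Complex.exp w)
          = (Complex.exp w - 1) / (s - Complex.exp w) * (Complex.exp w / B w) := by
        rw [hPQ w hw]
        ring
      rw [e, norm_mul, mul_div_assoc]
      exact mul_le_mul (norm_exp_sub_one_div_le hs hT)
        ((norm_exp_div_exp_mul_sub_one_le hα hT1).trans (hpow _ hT1)) (norm_nonneg _) (by norm_num))
  have hσ0 : ((Real.log s : ℝ) : ℂ) ≠ 0 := Complex.ofReal_ne_zero.mpr hσ.ne'
  have hval : Complex.exp (Real.log s : ℝ) * (P (Real.log s : ℝ) / Q (Real.log s : ℝ))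
      = ((s * ((s - 1) / (s ^ α - 1)) : ℝ) : ℂ) := by
    have hb : B (Real.log s : ℝ) = ((s ^ α - 1 : ℝ) : ℂ) := by
      simp only [hB]
      rw [← Complex.ofReal_mul, ← Complex.ofReal_exp, Real.rpow_def_of_pos hs0, mul_comm]
      simp
    rw [hPQ _ hσ0, hb, hσs]
    simp
  rw [hval, Complex.ofReal_re] at e2
  have hpt : ∀ t : ℝ, Real.exp t • (spectralKernel α (Real.exp t) / (s + Real.exp t)) =
      -(α / π / (s - 1)) * ((Complex.exp (t + π * Complex.I) / B (t + π * Complex.I)).im +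
        (Complex.exp (t + π * Complex.I) * (P (t + π * Complex.I) / Q (t + π * Complex.I)) /
          (s - Complex.exp (t + π * Complex.I))).im) := by
    intro t
    have hw : (t + π * Complex.I : ℂ) ≠ 0 := by
      intro h
      have := congrArg Complex.im h
      simp at this
    set R := Real.exp t ^ α with hR
    have hE : Complex.exp (t + π * Complex.I) = ((-Real.exp t : ℝ) : ℂ) := by
      rw [Complex.exp_add, Complex.exp_pi_mul_I]
      simp
    have hBt : B (t + π * Complex.I)
        = ((R * Real.cos (π * α) - 1 : ℝ) : ℂ) + (R * Real.sin (π * α) : ℝ) * Complex.I := by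
      simp only [hB]
      rw [show (α : ℂ) * (t + π * Complex.I) = (t * α : ℝ) + (π * α : ℝ) * Complex.I by
        push_cast; ring, Complex.exp_add, Complex.exp_mul_I, ← Complex.ofReal_exp, Real.exp_mul,
        ← Complex.ofReal_cos, ← Complex.ofReal_sin, ← hR]
      push_cast
      ring
    have hb0 : B (t + π * Complex.I) ≠ 0 := hBne _ (by simp [hπ.le]) (by simp) (by simpa using hw)
    have hse : 0 < s + Real.exp t := by positivity
    have hse' : (s : ℂ) - ((-Real.exp t : ℝ) : ℂ) = ((s + Real.exp t : ℝ) : ℂ) := by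
      push_cast; ring
    have hcomb : Complex.exp (t + π * Complex.I) / B (t + π * Complex.I) +
        (Complex.exp (t + π * Complex.I) * (P (t + π * Complex.I) / Q (t + π * Complex.I)) /
          (s - Complex.exp (t + π * Complex.I)))
        = ((-(s - 1) * Real.exp t / (s + Real.exp t) : ℝ) : ℂ) * (B (t + π * Complex.I))⁻¹ := by
      rw [hPQ _ hw, hE, hse']
      have : ((s + Real.exp t : ℝ) : ℂ) ≠ 0 := Complex.ofReal_ne_zero.mpr hse.ne'
      rw [Complex.ofReal_div]
      field_simp
      push_cast
      ring
    rw [← Complex.add_im, hcomb, Complex.im_ofReal_mul, Complex.inv_im, hBt, Complex.normSq_add_mul_I]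
    have hden := kernel_denom_pos hα R
    have hsq := Real.sin_sq_add_cos_sq (π * α)
    have hden' : (R * Real.cos (π * α) - 1) ^ 2 + (R * Real.sin (π * α)) ^ 2
        = R ^ 2 - 2 * R * Real.cos (π * α) + 1 := by
      linear_combination R ^ 2 * hsq
    rw [hden', spectralKernel, ← hR]
    have : s - 1 ≠ 0 := by linarith
    simp only [smul_eq_mul, Complex.add_im, Complex.ofReal_im, Complex.im_ofReal_mul, Complex.I_im]
    field_simp
    ring
  rw [integral_Ioi_zero_eq_integral_exp]
  simp_rw [hpt]
  rw [integral_const_mul, integral_add i1 i2, e1, e2]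
  have : s - 1 ≠ 0 := by linarith
  have : s ^ α - 1 ≠ 0 := by linarith
  simp
  field_simp
  ring

/-- The Mittag-Leffler function `E_{α,α}`. -/
noncomputable def mittagLeffler (α : ℝ) (z : ℂ) : ℂ :=
  ∑' n : ℕ, (((Real.Gamma (α * ((n : ℝ) + 1)))⁻¹ : ℝ) : ℂ) * z ^ n

lemma differentiable_mittagLeffler {α : ℝ} (hα : 1 < α) : Differentiable ℂ (mittagLeffler α) := by
  intro z
  have h : DifferentiableOn ℂ (mittagLeffler α) (Metric.ball 0 (‖z‖ + 1)) := by
    refine Complex.differentiableOn_tsum_of_summable_norm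
      (summable_inv_Gamma_mul_pow hα (by positivity : 0 ≤ ‖z‖ + 1)) (fun n => by fun_prop)
      Metric.isOpen_ball (fun n w hw => ?_)
    have hG := Real.Gamma_pos_of_pos (by positivity : 0 < α * ((n : ℝ) + 1))
    rw [norm_mul, norm_pow, Complex.norm_real, Real.norm_of_nonneg (by positivity)]
    have : ‖w‖ ≤ ‖z‖ + 1 := (mem_ball_zero_iff.mp hw).le
    gcongr
  exact h.differentiableAt (Metric.isOpen_ball.mem_nhds (by simp))

/-- The entire function `exp z - α z ^ (α - 1) E_{α,α}(z ^ α)` in the logarithmic coordinate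
`z = exp w`. -/
noncomputable def logResolvent (α : ℝ) (w : ℂ) : ℂ :=
  Complex.exp (Complex.exp w) -
    α * Complex.exp ((α - 1) * w) * mittagLeffler α (Complex.exp (α * w))

lemma differentiable_logResolvent {α : ℝ} (hα : 1 < α) : Differentiable ℂ (logResolvent α) := by
  have := differentiable_mittagLeffler hα
  unfold logResolvent
  fun_prop

/-- The function `α z ^ (α - 1) E_{α,α}(z ^ α)` on the half-line. -/
noncomputable def resolventDensity (α x : ℝ) : ℝ :=
  ∑' n : ℕ, α * (Real.Gamma (α * ((n : ℝ) + 1)))⁻¹ * x ^ (α * ((n : ℝ) + 1) - 1)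

lemma logResolvent_ofReal (α t : ℝ) :
    logResolvent α t
      = ((Real.exp (Real.exp t) - resolventDensity α (Real.exp t) : ℝ) : ℂ) := by
  rw [logResolvent, resolventDensity, mittagLeffler, ← tsum_mul_left]
  push_cast
  congr 2
  ext n
  rw [← Real.exp_mul]
  push_cast
  rw [← Complex.exp_nat_mul]
  have : (t : ℂ) * (α * (n + 1) - 1) = (α - 1) * t + n * (α * t) := by ring
  rw [this, Complex.exp_add]
  ring

lemma integral_laplace_resolventDensity {α s : ℝ} (hα : 1 < α) (hs : 1 < s) :
    IntegrableOn (fun x => Real.exp (-(s * x)) * resolventDensity α x) (Ioi 0) ∧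
      ∫ x in Ioi 0, Real.exp (-(s * x)) * resolventDensity α x = α / (s ^ α - 1) := by
  have hα0 : 0 < α := by linarith
  have hs0 : 0 < s := by linarith
  set F : ℕ → ℝ → ℝ := fun n x =>
    Real.exp (-(s * x)) * (α * (Real.Gamma (α * ((n : ℝ) + 1)))⁻¹ * x ^ (α * ((n : ℝ) + 1) - 1))
    with hF
  have hn0 : ∀ n : ℕ, 0 < α * ((n : ℝ) + 1) := fun n => by positivity
  have hnn : ∀ n : ℕ, ∀ x ∈ Ioi (0 : ℝ), 0 ≤ F n x := fun n x hx => by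
    have := Real.Gamma_pos_of_pos (hn0 n)
    have := Real.rpow_nonneg (le_of_lt hx) (α * ((n : ℝ) + 1) - 1)
    simp only [hF]
    positivity
  have hFint : ∀ n, IntegrableOn (F n) (Ioi 0) := fun n => by
    have h := (integrableOn_rpow_mul_exp_neg_mul_rpow (s := α * ((n : ℝ) + 1) - 1)
      (by linarith [hn0 n]) one_pos hs0).const_mul (α * (Real.Gamma (α * ((n : ℝ) + 1)))⁻¹)
    refine h.congr (Filter.Eventually.of_forall fun x => ?_)
    simp only [hF, Real.rpow_one, neg_mul]
    ring
  set q := (s ^ α)⁻¹ with hq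
  have hq0 : 0 ≤ q := by positivity
  have hq1 : q < 1 := inv_lt_one_of_one_lt₀ (Real.one_lt_rpow hs hα0)
  have hval : ∀ n, ∫ x in Ioi 0, F n x = α * q * q ^ n := fun n => by
    have h := Real.integral_rpow_mul_exp_neg_mul_Ioi (hn0 n) hs0
    have hG := Real.Gamma_pos_of_pos (hn0 n)
    have e : ∀ x, F n x = (α * (Real.Gamma (α * ((n : ℝ) + 1)))⁻¹) *
      (x ^ (α * ((n : ℝ) + 1) - 1) * Real.exp (-(s * x))) := fun x => by simp only [hF]; ring
    simp_rw [e]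
    rw [integral_const_mul, h, one_div, Real.rpow_mul (by positivity), Real.inv_rpow hs0.le, ← hq,
      Real.rpow_add_one' hq0 (by positivity), Real.rpow_natCast]
    field_simp
  have hnorm : ∀ n, ∫ x in Ioi 0, ‖F n x‖ = α * q * q ^ n := fun n => by
    rw [← hval n]
    exact setIntegral_congr_fun measurableSet_Ioi fun x hx => Real.norm_of_nonneg (hnn n x hx)
  have hsum : HasSum (fun n => α * q * q ^ n) (α * q * (1 - q)⁻¹) :=
    (hasSum_geometric_of_lt_one hq0 hq1).mul_left _
  have hFs : ∀ x, ∑' n, F n x = Real.exp (-(s * x)) * resolventDensity α x := fun x => by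
    rw [resolventDensity, ← tsum_mul_left]
  have hfin : α * q * (1 - q)⁻¹ = α / (s ^ α - 1) := by
    have h1 : 1 < s ^ α := Real.one_lt_rpow hs hα0
    have h2 : s ^ α - 1 ≠ 0 := by linarith
    rw [hq]
    field_simp
  have h := hasSum_integral_of_summable_integral_norm hFint (by
    simp_rw [hnorm]
    exact hsum.summable)
  simp_rw [hFs, hval] at h
  have hval2 := h.unique hsum
  refine ⟨?_, hval2.trans hfin⟩
  by_contra hni
  rw [integral_undef hni] at hval2
  have : 0 < α * q * (1 - q)⁻¹ := by
    rw [hfin]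
    have h1 : 1 < s ^ α := Real.one_lt_rpow hs hα0
    exact div_pos hα0 (by linarith)
  linarith

/-- The Laplace transform of the spectral kernel on the right half-plane. -/
noncomputable def kernelLaplace (α : ℝ) (z : ℂ) : ℂ :=
  ∫ r in Ioi (0 : ℝ), (spectralKernel α r : ℂ) * Complex.exp (-(r * z))

section Kernel
variable {α : ℝ} (hα : α ∈ Ioo (1 : ℝ) 2)
include hα

lemma integrableOn_spectralKernel_mul_exp {z : ℂ} (hz : 0 ≤ z.re) :
    IntegrableOn (fun r : ℝ => (spectralKernel α r : ℂ) * Complex.exp (-(r * z))) (Ioi 0) := by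
  refine Integrable.mono' (integrableOn_spectralKernel hα) ?_ ?_
  · have := measurable_spectralKernel (α := α)
    fun_prop
  · filter_upwards [ae_restrict_mem measurableSet_Ioi] with r hr
    rw [norm_mul, Complex.norm_real, Real.norm_of_nonneg (spectralKernel_nonneg hα (le_of_lt hr)),
      Complex.norm_exp]
    refine mul_le_of_le_one_right (spectralKernel_nonneg hα (le_of_lt hr)) ?_
    rw [Real.exp_le_one_iff, Complex.neg_re, Complex.re_ofReal_mul]
    have : 0 ≤ r * z.re := mul_nonneg (le_of_lt hr) hz
    linarith

lemma differentiableAt_kernelLaplace {z : ℂ} (hz : 0 < z.re) :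
    DifferentiableAt ℂ (kernelLaplace α) z := by
  set ε := z.re / 2 with hε
  have hε0 : 0 < ε := by positivity
  have hmem : {y : ℂ | ε < y.re} ∈ nhds z :=
    (isOpen_lt continuous_const Complex.continuous_re).mem_nhds (by simp only [mem_ofPred_eq]; linarith)
  have hκ := measurable_spectralKernel (α := α)
  have h := hasDerivAt_integral_of_dominated_loc_of_deriv_le (𝕜 := ℂ)
    (μ := volume.restrict (Ioi (0 : ℝ)))
    (F := fun z r => (spectralKernel α r : ℂ) * Complex.exp (-(r * z)))
    (F' := fun z r => (spectralKernel α r : ℂ) * (Complex.exp (-(r * z)) * -r))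
    (bound := fun r => spectralKernel α r * ε⁻¹) hmem
    (Filter.Eventually.of_forall fun z => by fun_prop)
    (integrableOn_spectralKernel_mul_exp hα hz.le) (by fun_prop) ?_
    ((integrableOn_spectralKernel hα).mul_const _) ?_
  · exact h.2.differentiableAt
  · filter_upwards [ae_restrict_mem measurableSet_Ioi] with r hr y hy
    have hr0 : (0 : ℝ) < r := hr
    rw [norm_mul, Complex.norm_real, Real.norm_of_nonneg (spectralKernel_nonneg hα (le_of_lt hr)),
      norm_mul, Complex.norm_exp, norm_neg, Complex.norm_real, Real.norm_of_nonneg hr0.le]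
    refine mul_le_mul_of_nonneg_left ?_ (spectralKernel_nonneg hα (le_of_lt hr))
    rw [Complex.neg_re, Complex.re_ofReal_mul]
    have h1 : r * ε ≤ r * y.re := mul_le_mul_of_nonneg_left (le_of_lt hy) hr0.le
    have h2 := Real.add_one_le_exp (r * y.re)
    rw [Real.exp_neg, ← div_eq_inv_mul, div_le_iff₀ (Real.exp_pos _), ← div_eq_inv_mul,
      le_div_iff₀ hε0]
    linarith
  · refine Filter.Eventually.of_forall fun r y _ => ?_
    have := (((hasDerivAt_id y).const_mul (r : ℂ)).neg.cexp).const_mul (spectralKernel α r : ℂ)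
    simpa using this

omit hα in
lemma kernelLaplace_ofReal (x : ℝ) :
    kernelLaplace α x = ((∫ r in Ioi 0, spectralKernel α r * Real.exp (-(r * x)) : ℝ) : ℂ) := by
  rw [kernelLaplace, ← integral_complex_ofReal]
  push_cast
  rfl

lemma integrable_prod_spectralKernel {s : ℝ} (hs : 0 < s) :
    Integrable (Function.uncurry fun x r : ℝ =>
        Real.exp (-(s * x)) * (spectralKernel α r * Real.exp (-(r * x))))
      ((volume.restrict (Ioi (0 : ℝ))).prod (volume.restrict (Ioi (0 : ℝ)))) := by
  have hκ := measurable_spectralKernel (α := α)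
  have h1 : Integrable (fun x => Real.exp (-(s * x))) (volume.restrict (Ioi (0 : ℝ))) := by
    have h2 := integrableOn_exp_mul_Ioi (neg_lt_zero.mpr hs) 0
    simp only [neg_mul] at h2
    exact h2
  refine (h1.mul_prod (integrableOn_spectralKernel hα)).mono' (by
    unfold Function.uncurry
    fun_prop) ?_
  rw [Measure.prod_restrict]
  filter_upwards [ae_restrict_mem (measurableSet_Ioi.prod measurableSet_Ioi)] with p hp
  obtain ⟨hp1, hp2⟩ := hp
  have hp1' : (0 : ℝ) < p.1 := hp1
  have hp2' : (0 : ℝ) < p.2 := hp2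
  have hk := spectralKernel_nonneg hα hp2'.le
  simp only [Function.uncurry]
  rw [Real.norm_of_nonneg (by positivity)]
  refine mul_le_mul_of_nonneg_left (mul_le_of_le_one_right hk ?_) (Real.exp_pos _).le
  rw [Real.exp_le_one_iff]
  nlinarith

lemma integral_laplace_kernelLaplace {s : ℝ} (hs : 1 < s) :
    IntegrableOn (fun x => Real.exp (-(s * x)) *
        ∫ r in Ioi 0, spectralKernel α r * Real.exp (-(r * x))) (Ioi 0) ∧
      ∫ x in Ioi 0, Real.exp (-(s * x)) *
        ∫ r in Ioi 0, spectralKernel α r * Real.exp (-(r * x))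
        = 1 / (s - 1) - α / (s ^ α - 1) := by
  have h := integrable_prod_spectralKernel hα (one_pos.trans hs)
  have hl := h.integral_prod_left
  simp only [Function.uncurry, integral_const_mul] at hl
  refine ⟨hl, ?_⟩
  have hsw := integral_integral_swap h
  simp only [integral_const_mul] at hsw
  rw [hsw, ← integral_spectralKernel_div hα hs]
  refine setIntegral_congr_fun measurableSet_Ioi fun r hr => ?_
  have hr0 : (0 : ℝ) < r := hr
  have e : ∀ x, Real.exp (-(s * x)) * (spectralKernel α r * Real.exp (-(r * x)))
      = spectralKernel α r * Real.exp (-(s + r) * x) := fun x => by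
    rw [mul_left_comm, ← Real.exp_add]
    ring_nf
  simp only [e]
  rw [integral_const_mul, integral_exp_mul_Ioi (by linarith), mul_zero, Real.exp_zero,
    neg_div_neg_eq, mul_one_div]

lemma logResolvent_eq_kernelLaplace_ofReal (t : ℝ) :
    logResolvent α t = kernelLaplace α (Complex.exp t) := by
  set R : ℝ → ℝ := fun x => ∫ r in Ioi 0, spectralKernel α r * Real.exp (-(r * x)) with hR
  have hRre : ∀ x, R x = (kernelLaplace α (x : ℂ)).re := fun x => by
    rw [kernelLaplace_ofReal, Complex.ofReal_re]
  have hRc : ContinuousOn R (Ioi 0) := by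
    intro x hx
    have h1 : ContinuousAt (kernelLaplace α) (x : ℂ) :=
      (differentiableAt_kernelLaplace hα (by simpa using hx)).continuousAt
    have h2 : ContinuousAt (fun y : ℝ => (kernelLaplace α (y : ℂ)).re) x :=
      Complex.continuous_re.continuousAt.comp
        (ContinuousAt.comp (f := fun y : ℝ => (y : ℂ)) h1 Complex.continuous_ofReal.continuousAt)
    exact (h2.congr (Filter.Eventually.of_forall fun y => (hRre y).symm)).continuousWithinAt
  have hEre : ∀ x ∈ Ioi (0 : ℝ), Real.exp x - resolventDensity α x
      = (logResolvent α (Real.log x : ℝ)).re := fun x hx => by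
    rw [logResolvent_ofReal, Complex.ofReal_re, Real.exp_log hx]
  have hEc : ContinuousOn (fun x => Real.exp x - resolventDensity α x) (Ioi 0) := by
    refine ContinuousOn.congr ?_ hEre
    have h1 := (differentiable_logResolvent hα.1).continuous
    exact (Complex.continuous_re.comp (h1.comp Complex.continuous_ofReal)).comp_continuousOn
      (Real.continuousOn_log.mono fun x hx => (ne_of_gt hx))
  have hl : ∀ s : ℝ, 1 < s →
      IntegrableOn (fun x => Real.exp (-(s * x)) * (Real.exp x - resolventDensity α x - R x))
        (Ioi 0) ∧
      ∫ x in Ioi 0, Real.exp (-(s * x)) * (Real.exp x - resolventDensity α x - R x) = 0 := by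
    intro s hs
    obtain ⟨i1, e1⟩ := integral_laplace_resolventDensity hα.1 hs
    obtain ⟨i2, e2⟩ := integral_laplace_kernelLaplace hα hs
    have i3 := integrableOn_exp_mul_Ioi (by linarith : -(s - 1) < 0) 0
    have e3 := integral_exp_mul_Ioi (by linarith : -(s - 1) < 0) 0
    have e : ∀ x, Real.exp (-(s * x)) * (Real.exp x - resolventDensity α x - R x)
        = Real.exp (-(s - 1) * x) - Real.exp (-(s * x)) * resolventDensity α x
          - Real.exp (-(s * x)) * R x := fun x => by
      rw [show -(s - 1) * x = -(s * x) + x by ring, Real.exp_add]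
      ring
    simp only [e]
    have i31 : IntegrableOn (fun x => Real.exp (-(s - 1) * x) -
      Real.exp (-(s * x)) * resolventDensity α x) (Ioi 0) := i3.sub i1
    change IntegrableOn (fun x => Real.exp (-(s * x)) * R x) (Ioi 0) at i2
    change ∫ x in Ioi 0, Real.exp (-(s * x)) * R x = _ at e2
    refine ⟨i31.sub i2, ?_⟩
    rw [integral_sub i31 i2, integral_sub i3 i1, e1, e2, e3, mul_zero, Real.exp_zero,
      neg_div_neg_eq]
    ring
  have hz := eq_zero_of_laplace_eq_zero
    (g := fun x => Real.exp (-(2 * x)) * (Real.exp x - resolventDensity α x - R x))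
    ((by fun_prop : Continuous fun x : ℝ => Real.exp (-(2 * x))).continuousOn.mul (hEc.sub hRc))
    (hl 2 (by norm_num)).1
    (fun k => by
      have e : ∀ x, Real.exp (-x) ^ k *
          (Real.exp (-(2 * x)) * (Real.exp x - resolventDensity α x - R x))
          = Real.exp (-((k + 2) * x)) * (Real.exp x - resolventDensity α x - R x) := fun x => by
        rw [← mul_assoc, ← Real.exp_nat_mul, ← Real.exp_add]
        ring_nf
      simp only [e]
      exact (hl (k + 2) (by
        have : (0 : ℝ) ≤ k := by positivity
        linarith)).2)
    (Real.exp t) (Real.exp_pos t)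
  have h0 := (mul_eq_zero.mp hz).resolve_left (Real.exp_pos _).ne'
  rw [logResolvent_ofReal, ← Complex.ofReal_exp, kernelLaplace_ofReal, Complex.ofReal_inj]
  simp only [hR] at h0
  linarith

lemma logResolvent_eq_kernelLaplace {w : ℂ} (hw : |w.im| < π / 2) :
    logResolvent α w = kernelLaplace α (Complex.exp w) := by
  set U : Set ℂ := {w | |w.im| < π / 2} with hU
  have hUo : IsOpen U := isOpen_lt (by fun_prop) continuous_const
  have hUc : IsPreconnected U := by
    have : U = Complex.im ⁻¹' (Ioo (-(π / 2)) (π / 2)) := by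
      ext w
      simp [hU, abs_lt]
    rw [this]
    exact ((convex_Ioo _ _).is_linear_preimage Complex.imLm.isLinear).isPreconnected
  have hre : ∀ w ∈ U, 0 < (Complex.exp w).re := by
    intro w hw
    rw [Complex.exp_re]
    exact mul_pos (Real.exp_pos _) (Real.cos_pos_of_mem_Ioo (abs_lt.mp hw))
  have h1 : AnalyticOnNhd ℂ (logResolvent α) U :=
    (differentiable_logResolvent hα.1).differentiableOn.analyticOnNhd hUo
  have h2 : AnalyticOnNhd ℂ (fun w => kernelLaplace α (Complex.exp w)) U :=
    DifferentiableOn.analyticOnNhd (fun w hw => (DifferentiableAt.comp w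
      (differentiableAt_kernelLaplace hα (hre w hw))
        (Complex.differentiable_exp w)).differentiableWithinAt) hUo
  refine AnalyticOnNhd.eqOn_of_preconnected_of_frequently_eq h1 h2 hUc (z₀ := 0)
    (by simp [hU, Real.pi_pos]) ?_ hw
  have ht : Filter.Tendsto (fun n : ℕ => (((1 / ((n : ℝ) + 1) : ℝ)) : ℂ)) Filter.atTop
      (nhdsWithin 0 {0}ᶜ) := by
    refine tendsto_nhdsWithin_iff.mpr ⟨?_, Filter.Eventually.of_forall fun n => ?_⟩
    · have := (Complex.continuous_ofReal.tendsto 0).comp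
        (tendsto_one_div_add_atTop_nhds_zero_nat (𝕜 := ℝ))
      simpa [Function.comp_def] using this
    · have : (1 / ((n : ℝ) + 1)) ≠ 0 := by positivity
      exact Complex.ofReal_ne_zero.mpr this
  exact ht.frequently (Filter.Frequently.of_forall fun n =>
    logResolvent_eq_kernelLaplace_ofReal hα _)

end Kernel

section Kernel
variable {α : ℝ} (hα : α ∈ Ioo (1 : ℝ) 2)
include hα

lemma exists_norm_kernelLaplace_le : ∃ K : ℝ, 0 < K ∧ ∀ z : ℂ, 0 < z.re →
    ‖kernelLaplace α z‖ ≤ K ∧ ‖kernelLaplace α z‖ ≤ K * z.re ^ (-(α + 1)) := by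
  obtain ⟨C, hC, h1, -⟩ := exists_spectralKernel_le hα
  have hα0 : 0 < α + 1 := by linarith [hα.1]
  have hG := Real.Gamma_pos_of_pos hα0
  have hI : 0 ≤ ∫ r in Ioi 0, spectralKernel α r :=
    setIntegral_nonneg measurableSet_Ioi fun r hr => spectralKernel_nonneg hα (le_of_lt hr)
  have hnorm : ∀ z : ℂ, ∀ r ∈ Ioi (0 : ℝ),
      ‖(spectralKernel α r : ℂ) * Complex.exp (-(r * z))‖
        = spectralKernel α r * Real.exp (-(z.re * r)) := fun z r hr => by
    rw [norm_mul, Complex.norm_real, Real.norm_of_nonneg (spectralKernel_nonneg hα (le_of_lt hr)),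
      Complex.norm_exp, Complex.neg_re, Complex.re_ofReal_mul, mul_comm r]
  refine ⟨C * Real.Gamma (α + 1) + ∫ r in Ioi 0, spectralKernel α r, by positivity, fun z hz => ?_⟩
  constructor
  · refine (norm_integral_le_of_norm_le (integrableOn_spectralKernel hα) ?_).trans
      (le_add_of_nonneg_left (by positivity))
    filter_upwards [ae_restrict_mem measurableSet_Ioi] with r hr
    rw [hnorm z r hr]
    refine mul_le_of_le_one_right (spectralKernel_nonneg hα (le_of_lt hr)) ?_
    rw [Real.exp_le_one_iff]
    have : 0 ≤ z.re * r := mul_nonneg hz.le (le_of_lt hr)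
    linarith
  · have hi : IntegrableOn (fun r => C * (r ^ (α + 1 - 1) * Real.exp (-(z.re * r)))) (Ioi 0) := by
      have := (integrableOn_rpow_mul_exp_neg_mul_rpow (s := α + 1 - 1)
        (by linarith [hα.1]) one_pos hz).const_mul C
      simp only [Real.rpow_one, neg_mul] at this
      exact this
    refine (norm_integral_le_of_norm_le hi ?_).trans ?_
    · filter_upwards [ae_restrict_mem measurableSet_Ioi] with r hr
      rw [hnorm z r hr, add_sub_cancel_right, ← mul_assoc]
      exact mul_le_mul_of_nonneg_right (h1 r (le_of_lt hr)) (Real.exp_pos _).le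
    · rw [integral_const_mul, Real.integral_rpow_mul_exp_neg_mul_Ioi hα0 hz, one_div,
        Real.inv_rpow hz.le, ← Real.rpow_neg hz.le, add_mul, mul_comm _ (Real.Gamma _), ← mul_assoc]
      exact le_add_of_nonneg_right (mul_nonneg hI (Real.rpow_nonneg hz.le _))

lemma exists_norm_logResolvent_le {ψ : ℝ} (hψ : ψ < α * (π / 2)) : ∃ K : ℝ, 0 < K ∧
    ∀ w : ℂ, 0 ≤ w.im → w.im ≤ ψ → ‖logResolvent α ((1 / α : ℝ) * w)‖ ≤ K ∧
      ‖logResolvent α ((1 / α : ℝ) * w)‖ ≤ K * Real.exp (-((1 + 1 / α) * w.re)) := by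
  obtain ⟨K, hK, h⟩ := exists_norm_kernelLaplace_le hα
  have hα0 : 0 < α := by linarith [hα.1]
  rcases lt_or_ge ψ 0 with hψ0 | hψ0
  · exact ⟨1, one_pos, fun w h0 h1 => by linarith⟩
  have hψ2 : 1 / α * ψ < π / 2 := by
    rw [div_mul_eq_mul_div, one_mul, div_lt_iff₀ hα0]
    linarith
  have hc : 0 < Real.cos (1 / α * ψ) :=
    Real.cos_pos_of_mem_Ioo ⟨by have : 0 ≤ 1 / α * ψ := by positivity
                                linarith [Real.pi_pos], hψ2⟩
  set c := Real.cos (1 / α * ψ) with hcdef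
  have hcp := Real.rpow_pos_of_pos hc (-(α + 1))
  refine ⟨K + K * c ^ (-(α + 1)), by positivity, fun w h0 h1 => ?_⟩
  have him : ((1 / α : ℝ) * w).im = 1 / α * w.im := Complex.im_ofReal_mul _ _
  have hre : ((1 / α : ℝ) * w).re = 1 / α * w.re := Complex.re_ofReal_mul _ _
  have h2 : 0 ≤ 1 / α * w.im := by positivity
  have h3 : 1 / α * w.im ≤ 1 / α * ψ := by gcongr
  have hz : Real.exp (1 / α * w.re) * c ≤ (Complex.exp ((1 / α : ℝ) * w)).re := by
    rw [Complex.exp_re, him, hre]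
    refine mul_le_mul_of_nonneg_left ?_ (Real.exp_pos _).le
    exact Real.cos_le_cos_of_nonneg_of_le_pi h2 (by linarith [Real.pi_pos]) h3
  have hz0 : 0 < Real.exp (1 / α * w.re) * c := by positivity
  rw [logResolvent_eq_kernelLaplace hα (by rw [him, abs_of_nonneg h2]; linarith)]
  obtain ⟨b1, b2⟩ := h _ (hz0.trans_le hz)
  have hE := Real.exp_pos (-((1 + 1 / α) * w.re))
  refine ⟨b1.trans (le_add_of_nonneg_right (by positivity)), b2.trans ?_⟩
  have h4 : (Complex.exp ((1 / α : ℝ) * w)).re ^ (-(α + 1))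
      ≤ c ^ (-(α + 1)) * Real.exp (-((1 + 1 / α) * w.re)) := by
    refine (Real.rpow_le_rpow_of_nonpos hz0 hz (by linarith)).trans_eq ?_
    rw [Real.mul_rpow (Real.exp_pos _).le hc.le, ← Real.exp_mul, mul_comm]
    congr 2
    field_simp
  nlinarith [mul_le_mul_of_nonneg_left h4 hK.le, mul_pos hK hE]

end Kernel

lemma integrable_exp_mul_exp_neg_exp {b r : ℝ} (hb : 0 < b) (hr : 0 < r) :
    Integrable (fun t => Real.exp (b * t) * Real.exp (-(r * Real.exp t))) ∧
      ∫ t, Real.exp (b * t) * Real.exp (-(r * Real.exp t)) = (1 / r) ^ b * Real.Gamma b := by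
  have e : ∀ t, Real.exp t • ((Real.exp t) ^ (b - 1) * Real.exp (-(r * Real.exp t)))
      = Real.exp (b * t) * Real.exp (-(r * Real.exp t)) := fun t => by
    rw [smul_eq_mul, ← mul_assoc, ← Real.exp_mul, ← Real.exp_add]
    ring_nf
  have h1 : IntegrableOn (fun x => x ^ (b - 1) * Real.exp (-(r * x))) (Ioi 0) := by
    have := integrableOn_rpow_mul_exp_neg_mul_rpow (s := b - 1) (by linarith) one_pos hr
    simpa only [Real.rpow_one, neg_mul] using this
  have h2 := Real.integral_rpow_mul_exp_neg_mul_Ioi hb hr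
  rw [integrableOn_Ioi_zero_iff_integrable_exp] at h1
  rw [integral_Ioi_zero_eq_integral_exp] at h2
  simp only [e] at h1 h2
  exact ⟨h1, h2⟩

lemma exists_exp_mul_exp_neg_exp_le {b r : ℝ} (hb : 0 < b) (hr : 0 < r) : ∃ C : ℝ, ∀ u : ℝ,
    1 ≤ |u| → Real.exp (b * u) * Real.exp (-(r * Real.exp u)) ≤ C / u ^ 2 := by
  obtain ⟨N, hN⟩ := exists_nat_ge (b + 1)
  have hrN : 0 < r ^ N := by positivity
  have hNf : (0 : ℝ) < N.factorial := by exact_mod_cast N.factorial_pos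
  refine ⟨2 / b ^ 2 + N.factorial / r ^ N * (2 / 1 ^ 2), fun u hu => ?_⟩
  have hu0 : u ≠ 0 := by
    rintro rfl
    norm_num at hu
  have hsq : 0 < u ^ 2 := by positivity
  rw [add_div]
  rcases le_total 0 u with h | h
  · have h1 := exp_neg_mul_abs_le one_pos hu0
    rw [abs_of_nonneg h, one_mul] at h1
    have h2 := Real.pow_div_factorial_le_exp (r * Real.exp u) (by positivity) N
    have h3 : Real.exp (b * u) * Real.exp (-(r * Real.exp u))
        ≤ N.factorial / r ^ N * Real.exp (-u) := by
      rw [Real.exp_neg, ← div_eq_mul_inv, div_le_iff₀ (Real.exp_pos _)]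
      calc Real.exp (b * u) ≤ Real.exp (-u + N * u) := Real.exp_le_exp.mpr (by nlinarith)
        _ = N.factorial / r ^ N * Real.exp (-u) * ((r * Real.exp u) ^ N / N.factorial) := by
          rw [mul_pow, ← Real.exp_nat_mul, Real.exp_add]
          field_simp
        _ ≤ _ := by gcongr
    refine h3.trans (le_add_of_nonneg_of_le (by positivity) ?_)
    rw [mul_div_assoc]
    gcongr
  · have h1 := exp_neg_mul_abs_le hb hu0
    rw [abs_of_nonpos h, mul_neg, neg_neg] at h1
    refine le_add_of_le_of_nonneg ?_ (by positivity)
    refine (mul_le_of_le_one_right (Real.exp_pos _).le ?_).trans h1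
    rw [Real.exp_le_one_iff]
    have : 0 < r * Real.exp u := by positivity
    linarith

lemma norm_exp_mul_exp_line (x b : ℝ) (w : ℂ) :
    ‖Complex.exp (x * Complex.exp w) * Complex.exp (b * w)‖
      = Real.exp (b * w.re) * Real.exp (-(-(x * Real.cos w.im) * Real.exp w.re)) := by
  rw [norm_mul, Complex.norm_exp, Complex.norm_exp, Complex.re_ofReal_mul, Complex.re_ofReal_mul,
    Complex.exp_re, mul_comm]
  ring_nf

section Line
variable {ψ x b : ℝ} (hψ : ψ ∈ Ioo (π / 2) π) (hx : 0 < x) (hb : 0 < b)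
include hψ hx

omit hx in
lemma cos_neg_of_mem_Ioo : Real.cos ψ < 0 :=
  Real.cos_neg_of_pi_div_two_lt_of_lt hψ.1 (by linarith [hψ.2, Real.pi_pos])

include hb

lemma integrable_line_and_integral_norm :
    Integrable (fun t : ℝ => Complex.exp (x * Complex.exp (t + ψ * Complex.I)) *
        Complex.exp (b * (t + ψ * Complex.I))) ∧
      ∫ t : ℝ, ‖Complex.exp (x * Complex.exp (t + ψ * Complex.I)) *
        Complex.exp (b * (t + ψ * Complex.I))‖ = (1 / -(x * Real.cos ψ)) ^ b * Real.Gamma b := by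
  have hr : 0 < -(x * Real.cos ψ) := by nlinarith [cos_neg_of_mem_Ioo hψ]
  obtain ⟨h1, h2⟩ := integrable_exp_mul_exp_neg_exp hb hr
  have e : ∀ t : ℝ, ‖Complex.exp (x * Complex.exp (t + ψ * Complex.I)) *
      Complex.exp (b * (t + ψ * Complex.I))‖
        = Real.exp (b * t) * Real.exp (-(-(x * Real.cos ψ) * Real.exp t)) := fun t => by
    rw [norm_exp_mul_exp_line]
    simp
  simp only [e]
  refine ⟨h1.mono' (by fun_prop) (Filter.Eventually.of_forall fun t => (e t).le), h2⟩

/-- Hankel's representation of the reciprocal Gamma function. -/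
lemma im_integral_line : (∫ t : ℝ, Complex.exp (x * Complex.exp (t + ψ * Complex.I)) *
      Complex.exp (b * (t + ψ * Complex.I))).im = π * (x ^ (-b) / Real.Gamma (1 - b)) := by
  have hr : 0 < -(x * Real.cos ψ) := by nlinarith [cos_neg_of_mem_Ioo hψ]
  obtain ⟨C, hC⟩ := exists_exp_mul_exp_neg_exp_le hb hr
  have hπ := Real.pi_pos
  set f : ℂ → ℂ := fun w => Complex.exp (x * Complex.exp (w + ψ * Complex.I)) *
    Complex.exp (b * (w + ψ * Complex.I)) with hf
  have hfd : Differentiable ℂ f := by fun_prop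
  have h := integral_line_shift (f := f) (ψ := π - ψ) (C := C) (T := 1) (by linarith [hψ.2])
    Set.countable_empty hfd.continuous.continuousOn (fun w _ _ _ => hfd w)
    (fun w h0 h1 hT => by
      refine le_trans ?_ (hC w.re hT)
      simp only [hf]
      rw [norm_exp_mul_exp_line]
      simp only [Complex.add_re, Complex.add_im, Complex.mul_re, Complex.mul_im, Complex.ofReal_re,
        Complex.ofReal_im, Complex.I_re, Complex.I_im, mul_zero, mul_one, sub_zero, add_zero]
      have hcos : Real.cos (w.im + ψ) ≤ Real.cos ψ :=
        Real.cos_le_cos_of_nonneg_of_le_pi (by linarith [hψ.1]) (by linarith) (by linarith)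
      gcongr)
  have e : ∀ t : ℝ, f (t + (π - ψ : ℝ) * Complex.I) = Complex.exp ((b * π : ℝ) * Complex.I) *
      ((Real.exp (b * t) * Real.exp (-(x * Real.exp t)) : ℝ) : ℂ) := fun t => by
    simp only [hf]
    have h1 : (t + (π - ψ : ℝ) * Complex.I + ψ * Complex.I : ℂ) = t + π * Complex.I := by
      push_cast; ring
    rw [h1, Complex.exp_add (t : ℂ), Complex.exp_pi_mul_I, mul_add, Complex.exp_add]
    push_cast
    ring_nf
  rw [← h]
  simp only [e]
  rw [integral_const_mul, integral_complex_ofReal, (integrable_exp_mul_exp_neg_exp hb hx).2,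
    Complex.im_mul_ofReal, Complex.exp_ofReal_mul_I_im, one_div, Real.inv_rpow hx.le,
    Real.rpow_neg hx.le, div_eq_mul_inv, show 1 - b = -(b - 1) by ring, inv_Gamma_neg (by linarith), sub_add_cancel, mul_sub, mul_one,
    Real.sin_sub_pi, mul_comm b π]
  field_simp

end Line

section Series
variable {α x : ℝ} (hα : α ∈ Ioo (1 : ℝ) 2) (hx : 0 < x)
include hα

lemma one_div_mem_Ioo : 1 / α ∈ Ioo (0 : ℝ) 1 := by
  have h0 : 0 < α := by linarith [hα.1]
  exact ⟨by positivity, by rw [div_lt_one h0]; exact hα.1⟩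

include hx

lemma summable_first_series : Summable (fun n : ℕ =>
    |(-α) * x ^ (1 / α - ((n : ℝ) + 1) - 1) /
      (Real.Gamma (α * ((n : ℝ) + 1)) * Real.Gamma (1 / α - ((n : ℝ) + 1)))|) := by
  have h0 : 0 < α := by linarith [hα.1]
  have hρ := one_div_mem_Ioo hα
  refine Summable.of_nonneg_of_le (fun n => abs_nonneg _) (fun n => ?_)
    ((summable_Gamma_div_Gamma_mul_pow hα.1 (inv_pos.mpr hx).le).mul_left (α * x ^ (1 / α - 2)))
  have hn : (0 : ℝ) ≤ n := n.cast_nonneg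
  have hG := Real.Gamma_pos_of_pos (by positivity : 0 < α * ((n : ℝ) + 1))
  have hb := abs_inv_Gamma_neg_le (a := (n : ℝ) + 1 - 1 / α) (by linarith [hρ.2])
  rw [neg_sub] at hb
  have e : x ^ (1 / α - ((n : ℝ) + 1) - 1) = x ^ (1 / α - 2) * x⁻¹ ^ n := by
    rw [inv_pow, ← Real.rpow_natCast, ← Real.rpow_neg hx.le, ← Real.rpow_add hx]
    ring_nf
  rw [div_eq_mul_inv, mul_inv, abs_mul, abs_mul, abs_neg, abs_mul, abs_of_pos h0,
    abs_of_pos (Real.rpow_pos_of_pos hx _), abs_of_pos (inv_pos.mpr hG), e]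
  calc _ ≤ α * (x ^ (1 / α - 2) * x⁻¹ ^ n) * ((Real.Gamma (α * ((n : ℝ) + 1)))⁻¹ *
        Real.Gamma ((n : ℝ) + 1 - 1 / α + 1)) := by gcongr
    _ = _ := by ring

lemma summable_second_series : Summable (fun n : ℕ =>
    |x ^ (-((n : ℝ) + 1) / α - 1) /
      (Real.Gamma (-((n : ℝ) + 1) / α) * (Nat.factorial (n + 1) : ℝ))|) := by
  have h0 : 0 < α := by linarith [hα.1]
  have hρ := one_div_mem_Ioo hα
  have hs := (summable_nat_add_iff 1).mpr
    (summable_Gamma_div_factorial_mul_pow hρ (Real.rpow_nonneg hx.le (-(1 / α))))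
  refine Summable.of_nonneg_of_le (fun n => abs_nonneg _) (fun n => ?_) (hs.mul_left x⁻¹)
  have hn : (0 : ℝ) ≤ n := n.cast_nonneg
  have hf : (0 : ℝ) < (n + 1).factorial := by exact_mod_cast (n + 1).factorial_pos
  have hpos : 0 ≤ 1 / α * ((n + 1 : ℕ) : ℝ) := by positivity
  have hb := abs_inv_Gamma_neg_le (a := 1 / α * ((n + 1 : ℕ) : ℝ)) (by linarith)
  have e : x ^ (-((n : ℝ) + 1) / α - 1) = x⁻¹ * (x ^ (-(1 / α))) ^ (n + 1) := by
    rw [← Real.rpow_natCast, ← Real.rpow_mul hx.le, ← Real.rpow_neg_one, ← Real.rpow_add hx]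
    push_cast
    ring_nf
  have e2 : -((n : ℝ) + 1) / α = -(1 / α * ((n + 1 : ℕ) : ℝ)) := by push_cast; ring
  rw [div_eq_mul_inv, mul_inv, abs_mul, abs_mul, abs_of_pos (Real.rpow_pos_of_pos hx _),
    abs_of_pos (inv_pos.mpr hf), e, e2]
  calc _ ≤ x⁻¹ * (x ^ (-(1 / α))) ^ (n + 1) * (Real.Gamma (1 / α * ((n + 1 : ℕ) : ℝ) + 1) *
        (((n + 1).factorial : ℝ))⁻¹) := by gcongr
    _ = _ := by ring

/-- The two series of `hittingDensity`, indexed so that they can be added termwise. -/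
lemma hasSum_hittingDensity : HasSum (fun n : ℕ =>
    x ^ (-(1 / α * n + 1)) / (Real.Gamma (1 - (1 / α * n + 1)) * (n.factorial : ℝ)) -
    α * x ^ (-((n : ℝ) + 2 - 1 / α)) /
      (Real.Gamma (α * ((n : ℝ) + 1)) * Real.Gamma (1 - ((n : ℝ) + 2 - 1 / α))))
    (hittingDensity α x) := by
  have h1 := (summable_first_series hα hx).of_abs.hasSum
  have h2 := (summable_second_series hα hx).of_abs.hasSum
  have h3 : HasSum (fun n : ℕ =>
      x ^ (-(1 / α * n + 1)) / (Real.Gamma (1 - (1 / α * n + 1)) * (n.factorial : ℝ)))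
      (∑' n : ℕ, x ^ (-((n : ℝ) + 1) / α - 1) /
        (Real.Gamma (-((n : ℝ) + 1) / α) * (Nat.factorial (n + 1) : ℝ))) := by
    rw [← hasSum_nat_add_iff' 1]
    simp only [Finset.range_one, Finset.sum_singleton, Nat.cast_zero, mul_zero, zero_add, sub_self,
      Real.Gamma_zero, zero_mul, div_zero, sub_zero]
    convert h2 using 1
    ext n
    push_cast
    congr 2
    · ring
    · congr 1
      ring
  rw [hittingDensity, add_comm]
  have h4 := h3.add h1
  convert h4 using 1
  ext n
  rw [sub_eq_add_neg, ← neg_div, neg_mul]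
  congr 4
  · ring_nf
  · ring_nf

end Series

section Contour
variable {α x ψ : ℝ} (hα : α ∈ Ioo (1 : ℝ) 2) (hψ : ψ ∈ Ioo (π / 2) π) (hx : 0 < x)
include hα

lemma hasSum_exp_mul_logResolvent (x : ℝ) (w : ℂ) : HasSum (fun n : ℕ =>
    Complex.exp (x * Complex.exp w) * Complex.exp ((1 / α * n + 1 : ℝ) * w) *
        (((n.factorial : ℝ)⁻¹ : ℝ) : ℂ) -
      Complex.exp (x * Complex.exp w) * Complex.exp (((n : ℝ) + 2 - 1 / α : ℝ) * w) *
        ((α * (Real.Gamma (α * ((n : ℝ) + 1)))⁻¹ : ℝ) : ℂ))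
    (Complex.exp (x * Complex.exp w) *
      (logResolvent α ((1 / α : ℝ) * w) * Complex.exp w)) := by
  have h0 : (α : ℂ) ≠ 0 := by
    have : α ≠ 0 := by linarith [hα.1]
    exact_mod_cast this
  have h1 : HasSum (fun n : ℕ => (Complex.exp ((1 / α : ℝ) * w)) ^ n / (n.factorial : ℂ))
      (Complex.exp (Complex.exp ((1 / α : ℝ) * w))) := by
    rw [Complex.exp_eq_exp_ℂ]
    exact NormedSpace.expSeries_div_hasSum_exp _
  have h2 : HasSum (fun n : ℕ => (((Real.Gamma (α * ((n : ℝ) + 1)))⁻¹ : ℝ) : ℂ) *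
      (Complex.exp (α * ((1 / α : ℝ) * w))) ^ n)
      (mittagLeffler α (Complex.exp (α * ((1 / α : ℝ) * w)))) := by
    refine Summable.hasSum (Summable.of_norm ?_)
    convert summable_inv_Gamma_mul_pow hα.1 (norm_nonneg (Complex.exp (α * ((1 / α : ℝ) * w)))) with n
    have hG := Real.Gamma_pos_of_pos (mul_pos (by linarith [hα.1] : 0 < α) n.cast_add_one_pos)
    rw [norm_mul, norm_pow, Complex.norm_real, Real.norm_of_nonneg (by positivity)]
  have h := (h1.sub (h2.mul_left (α * Complex.exp ((α - 1) * ((1 / α : ℝ) * w))))).mul_left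
    (Complex.exp (x * Complex.exp w) * Complex.exp w)
  have hv : Complex.exp (x * Complex.exp w) *
      (logResolvent α ((1 / α : ℝ) * w) * Complex.exp w) =
      Complex.exp (x * Complex.exp w) * Complex.exp w *
        (Complex.exp (Complex.exp ((1 / α : ℝ) * w)) -
          α * Complex.exp ((α - 1) * ((1 / α : ℝ) * w)) *
            mittagLeffler α (Complex.exp (α * ((1 / α : ℝ) * w)))) := by
    rw [logResolvent]
    ring
  rw [hv]
  refine Eq.mpr (congrArg (fun f => HasSum f _) (funext fun n => ?_)) h
  · have e1 : Complex.exp ((1 / α * n + 1 : ℝ) * w)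
        = Complex.exp w * Complex.exp ((1 / α : ℝ) * w) ^ n := by
      rw [← Complex.exp_nat_mul, ← Complex.exp_add]
      push_cast
      ring_nf
    have e2 : Complex.exp (((n : ℝ) + 2 - 1 / α : ℝ) * w) = Complex.exp w *
        (Complex.exp ((α - 1) * ((1 / α : ℝ) * w)) * Complex.exp (α * ((1 / α : ℝ) * w)) ^ n) := by
      rw [← Complex.exp_nat_mul, ← Complex.exp_add, ← Complex.exp_add]
      congr 1
      push_cast
      field_simp
      ring
    rw [e1, e2]
    push_cast
    ring

include hψ hx

/-- The contour representation of `hittingDensity`. -/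
lemma hittingDensity_eq_im_integral : hittingDensity α x = 1 / π *
    (∫ t : ℝ, Complex.exp (x * Complex.exp (t + ψ * Complex.I)) *
      (logResolvent α ((1 / α : ℝ) * (t + ψ * Complex.I)) *
        Complex.exp (t + ψ * Complex.I))).im := by
  have hα0 : 0 < α := by linarith [hα.1]
  have hπ := Real.pi_pos
  have hρ := one_div_mem_Ioo hα
  have hr : 0 < -(x * Real.cos ψ) := by nlinarith [cos_neg_of_mem_Ioo hψ]
  set y := 1 / -(x * Real.cos ψ) with hy
  have hy0 : 0 < y := by positivity
  set L : ℝ → ℝ → ℂ := fun b t => Complex.exp (x * Complex.exp (t + ψ * Complex.I)) *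
    Complex.exp (b * (t + ψ * Complex.I)) with hL
  have hLi : ∀ b, 0 < b → Integrable (L b) ∧ ∫ t, ‖L b t‖ = y ^ b * Real.Gamma b :=
    fun b hb => integrable_line_and_integral_norm hψ hx hb
  have hLim : ∀ b, 0 < b → (∫ t, L b t).im = π * (x ^ (-b) / Real.Gamma (1 - b)) :=
    fun b hb => im_integral_line hψ hx hb
  set c : ℕ → ℝ := fun n => ((n.factorial : ℝ))⁻¹ with hc
  set d : ℕ → ℝ := fun n => α * (Real.Gamma (α * ((n : ℝ) + 1)))⁻¹ with hd
  have hc0 : ∀ n, 0 ≤ c n := fun n => by positivity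
  have hd0 : ∀ n, 0 ≤ d n := fun n => by
    have := Real.Gamma_pos_of_pos (by positivity : 0 < α * ((n : ℝ) + 1))
    positivity
  have hb1 : ∀ n : ℕ, 0 < 1 / α * n + 1 := fun n => by positivity
  have hb2 : ∀ n : ℕ, 0 < (n : ℝ) + 2 - 1 / α := fun n => by
    have : (0 : ℝ) ≤ n := n.cast_nonneg
    linarith [hρ.2]
  set F : ℕ → ℝ → ℂ := fun n t =>
    L (1 / α * n + 1) t * (c n : ℂ) - L ((n : ℝ) + 2 - 1 / α) t * (d n : ℂ) with hF
  have hF1 : ∀ n : ℕ, Integrable (fun t => L (1 / α * n + 1) t * (c n : ℂ)) :=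
    fun n => (hLi _ (hb1 n)).1.mul_const _
  have hF2 : ∀ n : ℕ, Integrable (fun t => L ((n : ℝ) + 2 - 1 / α) t * (d n : ℂ)) :=
    fun n => (hLi _ (hb2 n)).1.mul_const _
  have hFi : ∀ n, Integrable (F n) := fun n => (hF1 n).sub (hF2 n)
  have hnorm : ∀ n, ∫ t, ‖F n t‖ ≤ y ^ (1 / α * n + 1) * Real.Gamma (1 / α * n + 1) * c n +
      y ^ ((n : ℝ) + 2 - 1 / α) * Real.Gamma ((n : ℝ) + 2 - 1 / α) * d n := fun n => by
    rw [← (hLi _ (hb1 n)).2, ← (hLi _ (hb2 n)).2, ← integral_mul_const, ← integral_mul_const,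
      ← integral_add ((hLi _ (hb1 n)).1.norm.mul_const _) ((hLi _ (hb2 n)).1.norm.mul_const _)]
    refine integral_mono (hFi n).norm (((hLi _ (hb1 n)).1.norm.mul_const _).add
      ((hLi _ (hb2 n)).1.norm.mul_const _)) fun t => ?_
    refine (norm_sub_le _ _).trans_eq ?_
    simp only [norm_mul, Complex.norm_real, Real.norm_of_nonneg (hc0 n),
      Real.norm_of_nonneg (hd0 n)]
  have hsum : Summable (fun n => ∫ t, ‖F n t‖) := by
    refine Summable.of_nonneg_of_le (fun n => integral_nonneg fun t => norm_nonneg _) hnorm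
      (Summable.add ?_ ?_)
    · refine ((summable_Gamma_div_factorial_mul_pow hρ
        (Real.rpow_nonneg hy0.le (1 / α))).mul_left y).congr fun n => ?_
      rw [Real.rpow_add hy0, Real.rpow_one, Real.rpow_mul hy0.le, Real.rpow_natCast]
      ring
    · refine ((summable_Gamma_div_Gamma_mul_pow hα.1 hy0.le).mul_left
        (α * y ^ (2 - 1 / α))).congr fun n => ?_
      have e : y ^ ((n : ℝ) + 2 - 1 / α) = y ^ n * y ^ (2 - 1 / α) := by
        rw [add_sub_assoc, Real.rpow_add hy0, Real.rpow_natCast]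
      rw [e, show (n : ℝ) + 1 - 1 / α + 1 = n + 2 - 1 / α by ring]
      simp only [hd]
      ring
  have h := hasSum_integral_of_summable_integral_norm hFi hsum
  have hpt : ∀ t : ℝ, ∑' n, F n t = Complex.exp (x * Complex.exp (t + ψ * Complex.I)) *
      (logResolvent α ((1 / α : ℝ) * (t + ψ * Complex.I)) *
        Complex.exp (t + ψ * Complex.I)) :=
    fun t => (hasSum_exp_mul_logResolvent hα x (t + ψ * Complex.I)).tsum_eq
  simp only [hpt] at h
  have him := (Complex.hasSum_im h).mul_left (1 / π)
  refine (hasSum_hittingDensity hα hx).unique ?_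
  refine Eq.mpr (congrArg (fun f => HasSum f _) (funext fun n => ?_)) him
  rw [hF, integral_sub (hF1 n) (hF2 n), integral_mul_const, integral_mul_const, Complex.sub_im,
    Complex.im_mul_ofReal, Complex.im_mul_ofReal, hLim _ (hb1 n), hLim _ (hb2 n)]
  simp only [hc, hd]
  field_simp

end Contour

lemma integrable_exp_neg_mul_abs {c : ℝ} (hc : 0 < c) :
    Integrable (fun t : ℝ => Real.exp (-(c * |t|))) := by
  refine (integrable_inv_one_add_sq.const_mul (1 + 2 / c ^ 2)).mono' (by fun_prop)
    (Filter.Eventually.of_forall fun t => ?_)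
  rw [Real.norm_of_nonneg (Real.exp_pos _).le, ← div_eq_mul_inv, le_div_iff₀ (by positivity)]
  have h1 : Real.exp (-(c * |t|)) ≤ 1 := Real.exp_le_one_iff.mpr (by
    have : 0 ≤ c * |t| := by positivity
    linarith)
  have h2 : Real.exp (-(c * |t|)) * t ^ 2 ≤ 2 / c ^ 2 := by
    rcases eq_or_ne t 0 with rfl | ht
    · simp only [ne_eq, OfNat.ofNat_ne_zero, not_false_eq_true, zero_pow, mul_zero]
      positivity
    · exact (le_div_iff₀ (by positivity)).mp (exp_neg_mul_abs_le hc ht)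
  linarith

lemma norm_exp_mul_exp_le_one {ψ x : ℝ} (hψ : ψ ∈ Ioo (π / 2) π) (hx : 0 ≤ x) (t : ℝ) :
    ‖Complex.exp (x * Complex.exp (t + ψ * Complex.I))‖ ≤ 1 := by
  rw [Complex.norm_exp, Real.exp_le_one_iff, Complex.re_ofReal_mul, Complex.exp_re]
  have := cos_neg_of_mem_Ioo hψ
  have h : Real.exp t * Real.cos ψ ≤ 0 := mul_nonpos_of_nonneg_of_nonpos (Real.exp_pos _).le this.le
  simpa using mul_nonpos_of_nonneg_of_nonpos hx h

section Laplace
variable {α : ℝ} (hα : α ∈ Ioo (1 : ℝ) 2)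
include hα

lemma exists_norm_logResolvent_mul_exp_le {ψ : ℝ} (hψ : ψ < α * (π / 2)) : ∃ K : ℝ, 0 < K ∧
    ∀ w : ℂ, 0 ≤ w.im → w.im ≤ ψ →
      ‖logResolvent α ((1 / α : ℝ) * w) * Complex.exp w‖
        ≤ K * Real.exp (-(1 / α * |w.re|)) := by
  obtain ⟨K, hK, h⟩ := exists_norm_logResolvent_le hα hψ
  have hρ := one_div_mem_Ioo hα
  refine ⟨K, hK, fun w h0 h1 => ?_⟩
  obtain ⟨h2, h3⟩ := h w h0 h1
  rw [norm_mul, Complex.norm_exp]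
  rcases le_total 0 w.re with hr | hr
  · refine (mul_le_mul_of_nonneg_right h3 (Real.exp_pos _).le).trans_eq ?_
    rw [mul_assoc, ← Real.exp_add, abs_of_nonneg hr]
    ring_nf
  · refine mul_le_mul h2 (Real.exp_le_exp.mpr ?_) (Real.exp_pos _).le hK.le
    rw [abs_of_nonpos hr]
    nlinarith [hρ.2]

lemma integrable_logResolvent_mul_exp {ψ : ℝ} (h0 : 0 ≤ ψ) (hψ : ψ < α * (π / 2)) :
    Integrable (fun t : ℝ => logResolvent α ((1 / α : ℝ) * (t + ψ * Complex.I)) *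
      Complex.exp (t + ψ * Complex.I)) := by
  obtain ⟨K, hK, h⟩ := exists_norm_logResolvent_mul_exp_le hα hψ
  have hc := (differentiable_logResolvent hα.1).continuous
  refine ((integrable_exp_neg_mul_abs (one_div_mem_Ioo hα).1).const_mul K).mono' (by fun_prop)
    (Filter.Eventually.of_forall fun t => ?_)
  simpa using h (t + ψ * Complex.I) (by simpa using h0) (by simp)

variable {ψ : ℝ} (hψ : ψ ∈ Ioo (π / 2) π) (hψα : ψ < α * (π / 2))
include hψ hψα

lemma continuousOn_hittingDensity : ContinuousOn (hittingDensity α) (Ioi 0) := by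
  have hψ0 : 0 ≤ ψ := by linarith [hψ.1, Real.pi_pos]
  have hi := integrable_logResolvent_mul_exp hα hψ0 hψα
  have hc := (differentiable_logResolvent hα.1).continuous
  refine ContinuousOn.congr ?_ fun x hx => hittingDensity_eq_im_integral hα hψ hx
  refine continuousOn_const.mul (Complex.continuous_im.comp_continuousOn ?_)
  refine continuousOn_of_dominated (fun x _ => by fun_prop) (fun x hx =>
    Filter.Eventually.of_forall fun t => ?_) hi.norm
    (Filter.Eventually.of_forall fun t => by fun_prop)
  rw [norm_mul]
  exact mul_le_of_le_one_left (norm_nonneg _) (norm_exp_mul_exp_le_one hψ (le_of_lt hx) t)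

lemma integrable_prod_contour {s : ℝ} (hs : 0 < s) :
    Integrable (Function.uncurry fun x t : ℝ =>
        Complex.exp (-(s * x)) * (Complex.exp (x * Complex.exp (t + ψ * Complex.I)) *
          (logResolvent α ((1 / α : ℝ) * (t + ψ * Complex.I)) *
            Complex.exp (t + ψ * Complex.I))))
      ((volume.restrict (Ioi (0 : ℝ))).prod volume) := by
  have hψ0 : 0 ≤ ψ := by linarith [hψ.1, Real.pi_pos]
  have hi := integrable_logResolvent_mul_exp hα hψ0 hψα
  have hc := (differentiable_logResolvent hα.1).continuous
  have h1 : Integrable (fun x => Real.exp (-(s * x))) (volume.restrict (Ioi (0 : ℝ))) := by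
    have h2 := integrableOn_exp_mul_Ioi (neg_lt_zero.mpr hs) 0
    simp only [neg_mul] at h2
    exact h2
  refine (h1.mul_prod hi.norm).mono' (by
    unfold Function.uncurry
    fun_prop) ?_
  have hr : (volume.restrict (Ioi (0 : ℝ))).prod (volume : Measure ℝ)
      = (volume.prod volume).restrict (Ioi 0 ×ˢ univ) := by
    rw [← Measure.prod_restrict, Measure.restrict_univ]
  rw [hr]
  filter_upwards [ae_restrict_mem (measurableSet_Ioi.prod MeasurableSet.univ)] with p hp
  simp only [Function.uncurry]
  rw [norm_mul, norm_mul, Complex.norm_exp]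
  have e : (-((s : ℂ) * p.1)).re = -(s * p.1) := by simp
  rw [e]
  refine mul_le_mul_of_nonneg_left ?_ (Real.exp_pos _).le
  exact mul_le_of_le_one_left (norm_nonneg _) (norm_exp_mul_exp_le_one hψ (le_of_lt hp.1) _)

lemma im_integral_contour {s : ℝ} (hs : 0 < s) :
    ∫ t : ℝ, (logResolvent α ((1 / α : ℝ) * (t + ψ * Complex.I)) *
        Complex.exp (t + ψ * Complex.I) / (s - Complex.exp (t + ψ * Complex.I))).im
      = π * ∫ r in Ioi 0, spectralKernel α r * Real.exp (-(r * s ^ (1 / α))) := by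
  have hψ0 : 0 < ψ := by linarith [hψ.1, Real.pi_pos]
  have hρ := one_div_mem_Ioo hα
  obtain ⟨K, hK, h⟩ := exists_norm_logResolvent_mul_exp_le hα hψα
  have hd := differentiable_logResolvent hα.1
  have hes : Complex.exp ((Real.log s : ℝ) : ℂ) = s := by
    rw [← Complex.ofReal_exp, Real.exp_log hs]
  have key := (im_integral_div (G := fun w => logResolvent α ((1 / α : ℝ) * w) * Complex.exp w)
    (D := fun w => s - Complex.exp w) (w₀ := Real.log s) (d := -s)
    (C := K * (2 / (1 / α) ^ 2) * (2 / s)) (T := |Real.log s| + 1) hψ0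
    (fun w _ _ => by fun_prop) (by fun_prop) (by simp [hes])
    (by
      have := (Complex.hasDerivAt_exp ((Real.log s : ℝ) : ℂ)).const_sub (s : ℂ)
      rw [hes] at this
      simpa using this)
    (by linarith)
    (fun w h0 h1 hw he => by
      refine hw (eq_of_exp_mul_eq one_pos (by linarith [hψ.2] : 1 * ψ < 2 * π) h0 h1 ?_)
      rw [Complex.ofReal_one, one_mul, one_mul, hes]
      exact (sub_eq_zero.mp he).symm)
    (fun t => by
      rw [← Complex.ofReal_mul, logResolvent_ofReal, ← Complex.ofReal_exp, ← Complex.ofReal_mul,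
        Complex.ofReal_im])
    (fun t => by
      rw [← Complex.ofReal_exp, ← Complex.ofReal_sub, Complex.ofReal_im])
    (fun w h0 h1 hT => by
      have hu : w.re ≠ 0 := by
        intro hu
        rw [hu, abs_zero] at hT
        linarith [abs_nonneg (Real.log s)]
      have hD : s / 2 ≤ ‖(s : ℂ) - Complex.exp w‖ := by
        have hn : ‖(s : ℂ)‖ = s := by rw [Complex.norm_real, Real.norm_of_nonneg hs.le]
        have h2 := abs_norm_sub_norm_le (s : ℂ) (Complex.exp w)
        rw [hn, Complex.norm_exp] at h2
        refine le_trans ?_ h2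
        have he : (2 : ℝ) ≤ Real.exp 1 := by linarith [Real.add_one_le_exp (1 : ℝ)]
        rcases le_total 0 w.re with hr | hr
        · have : Real.log s + 1 ≤ w.re := by
            rw [abs_of_nonneg hr] at hT
            linarith [le_abs_self (Real.log s)]
          have h3 := Real.exp_le_exp.mpr this
          rw [Real.exp_add, Real.exp_log hs] at h3
          rw [le_abs]
          right
          nlinarith
        · have : w.re + 1 ≤ Real.log s := by
            rw [abs_of_nonpos hr] at hT
            linarith [neg_abs_le (Real.log s)]
          have h3 := Real.exp_le_exp.mpr this
          rw [Real.exp_add, Real.exp_log hs] at h3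
          rw [le_abs]
          left
          nlinarith [Real.exp_pos w.re]
      rw [norm_div]
      calc _ ≤ K * (2 / (1 / α) ^ 2 / w.re ^ 2) / (s / 2) := by
            gcongr
            exact (h w h0 h1).trans
              (mul_le_mul_of_nonneg_left (exp_neg_mul_abs_le hρ.1 hu) hK.le)
        _ = _ := by
            field_simp)).2
  rw [key]
  simp only [hes]
  rw [← Complex.ofReal_mul, logResolvent_eq_kernelLaplace_ofReal hα, ← Complex.ofReal_exp,
    kernelLaplace_ofReal, ← Complex.ofReal_mul, Complex.ofReal_re,
    Real.rpow_def_of_pos hs, mul_comm (Real.log s), div_neg, mul_div_cancel_right₀ _ hs.ne',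
    neg_mul_neg]

/-- The Laplace transform of `hittingDensity`. -/
lemma integral_laplace_hittingDensity {s : ℝ} (hs : 0 < s) :
    IntegrableOn (fun x => Real.exp (-(s * x)) * hittingDensity α x) (Ioi 0) ∧
      ∫ x in Ioi 0, Real.exp (-(s * x)) * hittingDensity α x
        = ∫ r in Ioi 0, spectralKernel α r * Real.exp (-(r * s ^ (1 / α))) := by
  have h := integrable_prod_contour hα hψ hψα hs
  have hl := h.integral_prod_left
  have hsw := integral_integral_swap h
  have hr := h.integral_prod_right
  simp only [Function.uncurry] at hl hr
  have hfun : EqOn (fun x => Real.exp (-(s * x)) * hittingDensity α x) (fun x => 1 / π *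
      (∫ t : ℝ, Complex.exp (-(s * x)) * (Complex.exp (x * Complex.exp (t + ψ * Complex.I)) *
          (logResolvent α ((1 / α : ℝ) * (t + ψ * Complex.I)) *
            Complex.exp (t + ψ * Complex.I)))).im) (Ioi 0) := fun x hx => by
    simp only
    rw [hittingDensity_eq_im_integral hα hψ hx, integral_const_mul,
      show -((s : ℂ) * x) = ((-(s * x) : ℝ) : ℂ) by push_cast; ring, ← Complex.ofReal_exp,
      Complex.im_ofReal_mul]
    ring
  refine ⟨(integrableOn_congr_fun hfun measurableSet_Ioi).mpr (hl.im.const_mul (1 / π)), ?_⟩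
  have him := integral_im hl
  have him' := integral_im hr
  simp only [RCLike.im_to_complex] at him him'
  rw [setIntegral_congr_fun measurableSet_Ioi hfun, integral_const_mul, him, hsw, ← him']
  have hin : ∀ t : ℝ, ∫ x in Ioi (0 : ℝ), Complex.exp (-(s * x)) *
      (Complex.exp (x * Complex.exp (t + ψ * Complex.I)) *
          (logResolvent α ((1 / α : ℝ) * (t + ψ * Complex.I)) *
            Complex.exp (t + ψ * Complex.I))) =
      logResolvent α ((1 / α : ℝ) * (t + ψ * Complex.I)) *
        Complex.exp (t + ψ * Complex.I) / (s - Complex.exp (t + ψ * Complex.I)) := fun t => by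
    have hre : (Complex.exp (t + ψ * Complex.I) - s).re < 0 := by
      rw [Complex.sub_re, Complex.exp_re]
      have := mul_neg_of_pos_of_neg (Real.exp_pos t) (cos_neg_of_mem_Ioo hψ)
      simp
      linarith
    have e : ∀ x : ℝ, Complex.exp (-(s * x)) *
      (Complex.exp (x * Complex.exp (t + ψ * Complex.I)) *
          (logResolvent α ((1 / α : ℝ) * (t + ψ * Complex.I)) *
            Complex.exp (t + ψ * Complex.I))) =
      Complex.exp ((Complex.exp (t + ψ * Complex.I) - s) * x) *
          (logResolvent α ((1 / α : ℝ) * (t + ψ * Complex.I)) *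
            Complex.exp (t + ψ * Complex.I)) := fun x => by
      rw [← mul_assoc, ← Complex.exp_add]
      ring_nf
    simp only [e]
    rw [integral_mul_const, integral_exp_mul_complex_Ioi hre, Complex.ofReal_zero, mul_zero,
      Complex.exp_zero, ← neg_sub (s : ℂ), neg_div_neg_eq]
    ring
  simp only [hin]
  rw [im_integral_contour hα hψ hψα hs, ← mul_assoc, one_div_mul_cancel Real.pi_ne_zero, one_mul]

end Laplace

section Density
variable {α : ℝ} (hα : α ∈ Ioo (1 : ℝ) 2)
include hα

lemma tendsto_kernelLaplace_zero : Filter.Tendsto (fun n : ℕ =>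
    ∫ r in Ioi 0, spectralKernel α r * Real.exp (-(r * (1 / ((n : ℝ) + 1)) ^ (1 / α))))
    Filter.atTop (nhds 1) := by
  have hα0 : 0 < α := by linarith [hα.1]
  have hML := (differentiable_mittagLeffler hα.1).continuous
  set u : ℕ → ℝ := fun n => (1 / ((n : ℝ) + 1)) with hu
  have hu0 : ∀ n, 0 < u n := fun n => by positivity
  have hlim : Filter.Tendsto u Filter.atTop (nhds 0) := tendsto_one_div_add_atTop_nhds_zero_nat
  have hpow : ∀ {p : ℝ}, 0 < p → Filter.Tendsto (fun n => u n ^ p) Filter.atTop (nhds 0) :=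
    fun {p} hp => by
      simpa [Real.zero_rpow hp.ne'] using hlim.rpow_const (Or.inr hp.le)
  have hval : ∀ n, ((∫ r in Ioi 0, spectralKernel α r * Real.exp (-(r * u n ^ (1 / α))) : ℝ) : ℂ)
      = Complex.exp ((u n ^ (1 / α) : ℝ) : ℂ) -
        α * ((u n ^ ((α - 1) * (1 / α)) : ℝ) : ℂ) * mittagLeffler α ((u n : ℝ) : ℂ) := fun n => by
    have e : ∀ p : ℝ, u n ^ p = Real.exp (p * Real.log (u n)) := fun p => by
      rw [Real.rpow_def_of_pos (hu0 n), mul_comm]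
    have e1 : α * (1 / α * Real.log (u n)) = Real.log (u n) := by field_simp
    rw [← kernelLaplace_ofReal, e (1 / α), Complex.ofReal_exp,
      ← logResolvent_eq_kernelLaplace_ofReal hα, logResolvent]
    congr 1
    congr 1
    · rw [e, Complex.ofReal_exp]
      push_cast
      ring_nf
    · rw [← Complex.ofReal_mul, e1, ← Complex.ofReal_exp, Real.exp_log (hu0 n)]
  have hC : Filter.Tendsto (fun n => Complex.exp ((u n ^ (1 / α) : ℝ) : ℂ) -
        α * ((u n ^ ((α - 1) * (1 / α)) : ℝ) : ℂ) * mittagLeffler α ((u n : ℝ) : ℂ))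
      Filter.atTop (nhds (Complex.exp ((0 : ℝ) : ℂ) -
        α * ((0 : ℝ) : ℂ) * mittagLeffler α ((0 : ℝ) : ℂ))) := by
    have hp1 : 0 < 1 / α := by positivity
    have hp2 : 0 < (α - 1) * (1 / α) := mul_pos (by linarith [hα.1]) hp1
    have t1 := (Complex.continuous_ofReal.tendsto 0).comp (hpow hp1)
    have t2 := (Complex.continuous_ofReal.tendsto 0).comp (hpow hp2)
    have t3 := (Complex.continuous_ofReal.tendsto 0).comp hlim
    exact ((Complex.continuous_exp.tendsto _).comp t1).sub
      ((t2.const_mul _).mul ((hML.tendsto _).comp t3))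
  have hR := (Complex.continuous_re.tendsto _).comp hC
  simp only [Complex.ofReal_zero, Complex.exp_zero, mul_zero, zero_mul, sub_zero,
    Complex.one_re] at hR
  refine hR.congr fun n => ?_
  simp only [Function.comp]
  rw [← hval, Complex.ofReal_re]

lemma exists_contour_angle : ∃ ψ : ℝ, ψ ∈ Ioo (π / 2) π ∧ ψ < α * (π / 2) := by
  have hπ := Real.pi_pos
  exact ⟨(1 + α) * (π / 4), ⟨by nlinarith [hα.1], by nlinarith [hα.2]⟩, by nlinarith [hα.1]⟩

lemma hittingDensity_nonneg {x : ℝ} (hx : 0 < x) : 0 ≤ hittingDensity α x := by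
  obtain ⟨ψ, hψ, hψα⟩ := exists_contour_angle hα
  have hL : ∀ k : ℕ, IntegrableOn (fun x => Real.exp (-(((k + 1 : ℕ) : ℝ) * x)) *
      hittingDensity α x) (Ioi 0) ∧ _ :=
    fun k => integral_laplace_hittingDensity hα hψ hψα (Nat.cast_pos.mpr k.succ_pos)
  have h := nonneg_of_laplace_completelyMonotone
    (g := fun x => Real.exp (-x) * hittingDensity α x)
    ((by fun_prop : Continuous fun x : ℝ => Real.exp (-x)).continuousOn.mul
      (continuousOn_hittingDensity hα hψ hψα))
    (by simpa using (hL 0).1)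
    (fun N => by
      have e : (fun k : ℕ => ∫ x in Ioi 0,
          Real.exp (-x) ^ k * (Real.exp (-x) * hittingDensity α x)) = fun k : ℕ =>
          ∫ r in Ioi 0, spectralKernel α r * Real.exp (-(r * ((k + 1 : ℕ) : ℝ) ^ (1 / α))) :=
        funext fun k => by
          rw [← (hL k).2]
          refine integral_congr_ae (Filter.Eventually.of_forall fun x => ?_)
          simp only
          rw [← mul_assoc, ← pow_succ, ← Real.exp_nat_mul, mul_neg]
      rw [e]
      refine CMUpTo.integral ?_ fun k => ?_
      · filter_upwards [ae_restrict_mem measurableSet_Ioi] with r hr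
        exact (CMUpTo.const (spectralKernel_nonneg hα (le_of_lt hr))).mul
          (CMUpTo.exp_neg_mul_rpow (le_of_lt hr) (one_div_mem_Ioo hα))
      · have hz : 0 ≤ ((((k + 1 : ℕ) : ℝ) ^ (1 / α) : ℝ) : ℂ).re := by
          rw [Complex.ofReal_re]
          positivity
        refine (integrableOn_spectralKernel_mul_exp hα hz).re.congr
          (Filter.Eventually.of_forall fun r => ?_)
        simp only [RCLike.re_to_complex]
        rw [← Complex.ofReal_mul, ← Complex.ofReal_neg, ← Complex.ofReal_exp, ← Complex.ofReal_mul,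
          Complex.ofReal_re])
    x hx
  exact (mul_nonneg_iff_of_pos_left (Real.exp_pos _)).mp h

lemma integral_hittingDensity : ∫ x in Ioi 0, hittingDensity α x = 1 := by
  obtain ⟨ψ, hψ, hψα⟩ := exists_contour_angle hα
  have hu0 : ∀ n : ℕ, 0 < 1 / ((n : ℝ) + 1) := fun n => by positivity
  have hL := fun n : ℕ => integral_laplace_hittingDensity hα hψ hψα (hu0 n)
  have hnn : ∀ᵐ x ∂volume.restrict (Ioi 0), 0 ≤ hittingDensity α x := by
    filter_upwards [ae_restrict_mem measurableSet_Ioi] with x hx using hittingDensity_nonneg hα hx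
  have hm : AEStronglyMeasurable (hittingDensity α) (volume.restrict (Ioi 0)) :=
    (continuousOn_hittingDensity hα hψ hψα).aestronglyMeasurable measurableSet_Ioi
  have hmono := lintegral_tendsto_of_tendsto_of_monotone (μ := volume.restrict (Ioi 0))
    (f := fun (n : ℕ) x =>
      ENNReal.ofReal (Real.exp (-(1 / ((n : ℝ) + 1) * x)) * hittingDensity α x))
    (F := fun x => ENNReal.ofReal (hittingDensity α x))
    (fun n => (hL n).1.aestronglyMeasurable.aemeasurable.ennreal_ofReal)
    (by
      filter_upwards [ae_restrict_mem measurableSet_Ioi, hnn] with x hx hx0 n m hnm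
      have hx' : 0 < x := hx
      simp only
      gcongr)
    (by
      refine Filter.Eventually.of_forall fun x => ENNReal.tendsto_ofReal ?_
      have := ((Real.continuous_exp.tendsto _).comp
        ((tendsto_one_div_add_atTop_nhds_zero_nat (𝕜 := ℝ)).mul_const x).neg).mul_const
          (hittingDensity α x)
      simpa using this)
  have hval : ∀ n : ℕ, ∫⁻ x in Ioi 0,
      ENNReal.ofReal (Real.exp (-(1 / ((n : ℝ) + 1) * x)) * hittingDensity α x) =
      ENNReal.ofReal (∫ r in Ioi 0,
        spectralKernel α r * Real.exp (-(r * (1 / ((n : ℝ) + 1)) ^ (1 / α)))) := fun n => by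
    rw [← (hL n).2, ofReal_integral_eq_lintegral_ofReal (hL n).1]
    filter_upwards [hnn] with x hx using mul_nonneg (Real.exp_pos _).le hx
  simp only [hval] at hmono
  have h1 := tendsto_nhds_unique hmono (ENNReal.tendsto_ofReal (tendsto_kernelLaplace_zero hα))
  rw [integral_eq_lintegral_of_nonneg_ae hnn hm, h1, ENNReal.toReal_ofReal zero_le_one]

end Density

/-- For every `α ∈ (1,2)`, the two series defining `h_α(x)` converge
absolutely for every `x > 0`, `h_α` is nonnegative on `(0,∞)`, and
`∫₀^∞ h_α(x) dx = 1`; that is, `h_α` is a probability density on `(0,∞)`. -/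
theorem stmt_4 (α : ℝ) (hα : α ∈ Set.Ioo (1 : ℝ) 2) :
    (∀ x : ℝ, 0 < x →
      Summable (fun n : ℕ => |(-α) * x ^ (1 / α - ((n : ℝ) + 1) - 1) /
          (Real.Gamma (α * ((n : ℝ) + 1)) * Real.Gamma (1 / α - ((n : ℝ) + 1)))|) ∧
      Summable (fun n : ℕ => |x ^ (-((n : ℝ) + 1) / α - 1) /
          (Real.Gamma (-((n : ℝ) + 1) / α) * (Nat.factorial (n + 1) : ℝ))|)) ∧
    (∀ x : ℝ, 0 < x → 0 ≤ hittingDensity α x) ∧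
    ∫ x in Set.Ioi (0 : ℝ), hittingDensity α x = 1 :=
  ⟨fun _ hx => ⟨summable_first_series hα hx, summable_second_series hα hx⟩,
    fun _ hx => hittingDensity_nonneg hα hx, integral_hittingDensity hα⟩
end
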